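/- (Length formula.) Let (R, 𝔪) be a Noetherian local ring with dim R > 0 and R/𝔪 infinite, let I be a proper ideal, let M be a finitely generated R-module, and let d be a positive integer with dim_R M ≤ d. Then for general elements a_1, …, a_{d−1}, a_d of I one has j_d(I, M) = e(I; M/((a_1, …, a_{d−1})M :_M I^∞)) = length_R( M / ( ((a_1, …, a_{d−1})M :_M I^∞) + a_d M ) ). -/

import Mathlib

open Filter

noncomputable section

/-- The length of a module, as the height of `⊤` in the submodule lattice. -/
def mLength (R M : Type*) [CommRing R] [AddCommGroup M] [Module R M] : ℕ∞ :=
  Order.height (⊤ : Submodule R M)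

/-- The Krull dimension of a module, via the annihilator. -/
def mDim (R M : Type*) [CommRing R] [AddCommGroup M] [Module R M] : WithBot ℕ∞ :=
  ringKrullDim (R ⧸ Module.annihilator R M)

/-- `H⁰_I(N)`: elements killed by a power of `I` (0-th local cohomology). -/
def H0 {R : Type*} [CommRing R] (I : Ideal R) (N : Type*) [AddCommGroup N] [Module R N] :
    Submodule R N :=
  ⨆ n : ℕ, Submodule.torsionBySet R N ((I ^ n : Ideal R) : Set R)

/-- `IⁿM/I^{n+1}M`, as a submodule of `M/I^{n+1}M`. -/
def gradedPiece {R : Type*} [CommRing R] (I : Ideal R) {M : Type*} [AddCommGroup M]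
    [Module R M] (n : ℕ) : Submodule R (M ⧸ (I ^ (n + 1) • ⊤ : Submodule R M)) :=
  Submodule.map (I ^ (n + 1) • ⊤ : Submodule R M).mkQ (I ^ n • ⊤ : Submodule R M)

/-- The `j`-multiplicity `j_d(I, M)`, defined as
`lim_n (d−1)!/n^(d−1) · length_R (H⁰_𝔪(IⁿM/I^{n+1}M))`. -/
def jMult {R : Type*} [CommRing R] (𝔪 I : Ideal R) (M : Type*) [AddCommGroup M]
    [Module R M] (d : ℕ) : ℝ :=
  limUnder atTop fun n : ℕ =>
    ((d - 1).factorial : ℝ) / (n : ℝ) ^ (d - 1) *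
      ((mLength R (H0 𝔪 (gradedPiece I (M := M) n))).toNat : ℝ)

/-- The Hilbert–Samuel multiplicity `e(I; N)` of a `d`-dimensional module `N`
(equal to `0` if `N = 0`), defined as `lim_n d!/n^d · length_R (N/IⁿN)`. -/
def hsMult {R : Type*} [CommRing R] (I : Ideal R) (N : Type*) [AddCommGroup N]
    [Module R N] (d : ℕ) : ℝ :=
  limUnder atTop fun n : ℕ =>
    (d.factorial : ℝ) / (n : ℝ) ^ d *
      ((mLength R (N ⧸ (I ^ n • ⊤ : Submodule R N))).toNat : ℝ)

/-- `K :_M I^∞ = ⋃ₙ (K :_M Iⁿ)`. -/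
def satur {R : Type*} [CommRing R] (I : Ideal R) {M : Type*} [AddCommGroup M] [Module R M]
    (K : Submodule R M) : Submodule R M :=
  Submodule.comap K.mkQ (H0 I (M ⧸ K))

/-- "For general elements `a₁, …, aᵢ` of `I`", i.e. for all `i`-tuples of elements of `I`
whose coefficient vectors with respect to any finite generating set of `I` avoid the zero
locus of some nonzero polynomial over the residue field `R/𝔪` (equivalently, whose images
lie in a suitable nonempty Zariski-open set of choices modulo `𝔪I`), property `P` holds. -/
def GeneralElts {R : Type*} [CommRing R] (𝔪 I : Ideal R) (i : ℕ)
    (P : (Fin i → R) → Prop) : Prop :=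
  ∀ (m : ℕ) (x : Fin m → R), Ideal.span (Set.range x) = I →
    ∃ F : MvPolynomial (Fin i × Fin m) R,
      MvPolynomial.map (Ideal.Quotient.mk 𝔪) F ≠ 0 ∧
      ∀ c : Fin i × Fin m → R,
        MvPolynomial.eval (fun p => Ideal.Quotient.mk 𝔪 (c p))
          (MvPolynomial.map (Ideal.Quotient.mk 𝔪) F) ≠ 0 →
        P fun j => ∑ l, c (j, l) * x l

namespace JMul

section Length
variable {R M N : Type*} [CommRing R] [AddCommGroup M] [Module R M] [AddCommGroup N] [Module R N]

lemma mLength_eq : mLength R M = Module.length R M := (Module.length_eq_height R M).symm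

/-- The length of `(A + B) / A`. -/
def rlen (A B : Submodule R M) : ℕ∞ := Module.length R (B.map A.mkQ)

lemma rlen_sup (A B : Submodule R M) : rlen A (A ⊔ B) = rlen A B := by
  unfold rlen
  rw [Submodule.map_sup, Submodule.mkQ_map_self, bot_sup_eq]

lemma rlen_sup' (A B : Submodule R M) : rlen A (B ⊔ A) = rlen A B := by
  rw [sup_comm, rlen_sup]

lemma rlen_map (f : M →ₗ[R] N) (A : Submodule R N) (B : Submodule R M) :
    rlen A (B.map f) = rlen (A.comap f) B := by
  unfold rlen
  have e : (B.map f).map A.mkQ = (B.map (A.comap f).mkQ).map ((A.comap f).mapQ A f le_rfl) := by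
    rw [← Submodule.map_comp, ← Submodule.map_comp, Submodule.mapQ_mkQ]
  rw [e]
  refine (LinearEquiv.length_eq (Submodule.equivMapOfInjective _ ?_ _)).symm
  rw [← LinearMap.ker_eq_bot, Submodule.ker_mapQ, Submodule.mkQ_map_self]

lemma rlen_inf (A B : Submodule R M) : rlen (A ⊓ B) B = rlen A B := by
  have h : ∀ A : Submodule R M, rlen A B = rlen (A.comap B.subtype) ⊤ := fun A => by
    rw [← rlen_map, Submodule.map_subtype_top]
  rw [h, h A]
  congr 1
  ext x; simp

lemma rlen_congr {A A' B : Submodule R M} (h : A ⊓ B = A' ⊓ B) : rlen A B = rlen A' B := by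
  rw [← rlen_inf, h, rlen_inf]

lemma rlen_top (A : Submodule R M) : rlen A ⊤ = Module.length R (M ⧸ A) := by
  unfold rlen
  rw [Submodule.map_top, Submodule.range_mkQ, Module.length_top]

lemma rlen_mono (A : Submodule R M) {B C : Submodule R M} (h : B ≤ C) : rlen A B ≤ rlen A C := by
  unfold rlen
  exact Module.length_le_of_injective (Submodule.inclusion (Submodule.map_mono h))
    (Submodule.inclusion_injective _)

lemma rlen_add {A B C : Submodule R M} (hAB : A ≤ B) (hBC : B ≤ C) :
    rlen A C = rlen A B + rlen B C := by
  unfold rlen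
  have hm : ∀ x ∈ C.map A.mkQ, A.mapQ B LinearMap.id hAB x ∈ C.map B.mkQ := by
    rintro _ ⟨c, hc, rfl⟩
    exact ⟨c, hc, rfl⟩
  refine Module.length_eq_add_of_exact (Submodule.inclusion (Submodule.map_mono hBC))
    ((A.mapQ B LinearMap.id hAB).restrict hm) (Submodule.inclusion_injective _) ?_ ?_
  · rintro ⟨_, c, hc, rfl⟩
    exact ⟨⟨A.mkQ c, c, hc, rfl⟩, rfl⟩
  · rintro ⟨_, c, hc, rfl⟩
    constructor
    · intro h
      have h2 : B.mkQ c = 0 := congrArg Subtype.val h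
      have : c ∈ B := by simpa using h2
      exact ⟨⟨A.mkQ c, c, this, rfl⟩, rfl⟩
    · rintro ⟨⟨_, b, hb, rfl⟩, h⟩
      have h2 : A.mkQ b = A.mkQ c := congrArg Subtype.val h
      have h3 : b - c ∈ A := (Submodule.Quotient.eq A).1 h2
      apply Subtype.ext
      change B.mkQ c = 0
      have : c ∈ B := by
        have := B.sub_mem hb (hAB h3)
        simpa using this
      simpa using this

lemma rlen_antitone {A A' : Submodule R M} (h : A ≤ A') (B : Submodule R M) :
    rlen A' B ≤ rlen A B := by
  unfold rlen
  have e : B.map A'.mkQ = (B.map A.mkQ).map (A.mapQ A' LinearMap.id h) := by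
    rw [← Submodule.map_comp, Submodule.mapQ_mkQ, LinearMap.comp_id]
  rw [e]
  exact Module.length_le_of_surjective (LinearMap.submoduleMap _ _)
    (LinearMap.submoduleMap_surjective _ _)

lemma rlen_eq_zero {A B : Submodule R M} : rlen A B = 0 ↔ B ≤ A := by
  unfold rlen
  rw [Module.length_eq_zero_iff, Submodule.subsingleton_iff_eq_bot, ← le_bot_iff,
    Submodule.map_le_iff_le_comap, Submodule.comap_bot, Submodule.ker_mkQ]

section Finite
variable [IsNoetherianRing R] [IsLocalRing R]
open IsLocalRing

lemma length_ne_top_of_pow [Module.Finite R M] {k : ℕ}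
    (h : (maximalIdeal R ^ k) ≤ Module.annihilator R M) : Module.length R M ≠ ⊤ := by
  by_cases ht : Module.annihilator R M = ⊤
  · have : Subsingleton M := Module.annihilator_eq_top_iff.1 ht
    rw [Module.length_eq_zero]
    exact ENat.zero_ne_top
  have : Nontrivial (R ⧸ Module.annihilator R M) := Ideal.Quotient.nontrivial_iff.2 ht
  have : IsLocalRing (R ⧸ Module.annihilator R M) :=
    .of_surjective' (Ideal.Quotient.mk _) Ideal.Quotient.mk_surjective
  have hA : IsArtinianRing (R ⧸ Module.annihilator R M) := by
    rw [isArtinianRing_iff_isNilpotent_maximalIdeal]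
    refine ⟨k, ?_⟩
    have e : maximalIdeal (R ⧸ Module.annihilator R M)
        = (maximalIdeal R).map (Ideal.Quotient.mk (Module.annihilator R M)) := by
      refine (IsLocalRing.map_maximalIdeal_of_surjective _ Ideal.Quotient.mk_surjective).symm
    rw [e, ← Ideal.map_pow, Ideal.zero_eq_bot, Ideal.map_eq_bot_iff_le_ker, Ideal.mk_ker]
    exact h
  let _ : Module (R ⧸ Module.annihilator R M) M := Module.quotientAnnihilator
  have : IsScalarTower R (R ⧸ Module.annihilator R M) M := inferInstance
  have : Module.Finite (R ⧸ Module.annihilator R M) M := Module.Finite.of_restrictScalars_finite R _ _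
  have hl : Module.length (R ⧸ Module.annihilator R M) M ≠ ⊤ := Module.length_ne_top
  rwa [← Module.length_eq_of_surjective (S := R) (R := R ⧸ Module.annihilator R M) (M := M)
    Ideal.Quotient.mk_surjective] at hl

lemma rlen_ne_top [Module.Finite R M] {A B : Submodule R M} {k : ℕ}
    (h : maximalIdeal R ^ k • B ≤ A) : rlen A B ≠ ⊤ := by
  unfold rlen
  refine length_ne_top_of_pow (k := k) fun r hr => ?_
  rw [Module.mem_annihilator]
  rintro ⟨_, b, hb, rfl⟩
  apply Subtype.ext
  change r • A.mkQ b = 0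
  rw [← map_smul]
  exact (Submodule.Quotient.mk_eq_zero _).2 (h (Submodule.smul_mem_smul hr hb))

end Finite
end Length

section Generic

/-- The iterated filter on tuples: `∀ᶠ e₀, ∀ᶠ e₁, …`. -/
def seqFilter {E : Type*} : (n : ℕ) → (Fin n → Filter E) → Filter (Fin n → E)
  | 0, _ => pure Fin.elim0
  | n + 1, u => (u 0).bind fun e => map (Fin.cons e) (seqFilter n fun i => u i.succ)

lemma eventually_seqFilter_zero {E : Type*} {u : Fin 0 → Filter E} {p : (Fin 0 → E) → Prop} :
    (∀ᶠ c in seqFilter 0 u, p c) ↔ p Fin.elim0 := Iff.rfl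

lemma eventually_seqFilter_succ {E : Type*} {n : ℕ} {u : Fin (n + 1) → Filter E}
    {p : (Fin (n + 1) → E) → Prop} :
    (∀ᶠ c in seqFilter (n + 1) u, p c) ↔
      ∀ᶠ e in u 0, ∀ᶠ c in seqFilter n fun i => u i.succ, p (Fin.cons e c) := Iff.rfl

lemma seqFilter_neBot {E : Type*} : ∀ {n : ℕ} (u : Fin n → Filter E), (∀ i, (u i).NeBot) →
    (seqFilter n u).NeBot
  | 0, _, _ => by unfold seqFilter; infer_instance
  | n + 1, u, h => by
    have h0 := h 0
    have h1 : (seqFilter n fun i => u i.succ).NeBot := seqFilter_neBot _ fun i => h _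
    rw [← Filter.eventually_false_iff_eq_bot.not.trans Filter.neBot_iff.symm,
      eventually_seqFilter_succ]
    simp [h0.ne, h1.ne]

variable {R : Type*} [CommRing R] [IsLocalRing R]
open IsLocalRing

/-- A filter on `R` avoiding each residue class. -/
structure IsGeneric (𝓤 : Filter R) : Prop where
  neBot : 𝓤.NeBot
  avoid : ∀ r₀, ∀ᶠ r in 𝓤, r - r₀ ∉ maximalIdeal R

/-- A filter on `R^m` avoiding each proper submodule. -/
structure IsGenericRow {m : ℕ} (𝓤 : Filter (Fin m → R)) : Prop where
  neBot : 𝓤.NeBot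
  avoid : ∀ W : Submodule R (Fin m → R), W ≠ ⊤ → ∀ᶠ c in 𝓤, c ∉ W

lemma linear_avoid : ∀ {m : ℕ} (u : Fin m → Filter R), (∀ i, IsGeneric (u i)) →
    ∀ (t : R) (b : Fin m → R), (∃ l, b l ∉ maximalIdeal R) →
    ∀ᶠ c in seqFilter m u, t + ∑ l, b l * c l ∉ maximalIdeal R
  | 0, u, _, t, b, ⟨l, _⟩ => l.elim0
  | m + 1, u, hu, t, b, hb => by
    rw [eventually_seqFilter_succ]
    by_cases h : ∃ l : Fin m, b l.succ ∉ maximalIdeal R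
    · refine Eventually.of_forall fun e => ?_
      refine (linear_avoid (fun i => u i.succ) (fun i => hu _) (t + b 0 * e)
        (fun l => b l.succ) h).mono fun c hc => ?_
      simpa [Fin.sum_univ_succ, add_assoc] using hc
    · push Not at h
      have h0 : b 0 ∉ maximalIdeal R := by
        obtain ⟨l, hl⟩ := hb
        refine Fin.cases (fun h => h) (fun i hi => absurd (h i) hi) l hl
      have hu0 : IsUnit (b 0) := by simpa using h0
      obtain ⟨v, hv⟩ := hu0
      filter_upwards [(hu 0).avoid (-(↑v⁻¹ * t))] with e he
      refine Eventually.of_forall fun c hc => he ?_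
      simp only [Fin.sum_univ_succ, Fin.cons_zero, Fin.cons_succ] at hc
      have h2 : ∑ i : Fin m, b i.succ * c i ∈ maximalIdeal R :=
        Ideal.sum_mem _ fun i _ => Ideal.mul_mem_right _ _ (h i)
      have h3 : t + b 0 * e ∈ maximalIdeal R := by
        have := Ideal.sub_mem _ hc h2
        convert this using 1; ring
      have h4 := Ideal.mul_mem_left _ (↑v⁻¹ : R) h3
      convert h4 using 1
      rw [← hv, mul_add, ← mul_assoc, Units.inv_mul, one_mul]; ring

lemma exists_linear_of_ne_top {m : ℕ} (W : Submodule R (Fin m → R)) (hW : W ≠ ⊤) :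
    ∃ b : Fin m → R, (∃ l, b l ∉ maximalIdeal R) ∧
      ∀ c ∈ W, ∑ l, b l * c l ∈ maximalIdeal R := by
  classical
  let k := ResidueField R
  let π : (Fin m → R) →ₗ[R] (Fin m → k) := (Algebra.linearMap R k).compLeft (Fin m)
  have hπ : ∀ c l, π c l = residue R (c l) := fun _ _ => rfl
  let W' : Submodule k (Fin m → k) := Submodule.span k (π '' W)
  have hmap : ∀ w ∈ W', ∃ c ∈ W, π c = w := by
    intro w hw
    induction hw using Submodule.span_induction with
    | mem x h => exact h
    | zero => exact ⟨0, W.zero_mem, map_zero _⟩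
    | add x y _ _ hx hy =>
      obtain ⟨c, hc, rfl⟩ := hx; obtain ⟨d, hd, rfl⟩ := hy
      exact ⟨c + d, W.add_mem hc hd, map_add _ _ _⟩
    | smul a x _ hx =>
      obtain ⟨c, hc, rfl⟩ := hx
      obtain ⟨r, rfl⟩ := residue_surjective a
      refine ⟨r • c, W.smul_mem _ hc, ?_⟩
      rw [map_smul]; rfl
  have hW' : W' ≠ ⊤ := by
    intro h
    apply hW
    refine top_le_iff.1 (Submodule.le_of_le_smul_of_le_jacobson_bot (I := maximalIdeal R)
      (Module.Finite.fg_top) (IsLocalRing.maximalIdeal_le_jacobson _) ?_)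
    rintro c -
    obtain ⟨w, hw, hcw⟩ := hmap (π c) (h ▸ Submodule.mem_top)
    have h2 : c - w ∈ (maximalIdeal R • ⊤ : Submodule R (Fin m → R)) := by
      have h3 : ∀ l, (c - w) l ∈ maximalIdeal R := by
        intro l
        rw [← residue_eq_zero_iff, ← hπ, map_sub, hcw, sub_self]; rfl
      rw [pi_eq_sum_univ (c - w)]
      exact Submodule.sum_mem _ fun i _ => Submodule.smul_mem_smul (h3 i) Submodule.mem_top
    have := Submodule.add_mem_sup hw h2
    simpa using this
  obtain ⟨φ, hφ, hφW⟩ := Submodule.exists_le_ker_of_lt_top W' (lt_top_iff_ne_top.2 hW')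
  choose b hb using fun l => residue_surjective (R := R) (φ (Pi.single l 1))
  have key : ∀ c, residue R (∑ l, b l * c l) = φ (π c) := by
    intro c
    rw [pi_eq_sum_univ (π c), map_sum, map_sum]
    refine Finset.sum_congr rfl fun l _ => ?_
    rw [map_mul, hb, map_smul, hπ, smul_eq_mul, mul_comm]
    congr 2
    ext j; simp [Pi.single_apply, eq_comm]
  refine ⟨b, ?_, fun c hc => ?_⟩
  · by_contra! h
    apply hφ
    ext l
    simp only [LinearMap.comp_apply, LinearMap.coe_single, LinearMap.zero_apply]
    rw [← hb, residue_eq_zero_iff]; exact h l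
  · rw [← residue_eq_zero_iff, key]
    exact hφW (Submodule.subset_span ⟨c, hc, rfl⟩)

lemma isGenericRow_seqFilter {m : ℕ} (u : Fin m → Filter R) (hu : ∀ i, IsGeneric (u i)) :
    IsGenericRow (seqFilter m u) where
  neBot := seqFilter_neBot u fun i => (hu i).neBot
  avoid W hW := by
    obtain ⟨b, hb, hb'⟩ := exists_linear_of_ne_top W hW
    filter_upwards [linear_avoid u hu 0 b hb] with c hc h
    exact hc (by simpa using hb' c h)

/-- Nonzero polynomials over the residue field are eventually nonzero. -/
def PolyGeneric {E σ : Type*} (co : E → σ → R) (𝓤 : Filter E) : Prop :=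
  ∀ p : MvPolynomial σ (ResidueField R), p ≠ 0 →
    ∀ᶠ e in 𝓤, MvPolynomial.eval (fun s => residue R (co e s)) p ≠ 0

lemma PolyGeneric.seqFilter {E σ : Type*} (co : E → σ → R) : ∀ {n : ℕ} (u : Fin n → Filter E),
    (∀ i, PolyGeneric co (u i)) →
    PolyGeneric (fun (c : Fin n → E) (s : Fin n × σ) => co (c s.1) s.2) (seqFilter n u)
  | 0, u, _ => by
    intro p hp
    rw [eventually_seqFilter_zero]
    rwa [MvPolynomial.eq_C_of_isEmpty p, MvPolynomial.eval_C, ← (MvPolynomial.C_injective _ _).ne_iff' (map_zero _),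
      ← MvPolynomial.eq_C_of_isEmpty p]
  | n + 1, u, hu => by
    intro p hp
    rw [eventually_seqFilter_succ]
    let f : (Fin n × σ) ⊕ σ ≃ Fin (n + 1) × σ :=
      { toFun := Sum.elim (fun s => (s.1.succ, s.2)) fun s => (0, s)
        invFun := fun s => Fin.cases (Sum.inr s.2) (fun i => Sum.inl (i, s.2)) s.1
        left_inv := by rintro (s | s) <;> simp
        right_inv := by
          rintro ⟨i, s⟩
          refine Fin.cases ?_ (fun i => ?_) i <;> simp }
    let q := MvPolynomial.sumAlgEquiv (ResidueField R) (Fin n × σ) σ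
      (MvPolynomial.rename f.symm p)
    have hq : q ≠ 0 := by
      simp only [q, ne_eq, EmbeddingLike.map_eq_zero_iff]
      rwa [(MvPolynomial.rename_injective _ f.symm.injective).eq_iff' (map_zero _)]
    obtain ⟨w, hw⟩ := MvPolynomial.ne_zero_iff.1 hq
    filter_upwards [hu 0 _ hw] with e he
    have h1 : MvPolynomial.map (MvPolynomial.eval fun s => residue R (co e s)) q ≠ 0 := by
      rw [MvPolynomial.ne_zero_iff]
      exact ⟨w, by rwa [MvPolynomial.coeff_map]⟩
    filter_upwards [PolyGeneric.seqFilter co (fun i => u i.succ) (fun i => hu _) _ h1] with c hc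
    convert hc using 1
    have key : ∀ v : Fin (n + 1) × σ → ResidueField R,
        MvPolynomial.eval v p = MvPolynomial.eval (fun s => v (f (Sum.inl s)))
          (MvPolynomial.map (MvPolynomial.eval fun s => v (f (Sum.inr s))) q) := by
      intro v
      have : p = MvPolynomial.rename f (MvPolynomial.rename f.symm p) := by
        rw [MvPolynomial.rename_rename]; simp
      rw [this, MvPolynomial.eval_rename]
      simp only [q]
      generalize MvPolynomial.rename f.symm p = p'
      induction p' using MvPolynomial.induction_on with
      | C a => simp
      | add a b ha hb => simp [ha, hb]
      | mul_X a s ha => rcases s with s | s <;> simp [ha]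
    rw [key]
    rfl

lemma polyGeneric_of_isGeneric {𝓤 : Filter R} (h : IsGeneric 𝓤) :
    PolyGeneric (fun (r : R) (_ : Unit) => r) 𝓤 := by
  intro p hp
  classical
  let q := MvPolynomial.uniqueAlgEquiv (ResidueField R) Unit p
  have hq : q ≠ 0 := by simpa only [q, ne_eq, EmbeddingLike.map_eq_zero_iff] using hp
  have : ∀ᶠ r in 𝓤, ∀ z ∈ q.roots.toFinset, residue R r ≠ z := by
    rw [Filter.eventually_all_finset]
    intro z _
    obtain ⟨r₀, rfl⟩ := residue_surjective z
    filter_upwards [h.avoid r₀] with r hr h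
    exact hr (by rw [← residue_eq_zero_iff, map_sub, h, sub_self])
  filter_upwards [this] with r hr h0
  refine hr (residue R r) ?_ rfl
  rw [Multiset.mem_toFinset, Polynomial.mem_roots hq, Polynomial.IsRoot, ← h0]
  have := MvPolynomial.eval₂_const_uniqueAlgEquiv (f := p) (φ := RingHom.id _) (a := residue R r)
  rw [Polynomial.eval, MvPolynomial.eval]
  exact this

lemma eventually_eval_ne_zero {d m : ℕ} (u : Fin d → Fin m → Filter R)
    (hu : ∀ i j, IsGeneric (u i j)) (p : MvPolynomial (Fin d × Fin m) (ResidueField R))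
    (hp : p ≠ 0) : ∀ᶠ c in seqFilter d fun i => seqFilter m (u i),
      MvPolynomial.eval (fun s : Fin d × Fin m => residue R (c s.1 s.2)) p ≠ 0 := by
  have h := PolyGeneric.seqFilter _ _ fun i =>
    PolyGeneric.seqFilter _ (u i) fun j => polyGeneric_of_isGeneric (hu i j)
  let f : Fin d × Fin m → Fin d × (Fin m × Unit) := fun s => (s.1, (s.2, ()))
  have hf : Function.Injective f := by
    rintro ⟨a, b⟩ ⟨c, d⟩ h; simpa [f] using h
  have h1 := h (MvPolynomial.rename f p)
    (by rwa [ne_eq, (MvPolynomial.rename_injective _ hf).eq_iff' (map_zero _)])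
  simp only [MvPolynomial.eval_rename] at h1
  exact h1

end Generic

section Avoid
set_option linter.unusedSectionVars false
variable {R S : Type*} [CommRing R] [CommRing S] [Algebra R S]

/-- The linear combination of a tuple with given coefficients. -/
def lin {R S : Type*} [CommRing R] [AddCommGroup S] [Module R S] {m : ℕ} (ξ : Fin m → S) :
    (Fin m → R) →ₗ[R] S := Fintype.linearCombination R ξ

lemma lin_apply {R S : Type*} [CommRing R] [AddCommGroup S] [Module R S] {m : ℕ} (ξ : Fin m → S)
    (c : Fin m → R) : lin ξ c = ∑ l, c l • ξ l := rfl

lemma lin_mem {m : ℕ} (ξ : Fin m → S) (c : Fin m → R) :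
    lin ξ c ∈ Ideal.span (Set.range ξ) := by
  rw [lin_apply]
  refine Ideal.sum_mem _ fun l _ => ?_
  rw [Algebra.smul_def]
  exact Ideal.mul_mem_left _ _ (Ideal.subset_span ⟨l, rfl⟩)

variable [IsLocalRing R]

lemma eventually_lin_notMem {m : ℕ} {𝓤 : Filter (Fin m → R)} (h : IsGenericRow 𝓤)
    (ξ : Fin m → S) (P : Ideal S) (hP : ¬ Ideal.span (Set.range ξ) ≤ P) :
    ∀ᶠ c in 𝓤, lin ξ c ∉ P := by
  have : (P.restrictScalars R).comap (lin ξ) ≠ ⊤ := by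
    intro htop
    apply hP
    rw [Ideal.span_le]
    rintro _ ⟨l, rfl⟩
    have : Pi.single l 1 ∈ (P.restrictScalars R).comap (lin ξ) := htop ▸ Submodule.mem_top
    simpa [lin] using this
  exact (h.avoid _ this).mono fun c hc h => hc h

lemma eventually_forall_lin_notMem {m : ℕ} {𝓤 : Filter (Fin m → R)} (h : IsGenericRow 𝓤)
    (ξ : Fin m → S) {s : Set (Ideal S)} (hs : s.Finite) :
    ∀ᶠ c in 𝓤, ∀ P ∈ s, lin ξ c ∈ P → Ideal.span (Set.range ξ) ≤ P := by
  rw [Filter.eventually_all_finite hs]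
  intro P _
  by_cases hP : Ideal.span (Set.range ξ) ≤ P
  · exact Eventually.of_forall fun _ _ => hP
  · exact (eventually_lin_notMem h ξ P hP).mono fun c hc h => absurd h hc

variable [IsNoetherianRing S] {E : Type*} [AddCommGroup E] [Module S E] [Module.Finite S E]

lemma exists_pow_le_annihilator (X : Ideal S) (h : ∀ P ∈ associatedPrimes S E, X ≤ P) :
    ∃ k, X ^ k ≤ Module.annihilator S E := by
  refine Ideal.exists_pow_le_of_le_radical_of_fg ?_ (IsNoetherian.noetherian X)
  rw [← Ideal.sInf_minimalPrimes]
  exact le_sInf fun P hP => h P (Module.associatedPrimes.minimalPrimes_annihilator_subset_associatedPrimes S E hP)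

lemma eventually_pow_regular {m : ℕ} {𝓤 : Filter (Fin m → R)} (h : IsGenericRow 𝓤)
    (ξ : Fin m → S) :
    ∀ᶠ c in 𝓤, ∃ n₀, ∀ n ≥ n₀, ∀ e ∈ (Ideal.span (Set.range ξ) ^ n • ⊤ : Submodule S E),
      lin ξ c • e = 0 → e = 0 := by
  filter_upwards [eventually_forall_lin_notMem h ξ (associatedPrimes.finite S E)] with c hc
  set X := Ideal.span (Set.range ξ)
  let N : Submodule S E := LinearMap.ker (LinearMap.lsmul S E (lin ξ c))
  obtain ⟨k, hk⟩ : ∃ k, X ^ k ≤ Module.annihilator S N := by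
    refine exists_pow_le_annihilator X fun P hP => ?_
    refine hc P (associatedPrimes.subset_of_injective (f := N.subtype) N.subtype_injective hP) ?_
    refine IsAssociatedPrime.annihilator_le hP ?_
    rw [Submodule.mem_annihilator]
    rintro ⟨y, hy⟩ -
    exact Subtype.ext hy
  obtain ⟨k', hk'⟩ := Ideal.exists_pow_inf_eq_pow_smul X N
  refine ⟨k' + k, fun n hn e he h0 => ?_⟩
  have h1 : e ∈ X ^ n • (⊤ : Submodule S E) ⊓ N := ⟨he, h0⟩
  rw [hk' n (by lia)] at h1
  have h2 : X ^ (n - k') • (X ^ k' • (⊤ : Submodule S E) ⊓ N) ≤ X ^ k • N :=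
    Submodule.smul_mono (Ideal.pow_le_pow_right (by lia)) inf_le_right
  have h3 : X ^ k • N ≤ ⊥ := by
    rw [Submodule.smul_le]
    intro r hr y hy
    have := Module.mem_annihilator.1 (hk hr) ⟨y, hy⟩
    exact congrArg Subtype.val this
  simpa using h3 (h2 h1)

end Avoid

section Rees
variable {R M : Type*} [CommRing R] [AddCommGroup M] [Module R M]

/-- A family of submodules compatible with multiplication by `I`. -/
structure GFam (I : Ideal R) (M : Type*) [AddCommGroup M] [Module R M] where
  N : ℕ → Submodule R M
  smul_le : ∀ i, I • N i ≤ N (i + 1)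

variable {I : Ideal R}

lemma GFam.pow_smul_le (F : GFam I M) (i j : ℕ) : I ^ i • F.N j ≤ F.N (i + j) := by
  induction i with
  | zero => simp
  | succ _ ih =>
    rw [pow_succ', mul_smul, add_assoc, add_comm 1, ← add_assoc]
    exact (smul_mono_right _ ih).trans (F.smul_le _)

variable (I) in
/-- The Rees algebra, as a type with sealed instances. -/
def Rees : Type _ := reesAlgebra I

instance : CommRing (Rees I) := inferInstanceAs (CommRing (reesAlgebra I))
instance : Algebra R (Rees I) := inferInstanceAs (Algebra R (reesAlgebra I))
instance [IsNoetherianRing R] : IsNoetherianRing (Rees I) :=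
  inferInstanceAs (IsNoetherianRing (reesAlgebra I))
instance [IsNoetherianRing R] : Algebra.FiniteType R (Rees I) :=
  inferInstanceAs (Algebra.FiniteType R (reesAlgebra I))

/-- The polynomial module as a module over the Rees algebra. -/
def RMod {R : Type*} [CommRing R] (_I : Ideal R) (M : Type*) [AddCommGroup M] [Module R M] :
    Type _ := PolynomialModule R M

instance : AddCommGroup (RMod I M) := inferInstanceAs (AddCommGroup (PolynomialModule R M))
instance : Module (Rees I) (RMod I M) :=
  inferInstanceAs (Module (reesAlgebra I) (PolynomialModule R M))
instance : Module R (RMod I M) := inferInstanceAs (Module R (PolynomialModule R M))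
instance : IsScalarTower R (Rees I) (RMod I M) :=
  inferInstanceAs (IsScalarTower R (reesAlgebra I) (PolynomialModule R M))

/-- Coefficients of elements of the Rees algebra. -/
def Rees.cf (n : ℕ) : Rees I →ₗ[R] R :=
  (Polynomial.lcoeff R n).comp (reesAlgebra I).val.toLinearMap

lemma Rees.cf_mem (n : ℕ) (f : Rees I) : f.cf n ∈ I ^ n := f.2 n

lemma Rees.ext {f g : Rees I} (h : ∀ n, f.cf n = g.cf n) : f = g :=
  Subtype.ext (Polynomial.ext h)

/-- Coefficients of elements of the polynomial module. -/
def RMod.cf (n : ℕ) : RMod I M →ₗ[R] M :=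
  (Finsupp.lapply n).comp (PolynomialModule.coeffLinearEquiv R R).toLinearMap

lemma RMod.ext {f g : RMod I M} (h : ∀ n, RMod.cf n f = RMod.cf n g) : f = g :=
  PolynomialModule.coeff_injective (Finsupp.ext h)

variable (I) in
/-- Homogeneous elements of the polynomial module. -/
def RMod.sg (n : ℕ) : M →ₗ[R] RMod I M := PolynomialModule.lsingle R n

lemma RMod.cf_sg_self (n : ℕ) (y : M) : RMod.cf n (RMod.sg I n y) = y := by
  change (PolynomialModule.lsingle R n y).coeff n = y
  rw [PolynomialModule.lsingle_apply, if_pos rfl]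

lemma RMod.cf_sg_ne {n k : ℕ} (h : n ≠ k) (y : M) : RMod.cf k (RMod.sg I n y) = 0 := by
  change (PolynomialModule.lsingle R n y).coeff k = 0
  rw [PolynomialModule.lsingle_apply, if_neg h]

lemma RMod.cf_smul (r : Rees I) (f : RMod I M) (n : ℕ) :
    RMod.cf n (r • f) = ∑ p ∈ Finset.HasAntidiagonal.antidiagonal n, r.cf p.1 • RMod.cf p.2 f :=
  PolynomialModule.smul_apply _ _ _

lemma RMod.eq_sum (f : RMod I M) : ∃ s : Finset ℕ, f = ∑ n ∈ s, RMod.sg I n (RMod.cf n f) ∧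
    ∀ n ∉ s, RMod.cf n f = 0 := by
  refine ⟨(PolynomialModule.coeff f).support, RMod.ext fun n => ?_, fun n hn => ?_⟩
  · rw [map_sum]
    by_cases h : n ∈ (PolynomialModule.coeff f).support
    · rw [Finset.sum_eq_single_of_mem n h, RMod.cf_sg_self]
      exact fun k _ hk => RMod.cf_sg_ne hk _
    · rw [Finset.sum_eq_zero]
      · exact Finsupp.notMem_support_iff.1 h
      · rintro k hk
        refine RMod.cf_sg_ne (fun e => h ?_) _
        rwa [← e]
  · exact Finsupp.notMem_support_iff.1 hn

/-- The Rees submodule of `M[X]` of a compatible family. -/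
def GFam.sub (F : GFam I M) : Submodule (Rees I) (RMod I M) where
  carrier := { f | ∀ i, RMod.cf i f ∈ F.N i }
  add_mem' hf hg i := by rw [map_add]; exact Submodule.add_mem _ (hf i) (hg i)
  zero_mem' i := by rw [map_zero]; exact Submodule.zero_mem _
  smul_mem' r f hf i := by
    rw [RMod.cf_smul]
    apply Submodule.sum_mem
    rintro ⟨j, k⟩ e
    rw [Finset.HasAntidiagonal.mem_antidiagonal] at e
    subst e
    exact F.pow_smul_le j k (Submodule.smul_mem_smul (r.cf_mem j) (hf k))

lemma GFam.mem_sub (F : GFam I M) (f : RMod I M) :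
    f ∈ F.sub ↔ ∀ i, RMod.cf i f ∈ F.N i := Iff.rfl

lemma GFam.sg_mem_sub (F : GFam I M) {n : ℕ} {y : M} :
    RMod.sg I n y ∈ F.sub ↔ y ∈ F.N n := by
  rw [F.mem_sub]
  constructor
  · intro h; simpa [RMod.cf_sg_self] using h n
  · intro h j
    by_cases hj : n = j
    · subst hj; rwa [RMod.cf_sg_self]
    · rw [RMod.cf_sg_ne hj]; exact Submodule.zero_mem _

lemma GFam.sub_mono {F G : GFam I M} (h : ∀ n, F.N n ≤ G.N n) : F.sub ≤ G.sub :=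
  fun _ hf i => h i (hf i)

/-- The family `I^n M`. -/
def powFam {R : Type*} [CommRing R] (I : Ideal R) (M : Type*) [AddCommGroup M] [Module R M] :
    GFam I M where
  N n := I ^ n • ⊤
  smul_le i := by rw [← mul_smul, ← pow_succ']

instance powFam_finite [IsNoetherianRing R] [Module.Finite R M] :
    Module.Finite (Rees I) (powFam I M).sub := by
  have h : (I.stableFiltration (⊤ : Submodule R M)).submodule.FG := by
    rw [Ideal.Filtration.submodule_fg_iff_stable]
    · exact I.stableFiltration_stable ⊤
    · exact fun i => IsNoetherian.noetherian _
  rw [Module.Finite.iff_fg]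
  exact h

/-- Quotient of Rees modules. -/
abbrev GQuot (F G : GFam I M) := F.sub ⧸ G.sub.comap F.sub.subtype

lemma finite_sub [IsNoetherianRing R] [Module.Finite R M] {F : GFam I M}
    (h : ∀ n, F.N n ≤ I ^ n • ⊤) : Module.Finite (Rees I) F.sub := by
  have hle : F.sub ≤ (powFam I M).sub := GFam.sub_mono h
  exact Module.Finite.of_injective (Submodule.inclusion hle) (Submodule.inclusion_injective hle)

/-- The element `r t` of the Rees algebra. -/
def rt (r : I) : Rees I :=
  (⟨Polynomial.monomial 1 (r : R), reesAlgebra.monomial_mem.2 (by simp)⟩ : reesAlgebra I)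

lemma cf_rt_smul_succ (r : I) (f : RMod I M) (n : ℕ) :
    RMod.cf (n + 1) (rt r • f) = (r : R) • RMod.cf n f := by
  change ((Polynomial.monomial 1 (r : R)) • (show PolynomialModule R M from f)).coeff (n + 1) = _
  rw [PolynomialModule.monomial_smul_apply, if_pos (by lia)]
  rfl

lemma cf_rt_smul_zero (r : I) (f : RMod I M) : RMod.cf 0 (rt r • f) = 0 := by
  change ((Polynomial.monomial 1 (r : R)) • (show PolynomialModule R M from f)).coeff 0 = _
  rw [PolynomialModule.monomial_smul_apply, if_neg (by lia)]

lemma rt_smul_sg (r : I) (n : ℕ) (y : M) :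
    rt r • RMod.sg I n y = RMod.sg I (n + 1) ((r : R) • y) := by
  refine RMod.ext fun k => ?_
  rcases k with _ | k
  · rw [cf_rt_smul_zero, RMod.cf_sg_ne (by lia)]
  · rw [cf_rt_smul_succ]
    by_cases h : n = k
    · subst h; rw [RMod.cf_sg_self, RMod.cf_sg_self]
    · rw [RMod.cf_sg_ne h, RMod.cf_sg_ne (by lia), smul_zero]

variable {m : ℕ} {x : Fin m → R}

/-- Generators `x_l t` of the irrelevant ideal. -/
def xt (hx : Ideal.span (Set.range x) = I) (l : Fin m) : Rees I :=
  rt ⟨x l, hx ▸ Ideal.subset_span ⟨l, rfl⟩⟩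

lemma lin_mem_of_eq (hx : Ideal.span (Set.range x) = I) (c : Fin m → R) : lin x c ∈ I :=
  hx ▸ lin_mem x c

lemma lin_xt (hx : Ideal.span (Set.range x) = I) (c : Fin m → R) :
    lin (xt hx) c = rt ⟨lin x c, lin_mem_of_eq hx c⟩ := by
  apply Rees.ext
  intro n
  change _ = (Polynomial.monomial 1 (lin x c)).coeff n
  rw [lin_apply, map_sum, Polynomial.coeff_monomial]
  have : ∀ l, Rees.cf n (xt hx l) = if 1 = n then x l else 0 := fun l =>
    Polynomial.coeff_monomial ..
  simp only [map_smul, this, lin_apply]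
  split_ifs <;> simp

lemma exists_lin_eq (hx : Ideal.span (Set.range x) = I) {r : R} (hr : r ∈ I) :
    ∃ c : Fin m → R, lin x c = r := by
  rw [← hx, Ideal.mem_span_range_iff_exists_fun] at hr
  obtain ⟨c, hc⟩ := hr
  exact ⟨c, by simpa [lin_apply] using hc⟩

lemma rt_mem_span (hx : Ideal.span (Set.range x) = I) (r : I) :
    rt r ∈ Ideal.span (Set.range (xt hx)) := by
  obtain ⟨c, hc⟩ := exists_lin_eq hx r.2
  have : rt r = lin (xt hx) c := by
    rw [lin_xt]; congr 1; exact Subtype.ext hc.symm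
  rw [this]
  exact lin_mem _ _

lemma sg_mem_pow (hx : Ideal.span (Set.range x) = I) : ∀ (n : ℕ) (y : M),
    y ∈ (I ^ n • ⊤ : Submodule R M) → ∃ e : (powFam I M).sub, (e : RMod I M) = RMod.sg I n y ∧
      e ∈ (Ideal.span (Set.range (xt hx)) ^ n • ⊤ : Submodule (Rees I) (powFam I M).sub)
  | 0, y, hy => ⟨⟨RMod.sg I 0 y, (powFam I M).sg_mem_sub.2 hy⟩, rfl, by simp⟩
  | n + 1, y, hy => by
    rw [pow_succ', mul_smul] at hy
    refine Submodule.smul_induction_on hy (fun r hr z hz => ?_) (fun a b ha hb => ?_)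
    · 
      obtain ⟨e, he, he'⟩ := sg_mem_pow hx n z hz
      refine ⟨rt ⟨r, hr⟩ • e, ?_, ?_⟩
      · rw [Submodule.coe_smul, he, rt_smul_sg]
      · rw [pow_succ', mul_smul]
        exact Submodule.smul_mem_smul (rt_mem_span hx ⟨r, hr⟩) he'
    · obtain ⟨e, he, he'⟩ := ha
      obtain ⟨f, hf, hf'⟩ := hb
      exact ⟨e + f, by rw [Submodule.coe_add, he, hf, map_add], Submodule.add_mem _ he' hf'⟩

lemma eventually_regular [IsNoetherianRing R] [IsLocalRing R] [Module.Finite R M]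
    (hx : Ideal.span (Set.range x) = I) {𝓤 : Filter (Fin m → R)} (h : IsGenericRow 𝓤)
    (G : GFam I M) :
    ∀ᶠ c in 𝓤, ∃ n₀, ∀ n ≥ n₀, ∀ y ∈ (I ^ n • ⊤ : Submodule R M),
      lin x c • y ∈ G.N (n + 1) → y ∈ G.N n := by
  filter_upwards [eventually_pow_regular (E := GQuot (powFam I M) G) h (xt hx)] with c hc
  obtain ⟨n₀, hn₀⟩ := hc
  refine ⟨n₀, fun n hn y hy hay => ?_⟩
  obtain ⟨e, he, he'⟩ := sg_mem_pow hx n y hy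
  set π := (G.sub.comap (powFam I M).sub.subtype).mkQ
  have h1 : π e ∈ (Ideal.span (Set.range (xt hx)) ^ n • ⊤ :
      Submodule (Rees I) (GQuot (powFam I M) G)) := by
    have := Submodule.mem_map_of_mem (f := π) he'
    rw [Submodule.map_smul''] at this
    exact Submodule.smul_mono le_rfl le_top this
  have h2 := hn₀ n hn _ h1 (by
    rw [← map_smul, lin_xt]
    refine (Submodule.Quotient.mk_eq_zero _).2 ?_
    rw [Submodule.mem_comap]
    change rt ⟨lin x c, lin_mem_of_eq hx c⟩ • (e : RMod I M) ∈ _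
    rw [he, rt_smul_sg, G.sg_mem_sub]
    exact hay)
  have h3 := (Submodule.Quotient.mk_eq_zero _).1 h2
  rw [Submodule.mem_comap] at h3
  change (e : RMod I M) ∈ _ at h3
  rwa [he, G.sg_mem_sub] at h3

end Rees

section Dim
set_option linter.unusedSectionVars false

/-- All primes containing the annihilator have coheight at most `k`. -/
def DimLE (S E : Type*) [CommRing S] [AddCommGroup E] [Module S E] (k : ℕ) : Prop :=
  ∀ P : PrimeSpectrum S, Module.annihilator S E ≤ P.asIdeal → Order.coheight P ≤ k

lemma coheight_le_ringKrullDim_quotient {S : Type*} [CommRing S] {J : Ideal S} {P : PrimeSpectrum S}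
    (h : J ≤ P.asIdeal) : (Order.coheight P : WithBot ℕ∞) ≤ ringKrullDim (S ⧸ J) := by
  rw [ringKrullDim_quotient, Order.coheight_eq_krullDim_Ici]
  refine Order.krullDim_le_of_strictMono
    (fun Q : Set.Ici P => (⟨Q.1, (PrimeSpectrum.mem_zeroLocus _ _).2 (h.trans Q.2)⟩ :
      PrimeSpectrum.zeroLocus (J : Set S))) fun a b hab => hab

lemma ringKrullDim_quotient_le_of {S : Type*} [CommRing S] {J : Ideal S} {k : ℕ}
    (h : ∀ P : PrimeSpectrum S, J ≤ P.asIdeal → Order.coheight P ≤ k) :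
    ringKrullDim (S ⧸ J) ≤ (k : WithBot ℕ∞) := by
  rw [ringKrullDim_quotient, Order.krullDim_eq_iSup_coheight]
  refine iSup_le fun P => ?_
  have h1 := Order.coheight_le_coheight_apply_of_strictMono
    (Subtype.val : PrimeSpectrum.zeroLocus (J : Set S) → PrimeSpectrum S) (fun _ _ h => h) P
  exact_mod_cast h1.trans (h _ ((PrimeSpectrum.mem_zeroLocus _ _).1 P.2))

lemma dimLE_of_mDim_le {R M : Type*} [CommRing R] [AddCommGroup M] [Module R M] {d : ℕ}
    (h : mDim R M ≤ (d : WithBot ℕ∞)) : DimLE R M d := fun P hP => by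
  have := (coheight_le_ringKrullDim_quotient hP).trans h
  exact_mod_cast this

lemma coheight_le_of_ker_le {S D : Type*} [CommRing S] [CommRing D] (φ : S →+* D) {k : ℕ}
    (hk : ringKrullDim φ.range ≤ (k : WithBot ℕ∞)) {P : PrimeSpectrum S}
    (h : RingHom.ker φ ≤ P.asIdeal) : Order.coheight P ≤ k := by
  have := coheight_le_ringKrullDim_quotient h
  rw [ringKrullDim_eq_of_ringEquiv (RingHom.quotientKerEquivRange φ)] at this
  exact_mod_cast this.trans hk

lemma le_of_add_one_le {a : WithBot ℕ∞} {k : ℕ} (h : a + 1 ≤ (k : WithBot ℕ∞) + 1) :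
    a ≤ (k : WithBot ℕ∞) := by
  induction a using WithBot.recBotCoe with
  | bot => exact bot_le
  | coe a =>
    induction a using ENat.recTopCoe with
    | top => 
      exfalso
      have h' : (⊤ : ℕ∞) + 1 ≤ (k : ℕ∞) + 1 := by exact_mod_cast h
      have h2 : ((k : ℕ∞) + 1) ≠ ⊤ := by exact_mod_cast ENat.natCast_ne_top (k + 1)
      rw [top_add] at h'
      exact h2 (top_le_iff.1 h')
    | coe a =>
      have h' : a + 1 ≤ k + 1 := by exact_mod_cast h
      have h'' : a ≤ k := by lia
      exact_mod_cast h''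

lemma adjoin_dim {D : Type*} [CommRing D] [IsDomain D] (T : Subring D) [IsNoetherianRing T] {k : ℕ}
    (hk : ringKrullDim T ≤ (k : WithBot ℕ∞)) {u v y : D} (hu : u ∈ T) (hv : v ∈ T) (h0 : u ≠ 0)
    (huv : u * y = v) : ∃ T' : Subring D, T ≤ T' ∧ y ∈ T' ∧ IsNoetherianRing T' ∧
      ringKrullDim T' ≤ (k : WithBot ℕ∞) ∧ ∀ U : Subring D, T ≤ U → y ∈ U → T' ≤ U := by
  let φ : Polynomial T →+* D := Polynomial.eval₂RingHom T.subtype y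
  have hs : Function.Surjective φ.rangeRestrict := φ.rangeRestrict_surjective
  refine ⟨φ.range, fun t ht => ⟨Polynomial.C ⟨t, ht⟩, by simp [φ]⟩, ⟨Polynomial.X, by simp [φ]⟩,
    isNoetherianRing_of_surjective _ _ _ hs, ?_, ?_⟩
  · have hr : (Polynomial.C ⟨u, hu⟩ * Polynomial.X - Polynomial.C ⟨v, hv⟩ : Polynomial T) ≠ 0 := by
      intro h
      have := congrArg (fun p => p.coeff 1) h
      simp [Polynomial.coeff_C] at this
      exact h0 this
    have := ringKrullDim_succ_le_of_surjective φ.rangeRestrict hs (mem_nonZeroDivisors_of_ne_zero hr)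
      (Subtype.ext (by simp [φ, huv]))
    rw [Polynomial.ringKrullDim_of_isNoetherianRing] at this
    have h2 := this.trans (add_le_add_left hk 1)
    exact le_of_add_one_le h2
  · rintro U hT hy _ ⟨p, rfl⟩
    change p.eval₂ _ _ ∈ U
    rw [Polynomial.eval₂_eq_sum_range]
    exact sum_mem fun i _ => mul_mem (hT (Subtype.property _)) (pow_mem hy i)

variable {R : Type*} [CommRing R] [IsNoetherianRing R] {I : Ideal R}

/-- The map from the Rees algebra to polynomials over a quotient. -/
def reesMap (I 𝔭 : Ideal R) : Rees I →+* Polynomial (R ⧸ 𝔭) :=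
  (Polynomial.mapRingHom (Ideal.Quotient.mk 𝔭)).comp (reesAlgebra I).val.toRingHom

lemma reesMap_coeff (𝔭 : Ideal R) (f : Rees I) (n : ℕ) :
    (reesMap I 𝔭 f).coeff n = Ideal.Quotient.mk 𝔭 (f.cf n) := Polynomial.coeff_map _ _

lemma mem_ker_reesMap {𝔭 : Ideal R} {f : Rees I} :
    f ∈ RingHom.ker (reesMap I 𝔭) ↔ ∀ n, f.cf n ∈ 𝔭 := by
  rw [RingHom.mem_ker, Polynomial.ext_iff]
  simp only [reesMap_coeff, Polynomial.coeff_zero, Ideal.Quotient.eq_zero_iff_mem]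

lemma reesMap_algebraMap (𝔭 : Ideal R) (r : R) :
    reesMap I 𝔭 (algebraMap R (Rees I) r) = Polynomial.C (Ideal.Quotient.mk 𝔭 r) := by
  change Polynomial.map _ (algebraMap R (Polynomial R) r) = _
  simp

lemma reesMap_rt (𝔭 : Ideal R) (r : I) :
    reesMap I 𝔭 (rt r) = Polynomial.monomial 1 (Ideal.Quotient.mk 𝔭 r) := by
  change Polynomial.map _ (Polynomial.monomial 1 (r : R)) = _
  simp

lemma reesMap_range_le {𝔭 : Ideal R} (T : Subring (Polynomial (R ⧸ 𝔭)))
    (h0 : ∀ r : R ⧸ 𝔭, Polynomial.C r ∈ T) {s : Set R} (hs : Ideal.span s = I)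
    (h1 : ∀ r ∈ s, Polynomial.monomial 1 (Ideal.Quotient.mk 𝔭 r) ∈ T) :
    (reesMap I 𝔭).range ≤ T := by
  have h2 : ∀ r ∈ I, Polynomial.monomial 1 (Ideal.Quotient.mk 𝔭 r) ∈ T := by
    intro r hr
    rw [← hs] at hr
    induction hr using Submodule.span_induction with
    | mem x h => exact h1 x h
    | zero => simp [T.zero_mem]
    | add x y _ _ hx hy => rw [map_add, map_add]; exact T.add_mem hx hy
    | smul a x _ hx =>
      rw [smul_eq_mul, map_mul, ← Polynomial.C_mul_monomial]
      exact T.mul_mem (h0 _) hx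
  rintro _ ⟨f, rfl⟩
  have hf : (show reesAlgebra I from f).val ∈
      Algebra.adjoin R (Submodule.map (Polynomial.monomial 1 : R →ₗ[R] Polynomial R) I :
        Set (Polynomial R)) := by
    rw [adjoin_monomial_eq_reesAlgebra]; exact (show reesAlgebra I from f).2
  change Polynomial.map _ (show reesAlgebra I from f).val ∈ T
  generalize (show reesAlgebra I from f).val = f at hf
  induction hf using Algebra.adjoin_induction with
  | mem x h =>
    obtain ⟨r, hr, rfl⟩ := h
    simpa using h2 r hr
  | algebraMap r => simpa using h0 _
  | add x y _ _ hx hy => rw [Polynomial.map_add]; exact T.add_mem hx hy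
  | mul x y _ _ hx hy => rw [Polynomial.map_mul]; exact T.mul_mem hx hy

lemma reesMap_dim {𝔭 : Ideal R} [𝔭.IsPrime] {k : ℕ}
    (hk : ringKrullDim (R ⧸ 𝔭) ≤ (k : WithBot ℕ∞)) (hI : ¬ I ≤ 𝔭) :
    ringKrullDim (reesMap I 𝔭).range ≤ ((k + 1 : ℕ) : WithBot ℕ∞) := by
  obtain ⟨x, hxI, hx⟩ := Set.not_subset.1 hI
  let q := Ideal.Quotient.mk 𝔭
  let φ₀ : Polynomial (R ⧸ 𝔭) →+* Polynomial (R ⧸ 𝔭) :=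
    Polynomial.eval₂RingHom Polynomial.C (Polynomial.monomial 1 (q x))
  have hs := φ₀.rangeRestrict_surjective
  have hC : ∀ r : R ⧸ 𝔭, Polynomial.C r ∈ φ₀.range := fun r => ⟨Polynomial.C r, by simp [φ₀]⟩
  classical
  have key : ∀ s : Finset R, (∀ r ∈ s, r ∈ I) → ∃ T : Subring (Polynomial (R ⧸ 𝔭)),
      φ₀.range ≤ T ∧ (∀ r ∈ s, Polynomial.monomial 1 (q r) ∈ T) ∧ IsNoetherianRing T ∧
      ringKrullDim T ≤ ((k + 1 : ℕ) : WithBot ℕ∞) ∧ T ≤ (reesMap I 𝔭).range := by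
    intro s
    induction s using Finset.induction_on with
    | empty =>
      intro _
      refine ⟨φ₀.range, le_rfl, by simp, isNoetherianRing_of_surjective _ _ _ hs, ?_, ?_⟩
      · refine (ringKrullDim_le_of_surjective _ hs).trans ?_
        rw [Polynomial.ringKrullDim_of_isNoetherianRing]
        exact (add_le_add_left hk 1).trans (by simp)
      · rintro _ ⟨p, rfl⟩
        change p.eval₂ _ _ ∈ _
        rw [Polynomial.eval₂_eq_sum_range]
        refine sum_mem fun i _ => mul_mem ?_ (pow_mem (RingHom.mem_range.2 ⟨rt ⟨x, hxI⟩, reesMap_rt _ _⟩) i)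
        obtain ⟨r, hr⟩ := Ideal.Quotient.mk_surjective (p.coeff i)
        exact ⟨algebraMap R _ r, by rw [reesMap_algebraMap, hr]⟩
    | insert z s _ ih =>
      intro h
      obtain ⟨T, h1, h2, h3, h4, h5⟩ := ih fun r hr => h r (Finset.mem_insert_of_mem hr)
      obtain ⟨T', g1, g2, g3, g4, g5⟩ := adjoin_dim T h4 (u := Polynomial.C (q x))
        (v := Polynomial.C (q z) * Polynomial.monomial 1 (q x)) (y := Polynomial.monomial 1 (q z))
        (h1 (hC _)) (T.mul_mem (h1 (hC _)) (h1 (RingHom.mem_range.2 ⟨Polynomial.X, by simp [φ₀]⟩)))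
        (by simpa [q, Ideal.Quotient.eq_zero_iff_mem] using hx)
        (by simp [Polynomial.C_mul_monomial, mul_comm])
      refine ⟨T', h1.trans g1, ?_, g3, g4, g5 _ h5 ⟨rt ⟨z, h z (Finset.mem_insert_self _ _)⟩,
        reesMap_rt _ _⟩⟩
      intro r hr
      rcases Finset.mem_insert.1 hr with rfl | hr
      · exact g2
      · exact g1 (h2 r hr)
  obtain ⟨s, hs'⟩ : I.FG := IsNoetherian.noetherian I
  obtain ⟨T, h1, h2, h3, h4, h5⟩ := key s fun r hr => hs' ▸ Ideal.subset_span hr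
  have : (reesMap I 𝔭).range = T := le_antisymm
    (reesMap_range_le T (fun r => h1 (hC r)) hs' h2) h5
  rw [this]
  exact h4

lemma reesMap_dim' {𝔭 : Ideal R} [𝔭.IsPrime] {k : ℕ}
    (hk : ringKrullDim (R ⧸ 𝔭) ≤ (k : WithBot ℕ∞)) (hI : I ≤ 𝔭) :
    ringKrullDim (reesMap I 𝔭).range ≤ (k : WithBot ℕ∞) := by
  have hle : (reesMap I 𝔭).range ≤ (Polynomial.C : R ⧸ 𝔭 →+* _).range := by
    refine reesMap_range_le _ (fun r => ⟨r, rfl⟩) (Ideal.span_eq I) fun r hr => ⟨0, ?_⟩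
    rw [Ideal.Quotient.eq_zero_iff_mem.2 (hI hr)]
    simp
  have h : ∀ r : R ⧸ 𝔭, Polynomial.C r ∈ (reesMap I 𝔭).range := by
    intro r
    obtain ⟨r, rfl⟩ := Ideal.Quotient.mk_surjective r
    exact ⟨algebraMap R _ r, reesMap_algebraMap _ _⟩
  refine (ringKrullDim_le_of_surjective
    ((Polynomial.C : R ⧸ 𝔭 →+* _).codRestrict (reesMap I 𝔭).range h) ?_).trans hk
  rintro ⟨f, hf⟩
  obtain ⟨r, hr⟩ := hle hf
  exact ⟨r, Subtype.ext hr⟩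

lemma exists_ker_reesMap_le {M : Type*} [AddCommGroup M] [Module R M]
    {P : Ideal (Rees I)} [P.IsPrime]
    (hP : Module.annihilator (Rees I) (powFam I M).sub ≤ P) :
    ∃ 𝔭 ∈ (Module.annihilator R M).minimalPrimes, RingHom.ker (reesMap I 𝔭) ≤ P := by
  have hfin := Ideal.finite_minimalPrimes_of_isNoetherianRing R (Module.annihilator R M)
  have : hfin.toFinset.inf (fun 𝔭 => RingHom.ker (reesMap I 𝔭)) ≤ P := by
    intro f hf
    have h1 : ∀ 𝔭 ∈ (Module.annihilator R M).minimalPrimes, ∀ n, f.cf n ∈ 𝔭 := by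
      intro 𝔭 h𝔭
      rw [← mem_ker_reesMap]
      exact (Submodule.mem_finsetInf.1 hf) 𝔭 (hfin.mem_toFinset.2 h𝔭)
    have h2 : IsNilpotent (reesMap I (Module.annihilator R M) f) := by
      rw [Polynomial.isNilpotent_iff]
      intro n
      rw [reesMap_coeff]
      have : f.cf n ∈ (Module.annihilator R M).radical := by
        rw [← Ideal.sInf_minimalPrimes]
        exact (Submodule.mem_sInf).2 fun 𝔭 h => h1 𝔭 h n
      obtain ⟨k, hk⟩ := this
      exact ⟨k, by rw [← map_pow, Ideal.Quotient.eq_zero_iff_mem]; exact hk⟩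
    obtain ⟨k, hk⟩ := h2
    rw [← map_pow, ← RingHom.mem_ker, mem_ker_reesMap] at hk
    refine Ideal.IsPrime.mem_of_pow_mem ‹_› k (hP ?_)
    rw [Module.mem_annihilator]
    intro g
    refine Subtype.ext (RMod.ext fun n => ?_)
    rw [Submodule.coe_smul, RMod.cf_smul, Submodule.coe_zero, map_zero]
    exact Finset.sum_eq_zero fun p _ => Module.mem_annihilator.1 (hk p.1) _
  rw [Ideal.IsPrime.inf_le' ‹_›] at this
  obtain ⟨𝔭, h𝔭, h⟩ := this
  exact ⟨𝔭, hfin.mem_toFinset.1 h𝔭, h⟩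

lemma coheight_rees_le {M : Type*} [AddCommGroup M] [Module R M] {d : ℕ} (hd : DimLE R M d)
    {P : PrimeSpectrum (Rees I)}
    (hP : Module.annihilator (Rees I) (powFam I M).sub ≤ P.asIdeal)
    (hI : I.map (algebraMap R (Rees I)) ≤ P.asIdeal) : Order.coheight P ≤ d := by
  obtain ⟨𝔭, h𝔭, hle⟩ := exists_ker_reesMap_le hP
  have hp : 𝔭.IsPrime := h𝔭.1.1
  have hdim : ringKrullDim (R ⧸ 𝔭) ≤ (d : WithBot ℕ∞) := by
    exact ringKrullDim_quotient_le_of fun P hP => hd P (h𝔭.1.2.trans hP)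
  by_cases hI𝔭 : I ≤ 𝔭
  · exact coheight_le_of_ker_le _ (reesMap_dim' hdim hI𝔭) hle
  · have h1 := reesMap_dim hdim hI𝔭
    have hlt : (⟨RingHom.ker (reesMap I 𝔭), RingHom.ker_isPrime _⟩ : PrimeSpectrum (Rees I)) < P := by
      refine lt_of_le_of_ne hle ?_
      rintro rfl
      refine hI𝔭 fun r hr => ?_
      have := hI (Ideal.mem_map_of_mem _ hr)
      change _ ∈ RingHom.ker (reesMap I 𝔭) at this
      rw [RingHom.mem_ker, reesMap_algebraMap, Polynomial.C_eq_zero,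
        Ideal.Quotient.eq_zero_iff_mem] at this
      exact this
    have h2 := (Order.coheight_add_one_le hlt).trans (coheight_le_of_ker_le _ h1 le_rfl)
    have h3 : (Order.coheight P : WithBot ℕ∞) + 1 ≤ (d : WithBot ℕ∞) + 1 := by exact_mod_cast h2
    exact_mod_cast le_of_add_one_le h3

end Dim

section HSB
variable {R S : Type*} [CommRing R] [CommRing S] [Algebra R S]

/-- `𝔫 ^ n E` as an `R`-submodule. -/
def powSub (R : Type*) {S : Type*} [CommRing R] [CommRing S] [Algebra R S] (𝔫 : Ideal S)
    (E : Type*) [AddCommGroup E] [Module S E] [Module R E] [IsScalarTower R S E] (n : ℕ) :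
    Submodule R E := (𝔫 ^ n • (⊤ : Submodule S E)).restrictScalars R

variable {𝔫 : Ideal S} [𝔫.IsMaximal]

lemma length_ne_top_of_le_annihilator (hs : Function.Surjective ((Ideal.Quotient.mk 𝔫).comp (algebraMap R S)))
    (X : Type*) [AddCommGroup X] [Module S X] [Module R X] [IsScalarTower R S X]
    [Module.Finite S X] (h : 𝔫 ≤ Module.annihilator S X) : Module.length R X ≠ ⊤ := by
  have ht : Module.IsTorsionBySet S X 𝔫 := fun x r => Module.mem_annihilator.1 (h r.2) x
  let _ : Module (S ⧸ 𝔫) X := ht.module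
  have : IsScalarTower S (S ⧸ 𝔫) X := ht.isScalarTower
  have : IsScalarTower R (S ⧸ 𝔫) X := ht.isScalarTower
  have : Module.Finite (S ⧸ 𝔫) X := Module.Finite.of_restrictScalars_finite S _ _
  let _ := Ideal.Quotient.field 𝔫
  rw [Module.length_eq_of_surjective (R := S ⧸ 𝔫) hs]
  exact Module.length_ne_top

variable [IsNoetherianRing S]

lemma rlen_powSub_ne_top (hs : Function.Surjective ((Ideal.Quotient.mk 𝔫).comp (algebraMap R S)))
    (E : Type*) [AddCommGroup E] [Module S E] [Module R E] [IsScalarTower R S E]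
    [Module.Finite S E] (n : ℕ) : rlen (powSub R 𝔫 E n) ⊤ ≠ ⊤ := by
  induction n with
  | zero =>
    have : powSub R 𝔫 E 0 = ⊤ := by ext; simp [powSub]
    rw [this, rlen_eq_zero.2 le_rfl]
    exact ENat.zero_ne_top
  | succ n ih =>
    have hle : powSub R 𝔫 E (n + 1) ≤ powSub R 𝔫 E n :=
      fun x hx => Submodule.smul_mono_left (Ideal.pow_le_pow_right n.le_succ) hx
    rw [rlen_add hle le_top]
    refine WithTop.add_ne_top.2 ⟨?_, ih⟩
    let X : Submodule S (E ⧸ (𝔫 ^ (n + 1) • ⊤ : Submodule S E)) :=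
      (𝔫 ^ n • ⊤ : Submodule S E).map (Submodule.mkQ _)
    have hX : Module.length R X ≠ ⊤ := by
      refine length_ne_top_of_le_annihilator hs X fun r hr => ?_
      rw [Module.mem_annihilator]
      rintro ⟨_, b, hb, rfl⟩
      apply Subtype.ext
      change r • Submodule.mkQ _ b = 0
      rw [← map_smul]
      refine (Submodule.Quotient.mk_eq_zero _).2 ?_
      rw [pow_succ', mul_smul]
      exact Submodule.smul_mem_smul hr hb
    exact hX

lemma exists_pow_le_of_isolated {E : Type*} [AddCommGroup E] [Module S E]
    (h : ∀ P : PrimeSpectrum S, Module.annihilator S E ≤ P.asIdeal → P.asIdeal ≤ 𝔫 →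
      Order.coheight P ≤ (0 : ℕ)) :
    ∃ N, ∀ n, (𝔫 ^ N • ⊤ : Submodule S E) ≤ 𝔫 ^ n • ⊤ := by
  set J := Module.annihilator S E
  have hfin := Ideal.finite_minimalPrimes_of_isNoetherianRing S J
  have hmax : ∀ P ∈ J.minimalPrimes, P ≤ 𝔫 → P = 𝔫 := by
    intro P hP hle
    have h0 := h ⟨P, hP.1.1⟩ hP.1.2 hle
    have h1 : IsMax (⟨P, hP.1.1⟩ : PrimeSpectrum S) := by
      rw [← Order.coheight_eq_zero]; simpa using h0
    have h2 := h1.eq_of_le (b := ⟨𝔫, inferInstance⟩) hle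
    exact congrArg PrimeSpectrum.asIdeal h2
  classical
  obtain ⟨t, ht, htn⟩ : ∃ t ∈ (hfin.toFinset.filter (· ≠ 𝔫)).inf id, t ∉ 𝔫 := by
    by_contra! hcon
    have : (hfin.toFinset.filter (· ≠ 𝔫)).inf id ≤ 𝔫 := hcon
    rw [Ideal.IsPrime.inf_le' inferInstance] at this
    obtain ⟨P, hP, hle⟩ := this
    rw [Finset.mem_filter, hfin.mem_toFinset] at hP
    exact hP.2 (hmax P hP.1 hle)
  have hrad : Ideal.span {t} * 𝔫 ≤ J.radical := by
    rw [← Ideal.sInf_minimalPrimes]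
    refine le_sInf fun P hP => ?_
    by_cases hPn : P = 𝔫
    · rw [hPn]; exact Ideal.mul_le_right (I := Ideal.span {t})
    · refine (Ideal.mul_le_left (I := Ideal.span {t})).trans ?_
      rw [Ideal.span_singleton_le_iff_mem]
      exact (Submodule.mem_finsetInf.1 ht) P
        (Finset.mem_filter.2 ⟨hfin.mem_toFinset.2 hP, hPn⟩)
  obtain ⟨N, hN⟩ := Ideal.exists_pow_le_of_le_radical_of_fg hrad (IsNoetherian.noetherian _)
  refine ⟨N, fun n => ?_⟩
  have hcop : Ideal.span {t ^ N} ⊔ 𝔫 ^ n = ⊤ := by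
    have : IsCoprime (Ideal.span {t}) 𝔫 := by
      rw [Ideal.isCoprime_iff_sup_eq, sup_comm]
      exact ‹𝔫.IsMaximal›.out.2 _ (left_lt_sup.2 fun h => htn ((Ideal.span_singleton_le_iff_mem _).1 h))
    have := (this.pow (m := N) (n := n))
    rwa [Ideal.isCoprime_iff_sup_eq, Ideal.span_singleton_pow] at this
  calc (𝔫 ^ N • ⊤ : Submodule S E) = (⊤ : Ideal S) • 𝔫 ^ N • ⊤ := by simp
    _ = (Ideal.span {t} * 𝔫) ^ N • ⊤ ⊔ 𝔫 ^ n • 𝔫 ^ N • ⊤ := by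
      rw [← hcop, Submodule.sup_smul, mul_pow, mul_smul, Ideal.span_singleton_pow]
    _ ≤ 𝔫 ^ n • ⊤ := by
      refine sup_le ?_ (Submodule.smul_mono le_rfl le_top)
      rw [Submodule.smul_le]
      intro r hr e _
      rw [Module.mem_annihilator.1 (hN hr)]
      exact Submodule.zero_mem _

lemma exists_mem_notMem_minimalPrimes (J : Ideal S) :
    ∃ y ∈ 𝔫, ∀ P ∈ J.minimalPrimes, y ∈ P → P = 𝔫 := by
  have hfin := Ideal.finite_minimalPrimes_of_isNoetherianRing S J
  by_contra! hcon
  have h2 : (𝔫 : Set S) ⊆ ⋃ P ∈ {P ∈ J.minimalPrimes | P ≠ 𝔫}, (P : Set S) := by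
    intro y hy
    obtain ⟨P, hP, hyP, hne⟩ := hcon y hy
    exact Set.mem_biUnion (s := {P ∈ J.minimalPrimes | P ≠ 𝔫}) ⟨hP, hne⟩ hyP
  replace h2 := (Ideal.subset_union_prime_finite (f := fun P => P) (hfin.subset fun _ h => h.1) 𝔫 𝔫
    (fun P hP _ _ => hP.1.1.1)).1 h2
  obtain ⟨P, ⟨hP, hne⟩, hle⟩ := h2
  exact hne ((‹𝔫.IsMaximal›.eq_of_le hP.1.1.ne_top hle).symm)

lemma hs_bound (hs : Function.Surjective ((Ideal.Quotient.mk 𝔫).comp (algebraMap R S))) (k : ℕ) :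
    ∀ (E : Type*) [AddCommGroup E] [Module S E] [Module R E] [IsScalarTower R S E]
    [Module.Finite S E], 
    (∀ P : PrimeSpectrum S, Module.annihilator S E ≤ P.asIdeal → P.asIdeal ≤ 𝔫 →
      Order.coheight P ≤ k) →
    ∃ C : ℕ, ∀ n : ℕ, rlen (powSub R 𝔫 E n) ⊤ ≤ ((C * (n + 1) ^ k : ℕ) : ℕ∞) := by
  induction k with
  | zero =>
    intro E _ _ _ _ _ h
    obtain ⟨N, hN⟩ := exists_pow_le_of_isolated h
    obtain ⟨C, hC⟩ := ENat.ne_top_iff_exists.1 (rlen_powSub_ne_top hs E N)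
    refine ⟨C, fun n => ?_⟩
    rw [pow_zero, mul_one, hC]
    exact rlen_antitone (A := powSub R 𝔫 E N) (A' := powSub R 𝔫 E n) (hN n) _
  | succ k ih =>
    intro E _ _ _ _ _ h
    obtain ⟨y, hy, hyP⟩ := exists_mem_notMem_minimalPrimes (𝔫 := 𝔫) (Module.annihilator S E)
    let D : Submodule S E := LinearMap.range (LinearMap.lsmul S E y)
    obtain ⟨C, hC⟩ := ih (E ⧸ D) (by
      intro P hP hPn
      have h1 : Module.annihilator S E ≤ P.asIdeal := by
        refine le_trans ?_ hP
        exact LinearMap.annihilator_le_of_surjective D.mkQ D.mkQ_surjective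
      have hyP' : y ∈ P.asIdeal := by
        apply hP
        rw [Module.mem_annihilator]
        intro e
        obtain ⟨e, rfl⟩ := D.mkQ_surjective e
        rw [← map_smul]
        exact (Submodule.Quotient.mk_eq_zero _).2 ⟨e, rfl⟩
      obtain ⟨Q, hQ, hQP⟩ := Ideal.exists_minimalPrimes_le h1
      have hQ' := hQ.1.1
      by_cases hlt : Q = P.asIdeal
      · have : Q = 𝔫 := hyP Q hQ (hlt ▸ hyP')
        have hmax : IsMax P := by
          intro P' hP'
          change P'.asIdeal ≤ P.asIdeal
          rw [← hlt, this]
          have : 𝔫 ≤ P'.asIdeal := by rw [← this, hlt]; exact hP'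
          exact (‹𝔫.IsMaximal›.eq_of_le P'.2.ne_top this).ge
        rw [Order.coheight_eq_zero.2 hmax]
        exact bot_le
      · have hlt' : (⟨Q, hQ'⟩ : PrimeSpectrum S) < P := lt_of_le_of_ne hQP fun e => hlt (by rw [← e])
        have h2 := (Order.coheight_add_one_le hlt').trans (h ⟨Q, hQ'⟩ hQ.1.2 (hQP.trans hPn))
        have h3 : (Order.coheight P : WithBot ℕ∞) + 1 ≤ (k : WithBot ℕ∞) + 1 := by exact_mod_cast h2
        exact_mod_cast le_of_add_one_le h3)
    have hrec : ∀ n, rlen (powSub R 𝔫 E (n + 1)) ⊤ ≤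
        rlen (powSub R 𝔫 E n) ⊤ + rlen (powSub R 𝔫 (E ⧸ D) (n + 1)) ⊤ := by
      intro n
      set A := powSub R 𝔫 E (n + 1)
      let f : E →ₗ[R] E := (LinearMap.lsmul S E y).restrictScalars R
      let g : E →ₗ[R] E ⧸ D := D.mkQ.restrictScalars R
      have hg : Submodule.map g ⊤ = ⊤ := by
        rw [Submodule.map_top, LinearMap.range_eq_top]; exact D.mkQ_surjective
      rw [rlen_add (B := A ⊔ (⊤ : Submodule R E).map f) le_sup_left le_top, rlen_sup, rlen_map]
      refine add_le_add (rlen_antitone ?_ _) ?_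
      · intro e he
        change y • e ∈ 𝔫 ^ (n + 1) • (⊤ : Submodule S E)
        rw [pow_succ', mul_smul]
        exact Submodule.smul_mem_smul hy he
      · rw [← hg, rlen_map]
        refine rlen_antitone ?_ _
        intro e he
        change D.mkQ e ∈ 𝔫 ^ (n + 1) • (⊤ : Submodule S (E ⧸ D)) at he
        rw [← D.range_mkQ, ← Submodule.map_top, ← Submodule.map_smul''] at he
        obtain ⟨z, hz, hze⟩ := he
        have : e - z ∈ D := (Submodule.Quotient.eq D).1 hze.symm
        obtain ⟨w, hw⟩ := this
        refine Submodule.mem_sup.2 ⟨z, hz, e - z, ⟨w, trivial, hw⟩, by abel⟩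
    refine ⟨C, fun n => ?_⟩
    induction n with
    | zero =>
      have : powSub R 𝔫 E 0 = ⊤ := by ext; simp [powSub]
      rw [this, rlen_eq_zero.2 le_rfl]
      exact bot_le
    | succ n ihn =>
      refine (hrec n).trans ((add_le_add ihn (hC (n + 1))).trans ?_)
      rw [← Nat.cast_add]
      refine Nat.cast_le.2 ?_
      rw [← mul_add]
      refine Nat.mul_le_mul_left _ ?_
      have : (n + 1) ^ k ≤ (n + 1 + 1) ^ k := Nat.pow_le_pow_left (by lia) _
      calc (n + 1) ^ (k + 1) + (n + 1 + 1) ^ k ≤ (n + 1 + 1) ^ k * (n + 1) + (n + 1 + 1) ^ k := by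
            rw [pow_succ]; gcongr
        _ = _ := by ring

end HSB

section Satur
variable {R M N : Type*} [CommRing R] [AddCommGroup M] [Module R M] [AddCommGroup N] [Module R N]

lemma mem_H0 {I : Ideal R} {y : N} : y ∈ H0 I N ↔ ∃ n, ∀ r ∈ I ^ n, r • y = 0 := by
  unfold H0
  rw [Submodule.mem_iSup_of_directed]
  · simp only [Submodule.mem_torsionBySet_iff]
    exact ⟨fun ⟨n, h⟩ => ⟨n, fun r hr => h ⟨r, hr⟩⟩, fun ⟨n, h⟩ => ⟨n, fun r => h r r.2⟩⟩
  · refine Monotone.directed_le fun a b hab => ?_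
    exact Submodule.torsionBySet_le_torsionBySet_of_subset (Ideal.pow_le_pow_right hab)

lemma mem_satur {I : Ideal R} {K : Submodule R M} {y : M} :
    y ∈ satur I K ↔ ∃ n, ∀ r ∈ I ^ n, r • y ∈ K := by
  unfold satur
  rw [Submodule.mem_comap, mem_H0]
  refine exists_congr fun n => forall₂_congr fun r _ => ?_
  rw [← map_smul, Submodule.mkQ_apply, Submodule.Quotient.mk_eq_zero]

lemma le_satur (I : Ideal R) (K : Submodule R M) : K ≤ satur I K := fun _ hy =>
  mem_satur.2 ⟨0, fun r _ => K.smul_mem r hy⟩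

lemma satur_mono (I : Ideal R) {K K' : Submodule R M} (h : K ≤ K') : satur I K ≤ satur I K' := by
  intro y hy
  obtain ⟨n, hn⟩ := mem_satur.1 hy
  exact mem_satur.2 ⟨n, fun r hr => h (hn r hr)⟩

lemma comap_satur (f : M →ₗ[R] N) (I : Ideal R) (K : Submodule R N) :
    (satur I K).comap f = satur I (K.comap f) := by
  ext y
  simp only [Submodule.mem_comap, mem_satur, map_smul]

lemma exists_pow_le_annihilator_of_forall (J : Ideal R) [Module.Finite R M]
    (h : ∀ y : M, ∃ k, ∀ r ∈ J ^ k, r • y = 0) : ∃ k, J ^ k ≤ Module.annihilator R M := by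
  obtain ⟨s, hs⟩ : (⊤ : Submodule R M).FG := Module.Finite.fg_top
  choose k hk using h
  refine ⟨s.sup k, fun r hr => ?_⟩
  rw [Module.mem_annihilator]
  intro y
  have hy : y ∈ Submodule.span R (s : Set M) := hs ▸ Submodule.mem_top
  induction hy using Submodule.span_induction with
  | mem z hz => exact hk z r (Ideal.pow_le_pow_right (Finset.le_sup hz) hr)
  | zero => simp
  | add a b _ _ ha hb => rw [smul_add, ha, hb, add_zero]
  | smul c a _ ha => rw [smul_comm, ha, smul_zero]

lemma exists_pow_smul_satur_le [IsNoetherian R M] (I : Ideal R) (K : Submodule R M) :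
    ∃ k, I ^ k • satur I K ≤ K := by
  obtain ⟨k, hk⟩ := exists_pow_le_annihilator_of_forall (M := (satur I K).map K.mkQ) I (by
    rintro ⟨_, y, hy, rfl⟩
    obtain ⟨n, hn⟩ := mem_satur.1 hy
    refine ⟨n, fun r hr => Subtype.ext ?_⟩
    change r • K.mkQ y = 0
    rw [← map_smul]
    exact (Submodule.Quotient.mk_eq_zero _).2 (hn r hr))
  refine ⟨k, Submodule.smul_le.2 fun r hr y hy => ?_⟩
  have := congrArg Subtype.val (Module.mem_annihilator.1 (hk hr) ⟨K.mkQ y, y, hy, rfl⟩)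
  change r • K.mkQ y = 0 at this
  rw [← map_smul] at this
  exact (Submodule.Quotient.mk_eq_zero _).1 this

lemma satur_satur [IsNoetherian R M] (I : Ideal R) (K : Submodule R M) :
    satur I (satur I K) = satur I K := by
  refine le_antisymm (fun y hy => ?_) (le_satur _ _)
  obtain ⟨n, hn⟩ := mem_satur.1 hy
  obtain ⟨k, hk⟩ := exists_pow_smul_satur_le I K
  refine mem_satur.2 ⟨k + n, fun r hr => ?_⟩
  rw [pow_add] at hr
  induction hr using Submodule.mul_induction_on' with
  | mem_mul_mem a ha b hb =>
    rw [mul_smul]; exact hk (Submodule.smul_mem_smul ha (hn b hb))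
  | add a _ b _ ha hb => rw [add_smul]; exact K.add_mem ha hb

lemma length_H0_map (J : Ideal R) (A B : Submodule R M) :
    Module.length R (H0 J (B.map A.mkQ)) = rlen A (satur J A ⊓ B) := by
  have e : (H0 J (B.map A.mkQ)).map (B.map A.mkQ).subtype = (satur J A ⊓ B).map A.mkQ := by
    ext z
    constructor
    · rintro ⟨⟨_, b, hb, rfl⟩, h, rfl⟩
      refine ⟨b, ⟨?_, hb⟩, rfl⟩
      obtain ⟨n, hn⟩ := mem_H0.1 h
      refine mem_satur.2 ⟨n, fun r hr => ?_⟩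
      have := congrArg Subtype.val (hn r hr)
      change r • A.mkQ b = 0 at this
      rw [← map_smul] at this
      exact (Submodule.Quotient.mk_eq_zero _).1 this
    · rintro ⟨b, ⟨hs, hb⟩, rfl⟩
      refine ⟨⟨A.mkQ b, b, hb, rfl⟩, ?_, rfl⟩
      obtain ⟨n, hn⟩ := mem_satur.1 hs
      refine mem_H0.2 ⟨n, fun r hr => Subtype.ext ?_⟩
      change r • A.mkQ b = 0
      rw [← map_smul]
      exact (Submodule.Quotient.mk_eq_zero _).2 (hn r hr)
  unfold rlen
  rw [← e]
  exact (Submodule.equivMapOfInjective _ (Submodule.subtype_injective _) _).length_eq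

end Satur

section Stolz

lemma tendsto_div_pow_add_one (D : ℕ) :
    Tendsto (fun j : ℕ => (((j : ℝ) + 1) ^ (D + 1) - (j : ℝ) ^ (D + 1)) / ((j : ℝ) + 1) ^ D)
      atTop (nhds ((D : ℝ) + 1)) := by
  have h1 : Tendsto (fun j : ℕ => (j : ℝ) / ((j : ℝ) + 1)) atTop (nhds 1) :=
    tendsto_natCast_div_add_atTop 1
  have h2 : Tendsto (fun j : ℕ => ∑ i ∈ Finset.range (D + 1), ((j : ℝ) / ((j : ℝ) + 1)) ^ (D - i))
      atTop (nhds (∑ i ∈ Finset.range (D + 1), (1 : ℝ) ^ (D - i))) :=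
    tendsto_finsetSum _ fun i _ => h1.pow _
  simp only [one_pow, Finset.sum_const, Finset.card_range, nsmul_eq_mul, mul_one] at h2
  push_cast at h2
  refine h2.congr fun j => ?_
  have hj : ((j : ℝ) + 1) ≠ 0 := by positivity
  rw [← geom_sum₂_mul, add_sub_cancel_left, mul_one, Finset.sum_div]
  refine Finset.sum_congr rfl fun i hi => ?_
  rw [Finset.mem_range] at hi
  have : ((j : ℝ) + 1) ^ D = ((j : ℝ) + 1) ^ i * ((j : ℝ) + 1) ^ (D - i) := by
    rw [← pow_add]; congr 1; lia
  rw [this, div_pow, Nat.add_sub_cancel]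
  field_simp

lemma stolz {f g e : ℕ → ℝ} {D : ℕ} {L C : ℝ} {n₀ : ℕ}
    (h : ∀ n ≥ n₀, f (n + 1) + e (n + 1) = f n + g (n + 1))
    (he0 : ∀ n, 0 ≤ ∑ i ∈ Finset.range n, e (i + 1))
    (he : ∀ n : ℕ, ∑ i ∈ Finset.range n, e (i + 1) ≤ C * ((n : ℝ) + 1) ^ D)
    (hg : Tendsto (fun n : ℕ => (D.factorial : ℝ) / (n : ℝ) ^ D * g n) atTop (nhds L)) :
    Tendsto (fun n : ℕ => ((D + 1).factorial : ℝ) / (n : ℝ) ^ (D + 1) * f n) atTop (nhds L) := by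
  set b : ℕ → ℝ := fun j => ((j : ℝ) + 1) ^ (D + 1) - (j : ℝ) ^ (D + 1) with hb
  have hbpos : ∀ j, 0 < b j := fun j => by
    have : (j : ℝ) ^ (D + 1) < ((j : ℝ) + 1) ^ (D + 1) :=
      pow_lt_pow_left₀ (by linarith) (by positivity) (by lia)
    simp only [hb]; linarith
  have hbsum : ∀ n, ∑ i ∈ Finset.range n, b i = (n : ℝ) ^ (D + 1) := by
    intro n
    have := Finset.sum_range_sub (fun i : ℕ => (i : ℝ) ^ (D + 1)) n
    simpa [hb] using this
  set F : ℝ := ((D + 1).factorial : ℝ) with hF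
  have hFpos : 0 < F := by positivity
  have hlim : Tendsto (fun j => g (j + 1) / b j) atTop (nhds (L / F)) := by
    have h1 := (hg.comp (tendsto_add_atTop_nat 1)).div (tendsto_div_pow_add_one D) (by positivity)
    have h2 := h1.div_const (D.factorial : ℝ)
    have e1 : L / ((D : ℝ) + 1) / D.factorial = L / F := by
      rw [hF, Nat.factorial_succ, div_div]; push_cast; rfl
    rw [e1] at h2
    refine h2.congr fun j => ?_
    have := (hbpos j).ne'
    have hj : ((j : ℝ) + 1) ≠ 0 := by positivity
    have hD : (D.factorial : ℝ) ≠ 0 := by positivity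
    change (D.factorial : ℝ) / ((j + 1 : ℕ) : ℝ) ^ D * g (j + 1) / (b j / _) / D.factorial = _
    push_cast
    field_simp
  have ho : (fun j => g (j + 1) - L / F * b j) =o[atTop] b := by
    rw [Asymptotics.isLittleO_iff_tendsto (fun j h => absurd h (hbpos j).ne')]
    have := hlim.sub_const (L / F)
    rw [sub_self] at this
    refine this.congr fun j => ?_
    have := (hbpos j).ne'
    field_simp
  have hpow : Tendsto (fun n : ℕ => (n : ℝ) ^ (D + 1)) atTop atTop :=
    (tendsto_pow_atTop (by lia)).comp tendsto_natCast_atTop_atTop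
  have hs := ho.sum_range (fun j => (hbpos j).le) (by simpa only [hbsum] using hpow)
  simp only [hbsum, Finset.sum_sub_distrib, ← Finset.mul_sum] at hs
  have hs' := hs.tendsto_div_nhds_zero
  have hE : Tendsto (fun n : ℕ => (∑ i ∈ Finset.range n, e (i + 1)) / (n : ℝ) ^ (D + 1)) atTop
      (nhds 0) := by
    have hC : Tendsto (fun n : ℕ => C * ((((n : ℝ) + 1) / n) ^ D * (1 / n))) atTop (nhds 0) := by
      have h1 : Tendsto (fun n : ℕ => ((n : ℝ) + 1) / n) atTop (nhds 1) := by
        have := (tendsto_natCast_div_add_atTop (1 : ℝ)).inv₀ one_ne_zero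
        simpa using this
      have := ((h1.pow D).mul tendsto_one_div_atTop_nhds_zero_nat).const_mul C
      simpa using this
    refine squeeze_zero' (Eventually.of_forall fun n => ?_) ?_ hC
    · exact div_nonneg (he0 n) (by positivity)
    · filter_upwards [eventually_gt_atTop 0] with n hn
      have hn' : (0 : ℝ) < n := by exact_mod_cast hn
      rw [div_le_iff₀ (by positivity)]
      refine (he n).trans (le_of_eq ?_)
      rw [div_pow, pow_succ]
      field_simp
  have hf : ∀ n, f (n₀ + n) = f n₀ + (∑ i ∈ Finset.range (n₀ + n), g (i + 1) -
      ∑ i ∈ Finset.range (n₀ + n), e (i + 1)) - (∑ i ∈ Finset.range n₀, g (i + 1) -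
      ∑ i ∈ Finset.range n₀, e (i + 1)) := by
    intro n
    induction n with
    | zero => simp
    | succ n ih =>
      have := h (n₀ + n) (by lia)
      rw [← add_assoc, Finset.sum_range_succ, Finset.sum_range_succ]
      linarith
  set c : ℝ := f n₀ - (∑ i ∈ Finset.range n₀, g (i + 1) - ∑ i ∈ Finset.range n₀, e (i + 1))
  have hc : Tendsto (fun n : ℕ => c / (n : ℝ) ^ (D + 1)) atTop (nhds 0) :=
    hpow.const_div_atTop c
  have hfin := (((hs'.add hc).sub hE).const_mul F).add_const L
  simp only [add_zero, sub_zero, mul_zero, zero_add] at hfin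
  refine hfin.congr' ?_
  filter_upwards [eventually_ge_atTop n₀, eventually_gt_atTop 0] with n hn hn0
  obtain ⟨k, rfl⟩ := Nat.exists_eq_add_of_le hn
  rw [hf k]
  have hn' : (((n₀ + k : ℕ) : ℝ)) ≠ 0 := by exact_mod_cast hn0.ne'
  field_simp
  ring

end Stolz

section DimStep
variable {R M : Type*} [CommRing R] [AddCommGroup M] [Module R M]

/-- The submodule `aN`. -/
def am (a : R) (N : Submodule R M) : Submodule R M := N.map (LinearMap.lsmul R M a)

lemma mem_am {a : R} {N : Submodule R M} {y : M} : y ∈ am a N ↔ ∃ z ∈ N, a • z = y := Iff.rfl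

lemma smul_mem_am {a : R} {N : Submodule R M} {y : M} (h : y ∈ N) : a • y ∈ am a N := ⟨y, h, rfl⟩

lemma am_eq (a : R) (N : Submodule R M) : am a N = Ideal.span {a} • N := by
  rw [Submodule.ideal_span_singleton_smul]; rfl

lemma am_mono (a : R) {N N' : Submodule R M} (h : N ≤ N') : am a N ≤ am a N' := Submodule.map_mono h

lemma am_le (a : R) (N : Submodule R M) : am a N ≤ N := by
  rintro _ ⟨z, hz, rfl⟩
  exact N.smul_mem a hz

lemma coheight_le_of_lt {S : Type*} [CommRing S] {P Q T : PrimeSpectrum S} (h : P < Q) (h' : Q ≤ T)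
    {k : ℕ} (hk : Order.coheight P ≤ (k + 1 : ℕ)) : Order.coheight T ≤ k := by
  have h1 := (Order.coheight_add_one_le h).trans hk
  have h2 := Order.coheight_anti h'
  have h3 : Order.coheight T + 1 ≤ (k : ℕ∞) + 1 := (add_le_add_left h2 1).trans (by exact_mod_cast h1)
  exact (ENat.add_le_add_iff_right ENat.one_ne_top).1 h3

lemma not_le_of_associated {S E : Type*} [CommRing S] [AddCommGroup E] [Module S E]
    [IsNoetherianRing S] (J : Ideal S)
    (h : ∀ y : E, (∀ r ∈ J, r • y = 0) → y = 0) {P : Ideal S} (hP : P ∈ associatedPrimes S E) :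
    ¬ J ≤ P := by
  intro hle
  obtain ⟨hp, y, hy⟩ := isAssociatedPrime_iff.1 (AssociatedPrimes.mem_iff.1 hP)
  have h0 : y = 0 := h y fun r hr => by
    have := hle hr
    rwa [hy, Submodule.mem_colon_singleton, Submodule.mem_bot] at this
  apply hp.ne_top
  rw [hy, Ideal.eq_top_iff_one, Submodule.mem_colon_singleton, h0, smul_zero]
  exact Submodule.zero_mem _

lemma eventually_dimLE [IsNoetherianRing R] [IsLocalRing R] [Module.Finite R M] {I : Ideal R}
    {m : ℕ} {x : Fin m → R} (hx : Ideal.span (Set.range x) = I)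
    {𝓤 : Filter (Fin m → R)} (h : IsGenericRow 𝓤) {k : ℕ} (hd : DimLE R M (k + 1)) :
    ∀ᶠ c in 𝓤, DimLE R (M ⧸ satur I (am (lin x c) (⊤ : Submodule R M))) k := by
  have hfin := Ideal.finite_minimalPrimes_of_isNoetherianRing R (Module.annihilator R M)
  filter_upwards [eventually_forall_lin_notMem h x hfin] with c hc P hP
  set L := satur I (am (lin x c) (⊤ : Submodule R M)) with hL
  obtain ⟨P', hP', hP'P⟩ := Ideal.exists_minimalPrimes_le hP
  have hass := Module.associatedPrimes.minimalPrimes_annihilator_subset_associatedPrimes R _ hP'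
  have hIP' : ¬ I ≤ P' := by
    refine not_le_of_associated I (fun y hy => ?_) hass
    obtain ⟨y, rfl⟩ := L.mkQ_surjective y
    refine (Submodule.Quotient.mk_eq_zero _).2 ?_
    rw [hL, ← satur_satur]
    refine mem_satur.2 ⟨1, fun r hr => ?_⟩
    rw [pow_one] at hr
    have := hy r hr
    rw [← map_smul] at this
    exact (Submodule.Quotient.mk_eq_zero _).1 this
  have hann : Module.annihilator R M ≤ P' :=
    (LinearMap.annihilator_le_of_surjective L.mkQ L.mkQ_surjective).trans hP'.1.2
  have haP' : lin x c ∈ P' := by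
    refine hP'.1.2 (Module.mem_annihilator.2 fun y => ?_)
    obtain ⟨y, rfl⟩ := L.mkQ_surjective y
    rw [← map_smul]
    exact (Submodule.Quotient.mk_eq_zero _).2 (le_satur _ _ (smul_mem_am Submodule.mem_top))
  have hp' := hP'.1.1
  obtain ⟨P₀, hP₀, hP₀P'⟩ := Ideal.exists_minimalPrimes_le hann
  have hne : P₀ ≠ P' := by
    rintro rfl
    exact hIP' (hx ▸ hc _ hP₀ haP')
  refine coheight_le_of_lt (P := ⟨P₀, hP₀.1.1⟩) (Q := ⟨P', hp'⟩) ?_ hP'P (hd ⟨P₀, hP₀.1.1⟩ hP₀.1.2)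
  exact lt_of_le_of_ne hP₀P' fun e => hne (congrArg PrimeSpectrum.asIdeal e)

end DimStep

section Families
variable {R M : Type*} [CommRing R] [AddCommGroup M] [Module R M]
open IsLocalRing

lemma smul_satur_le {I J : Ideal R} {A B : Submodule R M} (h : I • A ≤ B) :
    I • satur J A ≤ satur J B := by
  refine Submodule.smul_le.2 fun r hr y hy => ?_
  obtain ⟨n, hn⟩ := mem_satur.1 hy
  refine mem_satur.2 ⟨n, fun s hs => ?_⟩
  rw [smul_comm]
  exact h (Submodule.smul_mem_smul hr (hn s hs))

/-- The family of `𝔪`-saturations of `I ^ (n + 1) M` in `I ^ n M`. -/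
def satFam (J I : Ideal R) (M : Type*) [AddCommGroup M] [Module R M] : GFam I M where
  N n := satur J (I ^ (n + 1) • ⊤) ⊓ I ^ n • ⊤
  smul_le n := by
    refine le_inf ((smul_mono_right _ inf_le_left).trans (smul_satur_le ?_))
      ((smul_mono_right _ inf_le_right).trans ?_)
    · rw [← mul_smul, ← pow_succ']
    · rw [← mul_smul, ← pow_succ']

lemma satFam_le (J I : Ideal R) (n : ℕ) : (satFam J I M).N n ≤ I ^ n • ⊤ := inf_le_right

/-- The family `satFam` enlarged by `a I ^ (n - 1) M`. -/
def addFam (J I : Ideal R) (M : Type*) [AddCommGroup M] [Module R M] (a : R) : GFam I M where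
  N
    | 0 => (satFam J I M).N 0
    | n + 1 => (satFam J I M).N (n + 1) ⊔ am a (I ^ n • ⊤)
  smul_le
    | 0 => ((satFam J I M).smul_le 0).trans le_sup_left
    | n + 1 => by
      change I • (_ ⊔ _) ≤ _
      rw [Submodule.smul_sup]
      refine sup_le (((satFam J I M).smul_le (n + 1)).trans le_sup_left) (le_sup_of_le_right ?_)
      refine Submodule.smul_le.2 fun r hr y hy => ?_
      obtain ⟨z, hz, rfl⟩ := mem_am.1 hy
      rw [smul_comm]
      refine smul_mem_am ?_
      rw [pow_succ', mul_smul]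
      exact Submodule.smul_mem_smul hr hz

lemma satFam_le_addFam (J I : Ideal R) (a : R) : ∀ n, (satFam J I M).N n ≤ (addFam J I M a).N n
  | 0 => le_rfl
  | _ + 1 => le_sup_left

lemma am_pow_le {I : Ideal R} {a : R} (ha : a ∈ I) (n : ℕ) :
    am a (I ^ n • ⊤ : Submodule R M) ≤ I ^ (n + 1) • ⊤ := by
  rintro _ ⟨z, hz, rfl⟩
  rw [pow_succ', mul_smul]
  exact Submodule.smul_mem_smul ha hz

/-- The `𝔪`-saturation of `addFam` in `I ^ n M`. -/
def addSat (J I : Ideal R) (M : Type*) [AddCommGroup M] [Module R M] (a : R) : GFam I M where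
  N n := satur J ((addFam J I M a).N n) ⊓ I ^ n • ⊤
  smul_le n := by
    refine le_inf ((smul_mono_right _ inf_le_left).trans (smul_satur_le ?_))
      ((smul_mono_right _ inf_le_right).trans ?_)
    · exact (addFam J I M a).smul_le n
    · rw [← mul_smul, ← pow_succ']

lemma addSat_le (J I : Ideal R) (a : R) (n : ℕ) : (addSat J I M a).N n ≤ I ^ n • ⊤ := inf_le_right

lemma mem_annihilator_gquot {I : Ideal R} {F G : GFam I M} {r : Rees I} :
    r ∈ Module.annihilator (Rees I) (GQuot F G) ↔ ∀ f ∈ F.sub, r • f ∈ G.sub := by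
  rw [Module.mem_annihilator]
  constructor
  · intro h f hf
    have := h ((G.sub.comap F.sub.subtype).mkQ ⟨f, hf⟩)
    rw [← map_smul] at this
    have h2 := (Submodule.Quotient.mk_eq_zero _).1 this
    exact h2
  · intro h e
    obtain ⟨f, rfl⟩ := Submodule.mkQ_surjective _ e
    rw [← map_smul]
    exact (Submodule.Quotient.mk_eq_zero _).2 (h f f.2)

lemma exists_pow_le_annihilator_gquot {I : Ideal R} {F G : GFam I M} (J : Ideal R)
    [Module.Finite (Rees I) (GQuot F G)] (h : ∀ n, F.N n ≤ satur J (G.N n)) :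
    ∃ k, J.map (algebraMap R (Rees I)) ^ k ≤ Module.annihilator (Rees I) (GQuot F G) := by
  refine exists_pow_le_annihilator_of_forall _ fun y => ?_
  obtain ⟨⟨f, hf⟩, rfl⟩ := Submodule.mkQ_surjective _ y
  obtain ⟨s, hs, hs0⟩ := RMod.eq_sum f
  choose k hk using fun n => mem_satur.1 (h n (hf n))
  refine ⟨s.sup k, fun r hr => ?_⟩
  rw [← Ideal.map_pow] at hr
  have : (J ^ s.sup k).map (algebraMap R (Rees I)) ≤
      LinearMap.ker (LinearMap.toSpanSingleton (Rees I) (GQuot F G)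
        ((G.sub.comap F.sub.subtype).mkQ ⟨f, hf⟩)) := by
    rw [Ideal.map_le_iff_le_comap]
    intro r hr
    rw [Ideal.mem_comap, LinearMap.mem_ker, LinearMap.toSpanSingleton_apply, ← map_smul]
    refine (Submodule.Quotient.mk_eq_zero _).2 ?_
    change algebraMap R (Rees I) r • f ∈ G.sub
    intro i
    rw [algebraMap_smul, map_smul]
    by_cases hi : i ∈ s
    · exact hk i r (Ideal.pow_le_pow_right (Finset.le_sup hi) hr)
    · rw [hs0 i hi, smul_zero]; exact Submodule.zero_mem _
  have := this hr
  rwa [LinearMap.mem_ker, LinearMap.toSpanSingleton_apply] at this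

end Families

section Irrelevant
variable {R : Type*} [CommRing R] {I : Ideal R}
open IsLocalRing

lemma Rees.cf_mul (f g : Rees I) (n : ℕ) :
    Rees.cf n (f * g) = ∑ p ∈ Finset.HasAntidiagonal.antidiagonal n, f.cf p.1 * g.cf p.2 :=
  Polynomial.coeff_mul _ _ _

lemma Rees.cf_zero_algebraMap (r : R) : Rees.cf 0 (algebraMap R (Rees I) r) = r := by
  change (algebraMap R (Polynomial R) r).coeff 0 = r
  simp

/-- The projection of the Rees algebra onto its degree-zero part. -/
def Rees.proj (I : Ideal R) : Rees I →+* R :=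
  Polynomial.constantCoeff.comp (reesAlgebra I).val.toRingHom

lemma Rees.proj_apply (f : Rees I) : Rees.proj I f = f.cf 0 := rfl

lemma exists_sub_mem_span_xt {m : ℕ} {x : Fin m → R} (hx : Ideal.span (Set.range x) = I)
    (f : Rees I) : f - algebraMap R (Rees I) (f.cf 0) ∈ Ideal.span (Set.range (xt hx)) := by
  set X := Ideal.span (Set.range (xt hx))
  have key : ∀ g ∈ Algebra.adjoin R (Submodule.map (Polynomial.monomial 1 : R →ₗ[R] Polynomial R) I :
      Set (Polynomial R)), ∃ h : Rees I, (reesAlgebra I).val h = g ∧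
        ∃ r, h - algebraMap R (Rees I) r ∈ X := by
    intro g hg
    induction hg using Algebra.adjoin_induction with
    | mem g hg =>
      obtain ⟨r, hr, rfl⟩ := hg
      exact ⟨rt ⟨r, hr⟩, rfl, 0, by rw [map_zero, sub_zero]; exact rt_mem_span hx _⟩
    | algebraMap r => exact ⟨algebraMap R (Rees I) r, rfl, r, by simp⟩
    | add a b _ _ ha hb =>
      obtain ⟨h, rfl, r, hr⟩ := ha
      obtain ⟨h', rfl, r', hr'⟩ := hb
      refine ⟨h + h', rfl, r + r', ?_⟩
      rw [map_add, add_sub_add_comm]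
      exact X.add_mem hr hr'
    | mul a b _ _ ha hb =>
      obtain ⟨h, rfl, r, hr⟩ := ha
      obtain ⟨h', rfl, r', hr'⟩ := hb
      refine ⟨h * h', rfl, r * r', ?_⟩
      have : h * h' - algebraMap R (Rees I) (r * r') =
          h * (h' - algebraMap R (Rees I) r') + algebraMap R (Rees I) r' * (h - algebraMap R (Rees I) r) := by
        rw [map_mul]; ring
      rw [this]
      exact X.add_mem (X.mul_mem_left _ hr') (X.mul_mem_left _ hr)
  obtain ⟨h, hh, r, hr⟩ := key ((reesAlgebra I).val f) (by
    rw [adjoin_monomial_eq_reesAlgebra]; exact f.2)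
  obtain rfl : h = f := Subtype.ext hh
  have hX : X ≤ RingHom.ker (Rees.proj I) := by
    rw [Ideal.span_le]
    rintro _ ⟨l, rfl⟩
    change (Polynomial.monomial 1 (x l)).coeff 0 = 0
    simp
  have h0 := hX hr
  rw [RingHom.mem_ker, map_sub, Rees.proj_apply, Rees.proj_apply, Rees.cf_zero_algebraMap,
    sub_eq_zero] at h0
  rwa [h0]

variable [IsLocalRing R]

variable (I) in
/-- The irrelevant maximal ideal of the Rees algebra. -/
def Rees.irr : Ideal (Rees I) := RingHom.ker ((residue R).comp (Rees.proj I))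

lemma Rees.mem_irr {f : Rees I} : f ∈ Rees.irr I ↔ f.cf 0 ∈ maximalIdeal R := by
  rw [Rees.irr, RingHom.mem_ker, RingHom.comp_apply, residue_eq_zero_iff, Rees.proj_apply]

instance : (Rees.irr I).IsMaximal := by
  refine RingHom.ker_isMaximal_of_surjective _ fun r => ?_
  obtain ⟨r, rfl⟩ := residue_surjective r
  exact ⟨algebraMap R _ r, by rw [RingHom.comp_apply, Rees.proj_apply, Rees.cf_zero_algebraMap]⟩

lemma Rees.mk_irr_surjective :
    Function.Surjective ((Ideal.Quotient.mk (Rees.irr I)).comp (algebraMap R (Rees I))) := by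
  intro z
  obtain ⟨f, rfl⟩ := Ideal.Quotient.mk_surjective z
  refine ⟨f.cf 0, ?_⟩
  rw [RingHom.comp_apply, Ideal.Quotient.eq, Rees.mem_irr, map_sub, Rees.cf_zero_algebraMap, sub_self]
  exact Ideal.zero_mem _

lemma Rees.irr_le {m : ℕ} {x : Fin m → R} (hx : Ideal.span (Set.range x) = I) {P : Ideal (Rees I)}
    (h : (maximalIdeal R).map (algebraMap R (Rees I)) ≤ P) (h' : Ideal.span (Set.range (xt hx)) ≤ P) :
    Rees.irr I ≤ P := by
  intro f hf
  rw [Rees.mem_irr] at hf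
  have := P.add_mem (h' (exists_sub_mem_span_xt hx f)) (h (Ideal.mem_map_of_mem _ hf))
  simpa using this

lemma Rees.cf_mem_of_mem_irr_pow (N : ℕ) : ∀ {f : Rees I}, f ∈ Rees.irr I ^ N → ∀ i,
    f.cf i ∈ maximalIdeal R ^ (N - i) * I ^ i := by
  induction N with
  | zero => intro f _ i; simpa using f.cf_mem i
  | succ N ih =>
    intro f hf i
    rw [pow_succ] at hf
    induction hf using Submodule.mul_induction_on' with
    | mem_mul_mem a ha b hb =>
      rw [Rees.cf_mul]
      refine Ideal.sum_mem _ fun p hp => ?_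
      rw [Finset.HasAntidiagonal.mem_antidiagonal] at hp
      have h1 := ih ha p.1
      rcases hq : p.2 with _ | q
      · rw [Rees.mem_irr] at hb
        have h2 := Ideal.mul_mem_mul h1 hb
        have : p.1 = i := by lia
        rw [this] at h2 ⊢
        rw [mul_right_comm, ← pow_succ] at h2
        exact Ideal.mul_mono_left (Ideal.pow_le_pow_right (by lia)) h2
      · have h2 := Ideal.mul_mem_mul h1 (b.cf_mem (q + 1))
        rw [mul_assoc, ← pow_add] at h2
        rw [show p.1 + (q + 1) = i by lia] at h2
        exact Ideal.mul_mono_left (Ideal.pow_le_pow_right (by lia)) h2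
    | add a _ b _ ha hb => rw [map_add]; exact Ideal.add_mem _ ha hb

end Irrelevant

section Bound
set_option linter.unusedSectionVars false
variable {R M : Type*} [CommRing R] [AddCommGroup M] [Module R M]
  [IsNoetherianRing R] [IsLocalRing R] [Module.Finite R M] {I : Ideal R}
open IsLocalRing

lemma satur_satFam_le (n : ℕ) : satur (maximalIdeal R) ((satFam (maximalIdeal R) I M).N n) ⊓
    (I ^ n • ⊤ : Submodule R M) ≤ (satFam (maximalIdeal R) I M).N n := by
  refine le_inf (inf_le_left.trans ?_) inf_le_right
  exact (satur_mono _ inf_le_left).trans (satur_satur _ _).le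

lemma finite_gquot {F G : GFam I M} (h : ∀ n, F.N n ≤ I ^ n • ⊤) :
    Module.Finite (Rees I) (GQuot F G) :=
  have := finite_sub h
  inferInstance

lemma eventually_coheight_le {m : ℕ} {x : Fin m → R} (hx : Ideal.span (Set.range x) = I)
    {𝓤 : Filter (Fin m → R)} (h : IsGenericRow 𝓤) {D : ℕ} (hd : DimLE R M (D + 2)) :
    ∀ᶠ c in 𝓤, ∀ P : PrimeSpectrum (Rees I),
      Module.annihilator (Rees I) (GQuot (addSat (maximalIdeal R) I M (lin x c))
        (addFam (maximalIdeal R) I M (lin x c))) ≤ P.asIdeal →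
      P.asIdeal ≤ Rees.irr I → Order.coheight P ≤ D := by
  set G := GQuot (powFam I M) (satFam (maximalIdeal R) I M)
  set J := (maximalIdeal R).map (algebraMap R (Rees I))
  have hfin := Ideal.finite_minimalPrimes_of_isNoetherianRing (Rees I)
    (Module.annihilator (Rees I) G ⊔ J)
  filter_upwards [eventually_forall_lin_notMem h (xt hx) hfin] with c hc P hP hPn
  rw [lin_xt] at hc
  set a := lin x c
  have ha : a ∈ I := lin_mem_of_eq hx c
  have hG : Module.annihilator (Rees I) G ≤ P.asIdeal := by
    refine le_trans (fun r hr => ?_) hP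
    rw [mem_annihilator_gquot] at hr ⊢
    exact fun f hf => GFam.sub_mono (satFam_le_addFam _ _ _) (hr f (GFam.sub_mono (addSat_le _ _ _) hf))
  have haP : rt ⟨a, ha⟩ ∈ P.asIdeal := by
    refine hP (mem_annihilator_gquot.2 fun f hf i => ?_)
    rcases i with _ | i
    · rw [cf_rt_smul_zero]; exact Submodule.zero_mem _
    · rw [cf_rt_smul_succ]
      exact Submodule.mem_sup_right (smul_mem_am (addSat_le _ _ _ _ (hf i)))
  have hJP : J ≤ P.asIdeal := by
    have := finite_gquot (G := addFam (maximalIdeal R) I M a) (addSat_le (M := M) (maximalIdeal R) I a)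
    obtain ⟨k, hk⟩ := exists_pow_le_annihilator_gquot (F := addSat (maximalIdeal R) I M a)
      (G := addFam (maximalIdeal R) I M a) (maximalIdeal R) fun n => inf_le_left
    exact P.2.le_of_pow_le (hk.trans hP)
  have hP' := P.2
  obtain ⟨Q, hQ, hQP⟩ := Ideal.exists_minimalPrimes_le (sup_le hG hJP)
  have hQp := hQ.1.1
  by_cases haQ : rt ⟨a, ha⟩ ∈ Q
  · have hX := (hc Q hQ haQ).trans hQP
    have hmax : P.asIdeal.IsMaximal := by
      rw [le_antisymm hPn (Rees.irr_le hx hJP hX)]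
      infer_instance
    rw [Order.coheight_eq_zero.2]
    · exact bot_le
    · exact fun T hT => hmax.eq_of_le T.2.ne_top hT |>.ge
  obtain ⟨Q', hQ', hQ'Q⟩ := Ideal.exists_minimalPrimes_le (le_sup_left.trans hQ.1.2)
  have hQp' := hQ'.1.1
  have hne : Q' ≠ Q := by
    rintro rfl
    have hass := Module.associatedPrimes.minimalPrimes_annihilator_subset_associatedPrimes _ _ hQ'
    refine not_le_of_associated J (fun y hy => ?_) hass (le_sup_right.trans hQ.1.2)
    obtain ⟨⟨f, hf⟩, rfl⟩ := Submodule.mkQ_surjective _ y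
    refine (Submodule.Quotient.mk_eq_zero _).2 ?_
    intro i
    refine satur_satFam_le i ⟨mem_satur.2 ⟨1, fun r hr => ?_⟩, hf i⟩
    rw [pow_one] at hr
    have h1 := hy _ (Ideal.mem_map_of_mem _ hr)
    rw [← map_smul] at h1
    have h2 := (Submodule.Quotient.mk_eq_zero _).1 h1 i
    change RMod.cf i (algebraMap R (Rees I) r • f) ∈ _ at h2
    rwa [algebraMap_smul, map_smul] at h2
  have h0 : Order.coheight (⟨Q', hQp'⟩ : PrimeSpectrum (Rees I)) ≤ (D + 1 + 1 : ℕ) := by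
    refine coheight_rees_le hd (le_trans (fun r hr => ?_) hQ'.1.2) (le_trans ?_ hQ'.1.2)
    · refine mem_annihilator_gquot.2 fun f hf => ?_
      have := congrArg Subtype.val (Module.mem_annihilator.1 hr ⟨f, hf⟩)
      change r • f = 0 at this
      rw [this]
      exact Submodule.zero_mem _
    · rw [Ideal.map_le_iff_le_comap]
      intro r hr
      refine mem_annihilator_gquot.2 fun f hf i => ?_
      rw [algebraMap_smul, map_smul]
      refine ⟨le_satur _ _ ?_, Submodule.smul_mem _ _ (hf i)⟩
      rw [pow_succ', mul_smul]
      exact Submodule.smul_mem_smul hr (hf i)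
  have h1 : Order.coheight (⟨Q, hQp⟩ : PrimeSpectrum (Rees I)) ≤ (D + 1 : ℕ) :=
    coheight_le_of_lt (lt_of_le_of_ne hQ'Q fun e => hne (congrArg PrimeSpectrum.asIdeal e)) le_rfl h0
  refine coheight_le_of_lt (P := ⟨Q, hQp⟩) (lt_of_le_of_ne hQP fun e => haQ ?_) le_rfl h1
  rw [← e] at haP
  exact haP

lemma mem_of_mem_irr_pow {F G : GFam I M} {k : ℕ}
    (hk : (maximalIdeal R).map (algebraMap R (Rees I)) ^ k ≤
      Module.annihilator (Rees I) (GQuot F G)) (n : ℕ) (y : F.sub)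
    (hy : (G.sub.comap F.sub.subtype).mkQ y ∈
      (Rees.irr I ^ (n + 1 + k) • ⊤ : Submodule (Rees I) (GQuot F G))) :
    ∀ i ≤ n, RMod.cf i (y : RMod I M) ∈ G.N i := by
  have hmain : ∀ e ∈ (Rees.irr I ^ (n + 1 + k) • ⊤ : Submodule (Rees I) (GQuot F G)),
      ∃ y : F.sub, (G.sub.comap F.sub.subtype).mkQ y = e ∧ ∀ i ≤ n, RMod.cf i (y : RMod I M) ∈ G.N i := by
    intro e he
    refine Submodule.smul_induction_on he (fun r hr z _ => ?_) fun a b ha hb => ?_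
    · obtain ⟨⟨f, hf⟩, rfl⟩ := Submodule.mkQ_surjective _ z
      refine ⟨r • ⟨f, hf⟩, rfl, fun i hi => ?_⟩
      change RMod.cf i (r • f) ∈ _
      rw [RMod.cf_smul]
      refine Submodule.sum_mem _ fun p hp => ?_
      rw [Finset.HasAntidiagonal.mem_antidiagonal] at hp
      have h1 := Rees.cf_mem_of_mem_irr_pow _ hr p.1
      have h2 : maximalIdeal R ^ (n + 1 + k - p.1) * I ^ p.1 ≤ I ^ p.1 * maximalIdeal R ^ k := by
        rw [mul_comm]
        exact Ideal.mul_mono_right (Ideal.pow_le_pow_right (by lia))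
      have h3 := Submodule.smul_mem_smul (h2 h1) (hf p.2)
      rw [mul_smul] at h3
      have h4 : maximalIdeal R ^ k • F.N p.2 ≤ G.N p.2 := by
        refine Submodule.smul_le.2 fun s hs y hy => ?_
        have h5 := Ideal.mem_map_of_mem (algebraMap R (Rees I)) hs
        rw [Ideal.map_pow] at h5
        have := mem_annihilator_gquot.1 (hk h5) _ (F.sg_mem_sub.2 hy)
        rw [algebraMap_smul, ← map_smul] at this
        exact G.sg_mem_sub.1 this
      rw [← hp]
      exact G.pow_smul_le _ _ (smul_mono_right _ h4 h3)
    · obtain ⟨y, rfl, hy⟩ := ha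
      obtain ⟨y', rfl, hy'⟩ := hb
      refine ⟨y + y', map_add _ _ _, fun i hi => ?_⟩
      have := Submodule.add_mem _ (hy i hi) (hy' i hi)
      rwa [← map_add] at this
  obtain ⟨y', hy', h⟩ := hmain _ hy
  have h1 := (Submodule.Quotient.eq _).1 hy'
  intro i hi
  have h2 := h1 i
  change RMod.cf i ((y' : RMod I M) - (y : RMod I M)) ∈ _ at h2
  rw [map_sub] at h2
  have := Submodule.sub_mem _ (h i hi) h2
  simpa using this

lemma sum_rlen_le {F G : GFam I M} {k : ℕ}
    (hk : (maximalIdeal R).map (algebraMap R (Rees I)) ^ k ≤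
      Module.annihilator (Rees I) (GQuot F G)) (n : ℕ) :
    ∑ i : Fin (n + 1), rlen (G.N i) (F.N i) ≤
      rlen (powSub R (Rees.irr I) (GQuot F G) (n + 1 + k)) ⊤ := by
  let ψi : ∀ i : Fin (n + 1), F.sub →ₗ[R] (F.N i).map (G.N i).mkQ := fun i =>
    LinearMap.codRestrict _ ((G.N i).mkQ ∘ₗ RMod.cf i ∘ₗ F.sub.subtype.restrictScalars R)
      fun f => ⟨_, f.2 i, rfl⟩
  let ψ := LinearMap.pi ψi
  have hψ : Function.Surjective ψ := by
    intro z
    choose w hw hwz using fun i => (z i).2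
    refine ⟨⟨∑ i : Fin (n + 1), RMod.sg I i (w i), fun j => ?_⟩, ?_⟩
    · rw [map_sum]
      refine Submodule.sum_mem _ fun i _ => F.sg_mem_sub.2 (hw i) j
    · funext i
      apply Subtype.ext
      change (G.N i).mkQ (RMod.cf i (∑ i : Fin (n + 1), RMod.sg I i (w i))) = _
      rw [map_sum, Finset.sum_eq_single i, RMod.cf_sg_self, hwz]
      · exact fun j _ hj => RMod.cf_sg_ne (fun e => hj (Fin.ext e)) _
      · simp
  have e1 : ∑ i : Fin (n + 1), rlen (G.N i) (F.N i) = rlen (LinearMap.ker ψ) ⊤ := by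
    rw [rlen_top, (ψ.quotKerEquivOfSurjective hψ).length_eq, Module.length_pi_of_fintype]
    rfl
  let π : F.sub →ₗ[R] GQuot F G := (G.sub.comap F.sub.subtype).mkQ.restrictScalars R
  have hπ : (⊤ : Submodule R F.sub).map π = ⊤ := by
    refine eq_top_iff.2 fun z _ => ?_
    obtain ⟨y, rfl⟩ := Submodule.mkQ_surjective (G.sub.comap F.sub.subtype) z
    exact ⟨y, trivial, rfl⟩
  have e2 : rlen (powSub R (Rees.irr I) (GQuot F G) (n + 1 + k)) ⊤ =
      rlen ((powSub R (Rees.irr I) (GQuot F G) (n + 1 + k)).comap π) ⊤ := by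
    have := rlen_map π (powSub R (Rees.irr I) (GQuot F G) (n + 1 + k)) ⊤
    rwa [hπ] at this
  rw [e1, e2]
  refine rlen_antitone (fun y hy => ?_) _
  rw [LinearMap.mem_ker]
  funext i
  apply Subtype.ext
  exact (Submodule.Quotient.mk_eq_zero _).2 (mem_of_mem_irr_pow hk n y hy i (Nat.lt_succ_iff.1 i.2))

lemma eventually_bound {m : ℕ} {x : Fin m → R} (hx : Ideal.span (Set.range x) = I)
    {𝓤 : Filter (Fin m → R)} (h : IsGenericRow 𝓤) {D : ℕ} (hd : DimLE R M (D + 2)) :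
    ∀ᶠ c in 𝓤, ∃ C : ℕ, ∀ n : ℕ, ∑ i ∈ Finset.range (n + 1),
      rlen ((addFam (maximalIdeal R) I M (lin x c)).N i)
        ((addSat (maximalIdeal R) I M (lin x c)).N i) ≤ ((C * (n + 1) ^ D : ℕ) : ℕ∞) := by
  filter_upwards [eventually_coheight_le hx h hd] with c hc
  set F := addSat (maximalIdeal R) I M (lin x c)
  set G := addFam (maximalIdeal R) I M (lin x c)
  have hfin : Module.Finite (Rees I) (GQuot F G) := finite_gquot (addSat_le _ _ _)
  obtain ⟨k, hk⟩ := exists_pow_le_annihilator_gquot (F := F) (G := G) (maximalIdeal R)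
    fun n => inf_le_left
  obtain ⟨C, hC⟩ := hs_bound Rees.mk_irr_surjective D (GQuot F G) hc
  refine ⟨C * (k + 2) ^ D, fun n => ?_⟩
  rw [Finset.sum_range]
  refine (sum_rlen_le hk n).trans ((hC _).trans ?_)
  rw [mul_assoc, ← mul_pow]
  exact_mod_cast Nat.mul_le_mul_left _ (Nat.pow_le_pow_left (by nlinarith) _)

end Bound

section Step
set_option linter.unusedSectionVars false
variable {R M : Type*} [CommRing R] [AddCommGroup M] [Module R M]
open IsLocalRing

/-- The length of `H⁰_J(IⁿM/Iⁿ⁺¹M)`. -/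
def jl (J I : Ideal R) (M : Type*) [AddCommGroup M] [Module R M] (n : ℕ) : ℕ∞ :=
  rlen (I ^ (n + 1) • ⊤ : Submodule R M) ((satFam J I M).N n)

lemma mLength_H0_gradedPiece (J I : Ideal R) (n : ℕ) :
    mLength R (H0 J (gradedPiece I (M := M) n)) = jl J I M n := by
  rw [mLength_eq]
  exact length_H0_map J _ _

lemma pow_smul_top_anti (I : Ideal R) {i j : ℕ} (h : i ≤ j) :
    (I ^ j • ⊤ : Submodule R M) ≤ I ^ i • ⊤ := Submodule.smul_mono_left (Ideal.pow_le_pow_right h)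

lemma inf_map_eq {N : Type*} [AddCommGroup N] [Module R N] (f : M →ₗ[R] N) (B : Submodule R N)
    (C : Submodule R M) : B ⊓ C.map f = (B.comap f ⊓ C).map f := by
  ext y
  constructor
  · rintro ⟨h, z, hz, rfl⟩
    exact ⟨z, ⟨h, hz⟩, rfl⟩
  · rintro ⟨z, ⟨h, hz⟩, rfl⟩
    exact ⟨h, z, hz, rfl⟩

lemma jl_quotient (J I : Ideal R) (L : Submodule R M) (n : ℕ) :
    jl J I (M ⧸ L) n = rlen (L ⊔ I ^ (n + 1) • ⊤)
      (satur J (L ⊔ I ^ (n + 1) • ⊤) ⊓ (I ^ n • ⊤ : Submodule R M)) := by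
  have h : ∀ n, (I ^ n • ⊤ : Submodule R (M ⧸ L)) = (I ^ n • ⊤ : Submodule R M).map L.mkQ := by
    intro n
    rw [Submodule.map_smul'', Submodule.map_top, Submodule.range_mkQ]
  have h1 : (satFam J I (M ⧸ L)).N n =
      (satur J (L ⊔ I ^ (n + 1) • ⊤) ⊓ (I ^ n • ⊤ : Submodule R M)).map L.mkQ := by
    change satur J _ ⊓ _ = _
    rw [h n, inf_map_eq, comap_satur, h (n + 1), Submodule.comap_map_mkQ]
  rw [jl, h1, rlen_map, h (n + 1), Submodule.comap_map_mkQ]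

lemma pow_smul_am (I : Ideal R) (a : R) (n : ℕ) :
    I ^ n • am a (⊤ : Submodule R M) = am a (I ^ n • ⊤) := by
  rw [am, am, Submodule.map_smul'']

variable [IsNoetherianRing R] [Module.Finite R M] {I : Ideal R}

/-- Artin–Rees for the saturation of `aM`. -/
lemma exists_satur_inf_le (I : Ideal R) (a : R) : ∃ κ, ∀ n ≥ κ,
    satur I (am a ⊤) ⊓ (I ^ n • ⊤ : Submodule R M) ≤ am a (I ^ (n - κ) • ⊤) := by
  set L := satur I (am a (⊤ : Submodule R M))
  obtain ⟨k, hk⟩ := Ideal.exists_pow_inf_eq_pow_smul I L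
  obtain ⟨k', hk'⟩ := exists_pow_smul_satur_le I (am a (⊤ : Submodule R M))
  refine ⟨k + k', fun n hn => ?_⟩
  rw [inf_comm, hk n (by lia), show n - k = (n - (k + k')) + k' by lia, pow_add, mul_smul, ← pow_smul_am]
  exact smul_mono_right _ ((smul_mono_right _ inf_le_right).trans hk')

lemma mem_pow_of_smul_mem {a : R} {n₀ : ℕ}
    (h : ∀ n ≥ n₀, ∀ y ∈ (I ^ n • ⊤ : Submodule R M), a • y ∈ (I ^ (n + 2) • ⊤ : Submodule R M) →
      y ∈ (I ^ (n + 1) • ⊤ : Submodule R M)) (i : ℕ) : ∀ j ≥ n₀, ∀ y ∈ (I ^ j • ⊤ : Submodule R M),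
      a • y ∈ (I ^ (j + i + 1) • ⊤ : Submodule R M) → y ∈ (I ^ (j + i) • ⊤ : Submodule R M) := by
  induction i with
  | zero => intro j _ y hy _; exact hy
  | succ i ih =>
    intro j hj y hy hay
    have h1 := h j hj y hy (pow_smul_top_anti I (by lia) hay)
    rw [show j + (i + 1) = j + 1 + i by lia] at hay ⊢
    exact ih (j + 1) (by lia) y h1 hay

lemma exists_satur_inf_eq {a : R} (ha : a ∈ I) {n₀ : ℕ}
    (h : ∀ n ≥ n₀, ∀ y ∈ (I ^ n • ⊤ : Submodule R M), a • y ∈ (I ^ (n + 2) • ⊤ : Submodule R M) →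
      y ∈ (I ^ (n + 1) • ⊤ : Submodule R M)) :
    ∃ n₁, ∀ n ≥ n₁, satur I (am a ⊤) ⊓ (I ^ (n + 1) • ⊤ : Submodule R M) = am a (I ^ n • ⊤) := by
  obtain ⟨κ, hκ⟩ := exists_satur_inf_le (M := M) I a
  refine ⟨n₀ + κ + 1, fun n hn => le_antisymm (fun y hy => ?_) ?_⟩
  · obtain ⟨z, hz, rfl⟩ := hκ (n + 1) (by lia) hy
    refine smul_mem_am ?_
    obtain ⟨i, hi⟩ := Nat.exists_eq_add_of_le (show n + 1 - (κ + 1) ≤ n by lia)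
    have h1 := mem_pow_of_smul_mem h i (n + 1 - (κ + 1)) (by lia) z
      (pow_smul_top_anti I (by lia) hz)
    rw [← hi] at h1
    exact h1 hy.2
  · exact le_inf ((am_mono a le_top).trans (le_satur _ _)) (am_pow_le ha n)

variable [IsLocalRing R]

lemma rlen_satur_ne_top (A : Submodule R M) : rlen A (satur (maximalIdeal R) A) ≠ ⊤ := by
  obtain ⟨k, hk⟩ := exists_pow_smul_satur_le (maximalIdeal R) A
  exact rlen_ne_top hk

lemma jl_ne_top (n : ℕ) : jl (maximalIdeal R) I M n ≠ ⊤ :=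
  ne_top_of_le_ne_top (rlen_satur_ne_top _) (rlen_mono _ inf_le_left)

lemma le_satFam (J : Ideal R) (n : ℕ) : (I ^ (n + 1) • ⊤ : Submodule R M) ≤ (satFam J I M).N n :=
  le_inf (le_satur _ _) (pow_smul_top_anti I (by lia))

lemma jl_recursion {a : R} (ha : a ∈ I) {n : ℕ}
    (h1 : ∀ y ∈ (I ^ n • ⊤ : Submodule R M), a • y ∈ (I ^ (n + 2) • ⊤ : Submodule R M) →
      y ∈ (I ^ (n + 1) • ⊤ : Submodule R M))
    (h2 : ∀ y ∈ (I ^ n • ⊤ : Submodule R M), a • y ∈ (satFam (maximalIdeal R) I M).N (n + 1) →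
      y ∈ (satFam (maximalIdeal R) I M).N n)
    (h3 : satur I (am a ⊤) ⊓ (I ^ (n + 1) • ⊤ : Submodule R M) = am a (I ^ n • ⊤)) :
    jl (maximalIdeal R) I M (n + 1) + rlen ((addFam (maximalIdeal R) I M a).N (n + 1))
      ((addSat (maximalIdeal R) I M a).N (n + 1)) =
    jl (maximalIdeal R) I M n + jl (maximalIdeal R) I (M ⧸ satur I (am a (⊤ : Submodule R M))) (n + 1) := by
  set L := satur I (am a (⊤ : Submodule R M))
  set U := satFam (maximalIdeal R) I M
  set V := (addFam (maximalIdeal R) I M a).N (n + 1) with hV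
  set W := (addSat (maximalIdeal R) I M a).N (n + 1) with hW
  set P : ℕ → Submodule R M := fun n => I ^ n • ⊤ with hP
  have hVdef : V = U.N (n + 1) ⊔ am a (P n) := rfl
  have hWdef : W = satur (maximalIdeal R) V ⊓ P (n + 1) := rfl
  set Y := P (n + 2) ⊔ am a (P n) with hY
  set Z := P (n + 2) ⊔ am a (U.N n) with hZ
  have hPU : P (n + 2) ≤ U.N (n + 1) := le_satFam _ _
  have hUP : U.N (n + 1) ≤ P (n + 1) := satFam_le _ _ _
  have hPP : P (n + 2) ≤ P (n + 1) := pow_smul_top_anti I (by lia)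
  have haP : am a (P n) ≤ P (n + 1) := am_pow_le ha n
  have hYV : Y ≤ V := sup_le_sup_right hPU _
  have hVs : V ≤ satur (maximalIdeal R) Y := by
    refine sup_le (inf_le_left.trans (satur_mono _ le_sup_left)) (le_sup_right.trans (le_satur _ _))
  have hVP : V ≤ P (n + 1) := sup_le hUP haP
  have hVW : V ≤ W := le_inf (le_satur _ _) hVP
  have hAP : (L ⊔ P (n + 2)) ⊓ P (n + 1) = Y := by
    rw [sup_comm, sup_inf_assoc_of_le _ hPP, h3]
  have hT : satur (maximalIdeal R) (L ⊔ P (n + 2)) ⊓ P (n + 1) = W := by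
    rw [hWdef]
    refine le_antisymm (le_inf ?_ inf_le_right) (le_inf ?_ inf_le_right)
    · rintro y ⟨hy, hyP⟩
      obtain ⟨k, hk⟩ := mem_satur.1 hy
      refine satur_mono _ hYV (mem_satur.2 ⟨k, fun r hr => ?_⟩)
      rw [← hAP]
      exact ⟨hk r hr, Submodule.smul_mem _ _ hyP⟩
    · refine inf_le_left.trans ((satur_mono _ hVs).trans ?_)
      rw [satur_satur, ← hAP]
      exact satur_mono _ inf_le_left
  have hg : jl (maximalIdeal R) I (M ⧸ L) (n + 1) = rlen Y (U.N (n + 1)) + rlen V W := by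
    rw [jl_quotient]
    change rlen (L ⊔ P (n + 2)) (satur (maximalIdeal R) (L ⊔ P (n + 2)) ⊓ P (n + 1)) = _
    rw [hT, rlen_congr (A' := Y), rlen_add hYV hVW]
    · congr 1
      have : V = U.N (n + 1) ⊔ Y := by
        rw [hVdef, hY, ← sup_assoc, sup_eq_left.2 hPU]
      rw [this, rlen_sup']
    · rw [← hAP, inf_assoc, inf_eq_right.2 (show W ≤ P (n + 1) from inf_le_right)]
  have hZU : Z ≤ U.N (n + 1) := by
    refine sup_le hPU ?_
    rintro _ ⟨z, hz, rfl⟩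
    exact U.smul_le n (Submodule.smul_mem_smul ha hz)
  have hf : jl (maximalIdeal R) I M (n + 1) =
      jl (maximalIdeal R) I M n + rlen Y (U.N (n + 1)) := by
    change rlen (P (n + 2)) (U.N (n + 1)) = rlen (P (n + 1)) (U.N n) + _
    rw [rlen_add (show P (n + 2) ≤ Z from le_sup_left) hZU, hZ, rlen_sup]
    congr 1
    · rw [am, rlen_map]
      refine rlen_congr (le_antisymm ?_ ?_)
      · rintro y ⟨hy, hyU⟩
        exact ⟨h1 y hyU.2 hy, hyU⟩
      · rintro y ⟨hy, hyU⟩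
        refine ⟨?_, hyU⟩
        exact am_pow_le ha (n + 1) (smul_mem_am hy)
    · refine rlen_congr (le_antisymm ?_ ?_)
      · exact inf_le_inf_right _ (sup_le_sup_left (am_mono a (satFam_le _ _ _)) _)
      · rw [hY, sup_inf_assoc_of_le _ hPU]
        refine le_inf (sup_le_sup_left ?_ _) (sup_le hPU inf_le_right)
        rintro _ ⟨⟨z, hz, rfl⟩, hU⟩
        exact smul_mem_am (h2 z hz hU)
  rw [hg, hf]
  ring

/-- The reduction step: modulo the saturation of a general element, the dimension bound drops
and the normalized limits agree. -/
lemma eventually_step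
    {m : ℕ} {x : Fin m → R} (hx : Ideal.span (Set.range x) = I)
    {𝓤 : Filter (Fin m → R)} (h : IsGenericRow 𝓤) {D : ℕ} (hd : DimLE R M (D + 2)) :
    ∀ᶠ c in 𝓤, DimLE R (M ⧸ satur I (am (lin x c) (⊤ : Submodule R M))) (D + 1) ∧
      ∀ L : ℝ, Tendsto (fun n : ℕ => (D.factorial : ℝ) / (n : ℝ) ^ D *
          (jl (maximalIdeal R) I (M ⧸ satur I (am (lin x c) (⊤ : Submodule R M))) n).toNat)
          atTop (nhds L) →
        Tendsto (fun n : ℕ => ((D + 1).factorial : ℝ) / (n : ℝ) ^ (D + 1) *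
          (jl (maximalIdeal R) I M n).toNat) atTop (nhds L) := by
  let G : GFam I M := ⟨fun n => I ^ (n + 1) • ⊤, fun n => by rw [← mul_smul, ← pow_succ']⟩
  filter_upwards [eventually_dimLE hx h hd, eventually_regular hx h G,
    eventually_regular hx h (satFam (maximalIdeal R) I M), eventually_bound hx h hd]
    with c hdim ⟨n₁, hn₁⟩ ⟨n₂, hn₂⟩ ⟨C, hC⟩
  refine ⟨hdim, fun L hL => ?_⟩
  set a := lin x c
  have ha : a ∈ I := lin_mem_of_eq hx c
  obtain ⟨n₃, hn₃⟩ := exists_satur_inf_eq ha hn₁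
  set e : ℕ → ℕ∞ := fun i => rlen ((addFam (maximalIdeal R) I M a).N i)
    ((addSat (maximalIdeal R) I M a).N i) with he
  have hfin : ∀ i, e i ≠ ⊤ := fun i =>
    ne_top_of_le_ne_top (rlen_satur_ne_top _) (rlen_mono _ inf_le_left)
  refine stolz (g := fun n => ((jl (maximalIdeal R) I (M ⧸ satur I (am a (⊤ : Submodule R M))) n).toNat : ℝ))
    (e := fun n => ((e n).toNat : ℝ)) (C := C) (n₀ := n₁ + n₂ + n₃) (fun n hn => ?_)
    (fun n => ?_) (fun n => ?_) hL
  · have := jl_recursion ha (hn₁ n (by lia)) (hn₂ n (by lia)) (hn₃ n (by lia))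
    have := congrArg ENat.toNat this
    rw [ENat.toNat_add (jl_ne_top _) (hfin _), ENat.toNat_add (jl_ne_top _) (jl_ne_top _)] at this
    exact_mod_cast this
  · positivity
  · have h1 : ∑ i ∈ Finset.range (n + 1), e i = ((∑ i ∈ Finset.range (n + 1), (e i).toNat : ℕ) : ℕ∞) := by
      rw [Nat.cast_sum]
      exact Finset.sum_congr rfl fun i _ => (ENat.natCast_toNat (hfin i)).symm
    have h2 := hC n
    change ∑ i ∈ Finset.range (n + 1), e i ≤ _ at h2
    rw [h1] at h2
    have h3 : ∑ i ∈ Finset.range (n + 1), (e i).toNat ≤ C * (n + 1) ^ D := by exact_mod_cast h2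
    rw [Finset.sum_range_succ'] at h3
    have h4 : ∑ i ∈ Finset.range n, (e (i + 1)).toNat ≤ C * (n + 1) ^ D := by lia
    exact_mod_cast h4

end Step

section Good
set_option linter.unusedSectionVars false
variable {R M : Type*} [CommRing R] [AddCommGroup M] [Module R M]
open IsLocalRing

/-- `a` is regular on `M/K`, is a reduction of `I` on `M/K`, and `M/(K+aM)` is killed by a power
of the maximal ideal. -/
structure Good [IsLocalRing R] (I : Ideal R) (K : Submodule R M) (a : R) : Prop where
  mem : a ∈ I
  reg : ∀ y : M, a • y ∈ K → y ∈ K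
  red : ∃ n, (I ^ (n + 1) • ⊤ : Submodule R M) ≤ am a (I ^ n • ⊤) ⊔ K
  cof : ∃ k, (maximalIdeal R ^ k • ⊤ : Submodule R M) ≤ K ⊔ am a ⊤

lemma am_sup (a : R) (N N' : Submodule R M) : am a (N ⊔ N') = am a N ⊔ am a N' :=
  Submodule.map_sup _ _ _

lemma smul_am (J : Ideal R) (a : R) (N : Submodule R M) : J • am a N = am a (J • N) := by
  rw [am, am, Submodule.map_smul'']

variable [IsLocalRing R] {I : Ideal R} {K : Submodule R M} {a : R}

lemma Good.exists_eq (h : Good I K a) : ∃ n₂, ∀ n ≥ n₂,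
    K ⊔ (I ^ (n + 1) • ⊤ : Submodule R M) = K ⊔ am a (I ^ n • ⊤) := by
  obtain ⟨n₂, hn₂⟩ := h.red
  refine ⟨n₂, fun n hn => le_antisymm (sup_le le_sup_left ?_)
    (sup_le_sup_left (am_pow_le h.mem n) _)⟩
  obtain ⟨i, rfl⟩ := Nat.exists_eq_add_of_le hn
  have h1 := smul_mono_right (I ^ i) hn₂
  rw [Submodule.smul_sup, smul_am, ← mul_smul, ← mul_smul, ← pow_add,
    ← pow_add] at h1
  rw [show n₂ + i + 1 = i + (n₂ + 1) by lia, add_comm n₂ i, sup_comm]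
  exact h1.trans (sup_le_sup_left Submodule.smul_le_right _)

lemma Good.rlen_succ (h : Good I K a) : ∃ n₂, ∀ n ≥ n₂,
    rlen (K ⊔ (I ^ (n + 1) • ⊤ : Submodule R M)) ⊤ =
      rlen (K ⊔ (I ^ n • ⊤ : Submodule R M)) ⊤ + rlen (K ⊔ am a ⊤) ⊤ := by
  obtain ⟨n₂, hn₂⟩ := h.exists_eq
  refine ⟨n₂, fun n hn => ?_⟩
  rw [hn₂ n hn, rlen_add (sup_le_sup_left (am_mono a le_top) K :
    K ⊔ am a (I ^ n • ⊤) ≤ K ⊔ am a ⊤) le_top]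
  congr 1
  have e : K ⊔ am a ⊤ = (K ⊔ am a (I ^ n • ⊤)) ⊔ am a ⊤ := by
    rw [sup_assoc, sup_eq_right.2 (am_mono a le_top : am a (I ^ n • ⊤ : Submodule R M) ≤ _)]
  rw [e, rlen_sup]
  nth_rw 2 [am]
  rw [rlen_map]
  congr 1
  ext y
  constructor
  · intro hy
    obtain ⟨k, hk, _, ⟨z, hz, rfl⟩, hkz⟩ := Submodule.mem_sup.1 hy
    have h1 : a • (y - z) ∈ K := by
      have : a • y = k + a • z := hkz.symm
      rw [smul_sub, this, add_sub_cancel_right]; exact hk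
    rw [← sub_add_cancel y z]
    exact Submodule.add_mem_sup (h.reg _ h1) hz
  · intro hy
    obtain ⟨k, hk, z, hz, rfl⟩ := Submodule.mem_sup.1 hy
    change a • (k + z) ∈ K ⊔ am a (I ^ n • ⊤)
    rw [smul_add]
    exact Submodule.add_mem_sup (K.smul_mem a hk) (smul_mem_am hz)

lemma Good.exists_pow_le (h : Good I K a) (n : ℕ) :
    ∃ k, (maximalIdeal R ^ k • ⊤ : Submodule R M) ≤ K ⊔ I ^ n • ⊤ := by
  obtain ⟨k, hk⟩ := h.cof
  refine ⟨k * n, ?_⟩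
  induction n with
  | zero => simp
  | succ n ih =>
    rw [mul_add, mul_one, pow_add, mul_smul]
    refine (smul_mono_right _ hk).trans ?_
    rw [Submodule.smul_sup, smul_am]
    refine sup_le (Submodule.smul_le_right.trans le_sup_left) ((am_mono a ih).trans ?_)
    rw [am_sup]
    exact sup_le_sup (am_le _ _) (am_pow_le h.mem n)

variable [IsNoetherianRing R] [Module.Finite R M]

lemma Good.rlen_ne_top (h : Good I K a) (n : ℕ) : rlen (K ⊔ (I ^ n • ⊤ : Submodule R M)) ⊤ ≠ ⊤ := by
  obtain ⟨k, hk⟩ := h.exists_pow_le n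
  exact JMul.rlen_ne_top hk

lemma Good.length_ne_top (h : Good I K a) : rlen (K ⊔ am a ⊤) ⊤ ≠ ⊤ := by
  obtain ⟨k, hk⟩ := h.cof
  exact JMul.rlen_ne_top hk

lemma Good.rlen_piece (h : Good I K a) : ∃ n₂, ∀ n ≥ n₂,
    rlen (K ⊔ (I ^ (n + 1) • ⊤ : Submodule R M)) (I ^ n • ⊤ : Submodule R M) =
      rlen (K ⊔ am a ⊤) ⊤ := by
  obtain ⟨n₂, hn₂⟩ := h.rlen_succ
  refine ⟨n₂, fun n hn => ?_⟩
  have h1 := hn₂ n hn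
  have hle : (I ^ (n + 1) • ⊤ : Submodule R M) ≤ I ^ n • ⊤ := pow_smul_top_anti I (by lia)
  rw [rlen_add (sup_le_sup_left hle K) le_top, add_comm] at h1
  replace h1 := ENat.add_right_injective_of_ne_top (h.rlen_ne_top n) h1
  rw [← h1, show K ⊔ (I ^ n • ⊤ : Submodule R M) = (K ⊔ I ^ (n + 1) • ⊤) ⊔ I ^ n • ⊤ by
    rw [sup_assoc, sup_eq_right.2 hle], rlen_sup]

lemma tendsto_of_recursion {f : ℕ → ℕ} {l n₂ : ℕ} (h : ∀ n ≥ n₂, f (n + 1) = f n + l) :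
    Tendsto (fun n : ℕ => (Nat.factorial 1 : ℝ) / (n : ℝ) ^ 1 * (f n : ℝ)) atTop (nhds (l : ℝ)) := by
  have h1 : ∀ n ≥ n₂, (f n : ℝ) = f n₂ + (n - n₂) * l := by
    intro n hn
    induction n, hn using Nat.le_induction with
    | base => simp
    | succ n hn ih => rw [h n hn]; push_cast; rw [ih]; ring
  have h2 : Tendsto (fun n : ℕ => ((f n₂ : ℝ) - n₂ * l) / (n : ℝ) + l) atTop (nhds (0 + l)) :=
    (tendsto_const_div_atTop_nhds_zero_nat _).add_const _
  rw [zero_add] at h2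
  refine h2.congr' ?_
  filter_upwards [eventually_ge_atTop (n₂ + 1)] with n hn
  rw [h1 n (by lia)]
  have : (n : ℝ) ≠ 0 := Nat.cast_ne_zero.2 (by lia)
  simp only [Nat.factorial_one, Nat.cast_one, pow_one]
  field_simp
  ring

lemma length_quot_pow (I : Ideal R) (K : Submodule R M) (n : ℕ) :
    mLength R ((M ⧸ K) ⧸ (I ^ n • ⊤ : Submodule R (M ⧸ K))) =
      rlen (K ⊔ (I ^ n • ⊤ : Submodule R M)) ⊤ := by
  have h : (I ^ n • ⊤ : Submodule R (M ⧸ K)) = (I ^ n • ⊤ : Submodule R M).map K.mkQ := by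
    rw [Submodule.map_smul'', Submodule.map_top, Submodule.range_mkQ]
  rw [mLength_eq, ← rlen_top, h]
  have h2 : (⊤ : Submodule R (M ⧸ K)) = (⊤ : Submodule R M).map K.mkQ := by
    rw [Submodule.map_top, Submodule.range_mkQ]
  rw [h2, rlen_map, Submodule.comap_map_mkQ]

lemma Good.hsMult_eq (h : Good I K a) :
    hsMult I (M ⧸ K) 1 = ((rlen (K ⊔ am a (⊤ : Submodule R M)) ⊤).toNat : ℝ) := by
  obtain ⟨n₂, hn₂⟩ := h.rlen_succ
  unfold hsMult
  refine Tendsto.limUnder_eq ?_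
  simp_rw [length_quot_pow]
  refine tendsto_of_recursion (n₂ := n₂) fun n hn => ?_
  rw [hn₂ n hn, ENat.toNat_add (h.rlen_ne_top n) h.length_ne_top]

end Good

section Base
set_option linter.unusedSectionVars false
variable {R M : Type*} [CommRing R] [AddCommGroup M] [Module R M]
  [IsNoetherianRing R] [IsLocalRing R] [Module.Finite R M] {I : Ideal R}
open IsLocalRing

/-- The family `𝔪IⁿM + aIⁿ⁻¹M`. -/
def fibFam (I : Ideal R) (M : Type*) [AddCommGroup M] [Module R M] (a : R) : GFam I M where
  N
  | 0 => maximalIdeal R • I ^ 0 • ⊤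
  | n + 1 => maximalIdeal R • I ^ (n + 1) • ⊤ ⊔ am a (I ^ n • ⊤)
  smul_le i := by
    have h : ∀ n, I • maximalIdeal R • (I ^ n • ⊤ : Submodule R M) =
        maximalIdeal R • I ^ (n + 1) • ⊤ := fun n => by
      rw [← mul_smul, ← mul_smul, ← mul_smul, pow_succ]
      congr 1
      ring
    rcases i with _ | i
    · rw [h]; exact le_sup_left
    · rw [Submodule.smul_sup, h, smul_am, ← mul_smul I, ← pow_succ']

lemma smul_le_fibFam (a : R) (n : ℕ) :
    maximalIdeal R • (I ^ n • ⊤ : Submodule R M) ≤ (fibFam I M a).N n :=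
  match n with
  | 0 => le_rfl
  | _ + 1 => le_sup_left

lemma coheight_irr (P : PrimeSpectrum (Rees I)) (h : Rees.irr I ≤ P.asIdeal) :
    Order.coheight P = 0 := by
  refine Order.coheight_eq_zero.2 fun T hT => ?_
  have e : Rees.irr I = T.asIdeal :=
    (inferInstance : (Rees.irr I).IsMaximal).eq_of_le T.2.ne_top (h.trans hT)
  exact (e ▸ h : T.asIdeal ≤ P.asIdeal)

/-- A general element of `I` is a reduction when the dimension is at most one. -/
lemma eventually_reduction (hI : I ≤ maximalIdeal R) {m : ℕ} {x : Fin m → R}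
    (hx : Ideal.span (Set.range x) = I)
    {𝓤 : Filter (Fin m → R)} (h : IsGenericRow 𝓤) (hd : DimLE R M 1) :
    ∀ᶠ c in 𝓤, ∃ n, (I ^ (n + 1) • ⊤ : Submodule R M) ≤ am (lin x c) (I ^ n • ⊤) := by
  set J := (maximalIdeal R).map (algebraMap R (Rees I))
  have hfin := Ideal.finite_minimalPrimes_of_isNoetherianRing (Rees I)
    (Module.annihilator (Rees I) (powFam I M).sub ⊔ J)
  filter_upwards [eventually_forall_lin_notMem h (xt hx) hfin] with c hc
  rw [lin_xt] at hc
  set a := lin x c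
  have ha : a ∈ I := lin_mem_of_eq hx c
  set V := fibFam I M a with hV
  have hfin' : Module.Finite (Rees I) (GQuot (powFam I M) V) := finite_gquot fun n => le_rfl
  have hJ : J ≤ Module.annihilator (Rees I) (GQuot (powFam I M) V) := by
    rw [Ideal.map_le_iff_le_comap]
    intro r hr
    refine mem_annihilator_gquot.2 fun f hf i => ?_
    rw [algebraMap_smul, map_smul]
    exact smul_le_fibFam a i (Submodule.smul_mem_smul hr (hf i))
  have haV : rt ⟨a, ha⟩ ∈ Module.annihilator (Rees I) (GQuot (powFam I M) V) := by
    refine mem_annihilator_gquot.2 fun f hf i => ?_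
    rcases i with _ | i
    · rw [cf_rt_smul_zero]; exact Submodule.zero_mem _
    · rw [cf_rt_smul_succ]
      exact Submodule.mem_sup_right (smul_mem_am (hf i))
  obtain ⟨N, hN⟩ := exists_pow_le_of_isolated (S := Rees I) (𝔫 := Rees.irr I)
    (E := GQuot (powFam I M) V) (fun P hP hPn => by
    have hann : Module.annihilator (Rees I) (powFam I M).sub ≤ P.asIdeal :=
      (LinearMap.annihilator_le_of_surjective _ (Submodule.mkQ_surjective _)).trans hP
    obtain ⟨Q, hQ, hQP⟩ := Ideal.exists_minimalPrimes_le (sup_le hann (hJ.trans hP))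
    by_cases haQ : rt ⟨a, ha⟩ ∈ Q
    · rw [coheight_irr P (Rees.irr_le hx (hJ.trans hP) ((hc Q hQ haQ).trans hQP))]
      exact bot_le
    · have h1 : Order.coheight (⟨Q, hQ.1.1⟩ : PrimeSpectrum (Rees I)) ≤ (0 + 1 : ℕ) :=
        coheight_rees_le hd (le_sup_left.trans hQ.1.2)
          ((Ideal.map_mono hI).trans (le_sup_right.trans hQ.1.2))
      refine coheight_le_of_lt (P := ⟨Q, hQ.1.1⟩) (Q := P) (lt_of_le_of_ne hQP fun e => haQ ?_)
        le_rfl h1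
      have := hP haV
      rwa [← e] at this)
  refine ⟨N, ?_⟩
  refine Submodule.le_of_le_smul_of_le_jacobson_bot (I := maximalIdeal R) (IsNoetherian.noetherian _)
    (IsLocalRing.maximalIdeal_le_jacobson _) fun y hy => ?_
  obtain ⟨e, he, he'⟩ := sg_mem_pow hx (N + 1) y hy
  set π := (V.sub.comap (powFam I M).sub.subtype).mkQ
  have hX : Ideal.span (Set.range (xt hx)) ≤ Rees.irr I := by
    rw [Ideal.span_le]
    rintro _ ⟨l, rfl⟩
    rw [SetLike.mem_coe, Rees.mem_irr]
    change (Polynomial.monomial 1 (x l)).coeff 0 ∈ _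
    rw [Polynomial.coeff_monomial, if_neg (by lia)]
    exact Ideal.zero_mem _
  have h1 : π e ∈ (Rees.irr I ^ N • ⊤ : Submodule (Rees I) (GQuot (powFam I M) V)) := by
    have h2 : (Ideal.span (Set.range (xt hx)) ^ (N + 1) • ⊤ : Submodule (Rees I) (powFam I M).sub) ≤
        (Rees.irr I ^ N • ⊤) :=
      Submodule.smul_mono_left ((Ideal.pow_le_pow_right (Nat.le_succ N)).trans
        (Ideal.pow_right_mono hX N))
    have h3 := Submodule.mem_map_of_mem (f := π) (h2 he')
    rw [Submodule.map_smul''] at h3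
    rwa [Submodule.map_top, LinearMap.range_eq_top.2 (Submodule.mkQ_surjective _)] at h3
  have h2 := mem_of_mem_irr_pow (k := 1) (by rw [pow_one]; exact hJ) (N + 1) e
    (hN (N + 1 + 1 + 1) h1) (N + 1) le_rfl
  rw [he, RMod.cf_sg_self] at h2
  rw [sup_comm]
  exact h2

lemma eventually_reg {m : ℕ} {x : Fin m → R}
    (hx : Ideal.span (Set.range x) = I) {𝓤 : Filter (Fin m → R)} (h : IsGenericRow 𝓤)
    (K : Submodule R M) (hK : satur I K = K) :
    ∀ᶠ c in 𝓤, ∀ P ∈ associatedPrimes R (M ⧸ K), lin x c ∉ P := by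
  filter_upwards [eventually_forall_lin_notMem h x (associatedPrimes.finite R (M ⧸ K))] with c hc P hP hcP
  refine not_le_of_associated I (fun y hy => ?_) hP (hx ▸ hc P hP hcP)
  obtain ⟨y, rfl⟩ := K.mkQ_surjective y
  refine (Submodule.Quotient.mk_eq_zero _).2 ?_
  rw [← hK]
  refine mem_satur.2 ⟨1, fun r hr => ?_⟩
  rw [pow_one] at hr
  have := hy r hr
  rw [← map_smul] at this
  exact (Submodule.Quotient.mk_eq_zero _).1 this

lemma reg_of_notMem {K : Submodule R M} {a : R} (h : ∀ P ∈ associatedPrimes R (M ⧸ K), a ∉ P)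
    (y : M) (hy : a • y ∈ K) : y ∈ K := by
  by_contra hyK
  have h0 : K.mkQ y ≠ 0 := fun e => hyK ((Submodule.Quotient.mk_eq_zero _).1 e)
  obtain ⟨P, hP, hle⟩ := exists_le_isAssociatedPrime_of_isNoetherianRing R (K.mkQ y) h0
  refine h P hP (hle ?_)
  rw [Submodule.mem_colon_singleton, Submodule.mem_bot, ← map_smul]
  exact (Submodule.Quotient.mk_eq_zero _).2 hy

lemma cof_of_notMem {K : Submodule R M} {a : R} (h : ∀ P ∈ associatedPrimes R (M ⧸ K), a ∉ P)
    (hd : DimLE R M 1) : ∃ k, (maximalIdeal R ^ k • ⊤ : Submodule R M) ≤ K ⊔ am a ⊤ := by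
  set A := K ⊔ am a ⊤
  obtain ⟨k, hk⟩ := exists_pow_le_annihilator (E := M ⧸ A) (maximalIdeal R) fun P hP => by
    have hPp : P.IsPrime := (AssociatedPrimes.mem_iff.1 hP).1
    have hannP : Module.annihilator R (M ⧸ A) ≤ P :=
      Submodule.annihilator_top (R := R) (M := M ⧸ A) ▸
        IsAssociatedPrime.annihilator_le (AssociatedPrimes.mem_iff.1 hP)
    have hann : Module.annihilator R (M ⧸ K) ≤ P := by
      refine le_trans (fun r hr => ?_) hannP
      rw [Module.mem_annihilator] at hr ⊢
      intro y
      obtain ⟨y, rfl⟩ := A.mkQ_surjective y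
      have := hr (K.mkQ y)
      rw [← map_smul] at this ⊢
      have h2 := (Submodule.Quotient.mk_eq_zero _).1 this
      exact (Submodule.Quotient.mk_eq_zero _).2 ((le_sup_left : K ≤ A) h2)
    obtain ⟨Q, hQ, hQP⟩ := Ideal.exists_minimalPrimes_le hann
    have hass := Module.associatedPrimes.minimalPrimes_annihilator_subset_associatedPrimes R _ hQ
    have haP : a ∈ P := by
      refine hannP (Module.mem_annihilator.2 fun y => ?_)
      obtain ⟨y, rfl⟩ := A.mkQ_surjective y
      rw [← map_smul]
      exact (Submodule.Quotient.mk_eq_zero _).2 (Submodule.mem_sup_right (smul_mem_am trivial))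
    have h1 : Order.coheight (⟨Q, hQ.1.1⟩ : PrimeSpectrum R) ≤ (0 + 1 : ℕ) :=
      hd _ ((LinearMap.annihilator_le_of_surjective K.mkQ K.mkQ_surjective).trans hQ.1.2)
    have h2 : Order.coheight (⟨P, hPp⟩ : PrimeSpectrum R) ≤ (0 : ℕ) :=
      coheight_le_of_lt (P := ⟨Q, hQ.1.1⟩) (lt_of_le_of_ne hQP fun e => h Q hass
        (by
          have e' : Q = P := congrArg PrimeSpectrum.asIdeal e
          rw [e']; exact haP)) le_rfl h1
    have h3 : Order.coheight (⟨P, hPp⟩ : PrimeSpectrum R) = 0 := le_antisymm (by exact_mod_cast h2) bot_le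
    have h4 := Order.coheight_eq_zero.1 h3
      (show (⟨P, hPp⟩ : PrimeSpectrum R) ≤ ⟨maximalIdeal R, inferInstance⟩ from
        IsLocalRing.le_maximalIdeal hPp.ne_top)
    exact h4
  refine ⟨k, Submodule.smul_le.2 fun r hr y _ => ?_⟩
  have := Module.mem_annihilator.1 (hk hr) (A.mkQ y)
  rw [← map_smul] at this
  exact (Submodule.Quotient.mk_eq_zero _).1 this

lemma eventually_good (hI : I ≤ maximalIdeal R) {m : ℕ} {x : Fin m → R}
    (hx : Ideal.span (Set.range x) = I)
    {𝓤 : Filter (Fin m → R)} (h : IsGenericRow 𝓤) (hd : DimLE R M 1) :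
    ∀ᶠ c in 𝓤, Good I (satur I (⊥ : Submodule R M)) (lin x c) := by
  filter_upwards [eventually_reduction hI hx h hd,
    eventually_reg hx h (satur I (⊥ : Submodule R M)) (satur_satur _ _)] with c ⟨n, hn⟩ hc
  exact ⟨lin_mem_of_eq hx c, reg_of_notMem hc, ⟨n, hn.trans le_sup_left⟩, cof_of_notMem hc hd⟩

lemma Good.jl_eq {a : R} (h : Good I (satur I (⊥ : Submodule R M)) a) :
    ∃ n₂, ∀ n ≥ n₂, jl (maximalIdeal R) I M n =
      rlen (satur I (⊥ : Submodule R M) ⊔ am a ⊤) ⊤ := by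
  obtain ⟨n₁, hn₁⟩ := h.rlen_piece
  set K := satur I (⊥ : Submodule R M)
  obtain ⟨k, hk⟩ := Ideal.exists_pow_inf_eq_pow_smul I K
  obtain ⟨k', hk'⟩ := exists_pow_smul_satur_le I (⊥ : Submodule R M)
  refine ⟨n₁ + k + k', fun n hn => ?_⟩
  have h0 : (I ^ n • ⊤ : Submodule R M) ⊓ K = ⊥ := by
    rw [hk n (by lia), show n - k = (n - k - k') + k' by lia, pow_add, mul_smul, eq_bot_iff]
    refine (smul_mono_right _ ((smul_mono_right _ inf_le_right).trans hk')).trans ?_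
    rw [Submodule.smul_bot]
  have hle : (I ^ (n + 1) • ⊤ : Submodule R M) ≤ I ^ n • ⊤ := pow_smul_top_anti I (by lia)
  have h1 : (K ⊔ (I ^ (n + 1) • ⊤ : Submodule R M)) ⊓ (I ^ n • ⊤) = I ^ (n + 1) • ⊤ := by
    rw [sup_comm, sup_inf_assoc_of_le _ hle, inf_comm, h0, sup_bot_eq]
  have h2 : (satFam (maximalIdeal R) I M).N n = I ^ n • ⊤ := by
    refine le_antisymm (satFam_le _ _ _) (le_inf (fun y hy => ?_) le_rfl)
    obtain ⟨j, hj⟩ := h.exists_pow_le (n + 1)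
    refine mem_satur.2 ⟨j, fun r hr => ?_⟩
    rw [← h1]
    exact ⟨hj (Submodule.smul_mem_smul hr trivial), Submodule.smul_mem _ _ hy⟩
  rw [jl, h2, ← hn₁ n (by lia)]
  refine rlen_congr ?_
  rw [h1, inf_eq_left.2 hle]

end Base

section Formula
set_option linter.unusedSectionVars false
variable {R M : Type*} [CommRing R] [AddCommGroup M] [Module R M] {I : Ideal R}
open IsLocalRing

lemma map_am {N : Type*} [AddCommGroup N] [Module R N] (f : M →ₗ[R] N) (a : R) (B : Submodule R M) :
    (am a B).map f = am a (B.map f) := by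
  rw [am_eq, am_eq, Submodule.map_smul'']

lemma map_mkQ_top (L : Submodule R M) : (⊤ : Submodule R M).map L.mkQ = ⊤ := by
  rw [Submodule.map_top, Submodule.range_mkQ]

lemma map_mkQ_pow (L : Submodule R M) (J : Ideal R) :
    (J • ⊤ : Submodule R M).map L.mkQ = J • ⊤ := by
  rw [Submodule.map_smul'', map_mkQ_top]

lemma le_of_map_mkQ_le {L X Y : Submodule R M} (hL : L ≤ X) (h : Y.map L.mkQ ≤ X.map L.mkQ) :
    Y ≤ X := by
  rw [Submodule.map_le_iff_le_comap, Submodule.comap_map_mkQ, sup_eq_right.2 hL] at h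
  exact h

lemma le_comap_mkQ (L : Submodule R M) (K : Submodule R (M ⧸ L)) : L ≤ K.comap L.mkQ := by
  intro y hy
  rw [Submodule.mem_comap, Submodule.mkQ_apply, (Submodule.Quotient.mk_eq_zero _).2 hy]
  exact K.zero_mem

lemma comap_mkQ_sup_am (L : Submodule R M) (K : Submodule R (M ⧸ L)) (a : R) :
    K.comap L.mkQ ⊔ am a ⊤ = (K ⊔ am a ⊤).comap L.mkQ := by
  refine le_antisymm (sup_le (Submodule.comap_mono le_sup_left) ?_)
    (le_of_map_mkQ_le ((le_comap_mkQ L K).trans le_sup_left) ?_)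
  · rw [← Submodule.map_le_iff_le_comap, map_am, map_mkQ_top]
    exact le_sup_right
  · rw [Submodule.map_sup, map_am, map_mkQ_top,
      Submodule.map_comap_eq_of_surjective (Submodule.mkQ_surjective L),
      Submodule.map_comap_eq_of_surjective (Submodule.mkQ_surjective L)]

lemma rlen_comap_mkQ (L : Submodule R M) (A : Submodule R (M ⧸ L)) :
    rlen (A.comap L.mkQ) ⊤ = rlen A ⊤ := by
  rw [← rlen_map, map_mkQ_top]

lemma Good.comap_mkQ [IsLocalRing R] {L : Submodule R M} {K : Submodule R (M ⧸ L)} {a : R}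
    (h : Good I K a) : Good I (K.comap L.mkQ) a where
  mem := h.mem
  reg y hy := h.reg _ (by rw [← map_smul]; exact hy)
  red := by
    obtain ⟨n, hn⟩ := h.red
    refine ⟨n, le_of_map_mkQ_le ((le_comap_mkQ L K).trans le_sup_right) ?_⟩
    rw [map_mkQ_pow, Submodule.map_sup, map_am, map_mkQ_pow,
      Submodule.map_comap_eq_of_surjective (Submodule.mkQ_surjective L)]
    exact hn
  cof := by
    obtain ⟨k, hk⟩ := h.cof
    refine ⟨k, ?_⟩
    rw [comap_mkQ_sup_am, ← Submodule.map_le_iff_le_comap, map_mkQ_pow]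
    exact hk

variable [IsNoetherianRing R] [Module.Finite R M]

lemma satur_satur_sup (I : Ideal R) (A B : Submodule R M) :
    satur I (satur I A ⊔ B) = satur I (A ⊔ B) := by
  refine le_antisymm ?_ (satur_mono _ (sup_le_sup_right (le_satur _ _) _))
  rw [← satur_satur I (A ⊔ B)]
  exact satur_mono _ (sup_le (satur_mono _ le_sup_left) (le_sup_right.trans (le_satur _ _)))

lemma comap_satur_quotient (a : R) (J : Ideal R) :
    (satur I (J • ⊤ : Submodule R (M ⧸ satur I (am a (⊤ : Submodule R M))))).comap (Submodule.mkQ _) =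
      satur I ((Ideal.span {a} ⊔ J) • ⊤ : Submodule R M) := by
  rw [comap_satur, ← map_mkQ_pow, Submodule.comap_map_mkQ, satur_satur_sup, am_eq, Submodule.sup_smul]

/-- The length formula for parameters that are generic with respect to arbitrary generic filters. -/
theorem eventually_formula [IsLocalRing R] (hI : I ≤ maximalIdeal R) {m : ℕ} {x : Fin m → R}
    (hx : Ideal.span (Set.range x) = I) (D : ℕ) : ∀ (M : Type*) [AddCommGroup M] [Module R M]
    [Module.Finite R M] (𝓤 : Fin (D + 1) → Filter (Fin m → R)), (∀ i, IsGenericRow (𝓤 i)) →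
    DimLE R M (D + 1) → ∀ᶠ c in seqFilter (D + 1) 𝓤, ∃ K : Submodule R M, 
      K = satur I (Ideal.span (Set.range fun j : Fin D => lin x (c j.castSucc)) • ⊤) ∧
      Good I K (lin x (c (Fin.last D))) ∧
      Tendsto (fun n : ℕ => (D.factorial : ℝ) / (n : ℝ) ^ D * (jl (maximalIdeal R) I M n).toNat)
        atTop (nhds ((rlen (K ⊔ am (lin x (c (Fin.last D))) ⊤) ⊤).toNat : ℝ)) := by
  induction D with
  | zero =>
    intro M _ _ _ 𝓤 h hd
    rw [eventually_seqFilter_succ]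
    filter_upwards [eventually_good hI hx (h 0) hd] with c hc
    rw [eventually_seqFilter_zero]
    refine ⟨satur I ⊥, ?_, hc, ?_⟩
    · rw [Set.range_eq_empty, Ideal.span_empty, Submodule.bot_smul]
    · obtain ⟨n₂, hn₂⟩ := hc.jl_eq
      refine tendsto_const_nhds.congr' ?_
      filter_upwards [eventually_ge_atTop n₂] with n hn
      rw [hn₂ n hn]
      simp
  | succ D ih =>
    intro M _ _ _ 𝓤 h hd
    rw [eventually_seqFilter_succ]
    filter_upwards [eventually_step hx (h 0) hd] with e ⟨hdim, hlim⟩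
    filter_upwards [ih (M ⧸ satur I (am (lin x e) (⊤ : Submodule R M))) _ (fun i => h i.succ) hdim]
      with c ⟨K, hK, hg, ht⟩
    refine ⟨K.comap (Submodule.mkQ _), ?_, ?_, ?_⟩
    · rw [hK, comap_satur_quotient, ← Ideal.span_union]
      congr 3
      ext r
      simp only [Set.singleton_union, Set.mem_insert_iff, Set.mem_range]
      rw [Fin.exists_fin_succ]
      simp only [Fin.castSucc_zero, Fin.cons_zero, ← Fin.succ_castSucc, Fin.cons_succ, eq_comm]
    · rw [← Fin.succ_last, Fin.cons_succ]
      exact hg.comap_mkQ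
    · rw [← Fin.succ_last, Fin.cons_succ, comap_mkQ_sup_am, rlen_comap_mkQ]
      exact hlim _ ht

end Formula

section Spread
open IsLocalRing TensorProduct
variable {R M κ : Type*} [CommRing R] [AddCommGroup M] [Module R M]

instance eval_surjective (e : κ → R) : RingHomSurjective (MvPolynomial.eval e) :=
  ⟨fun r => ⟨MvPolynomial.C r, MvPolynomial.eval_C r⟩⟩

/-- Specialization of `M[Z]` at a point. -/
def spec (M : Type*) [AddCommGroup M] [Module R M] (e : κ → R) :
    MvPolynomial κ R ⊗[R] M →ₛₗ[MvPolynomial.eval e] M where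
  toFun := TensorProduct.lift ((LinearMap.lsmul R M).comp (MvPolynomial.aeval e).toLinearMap)
  map_add' := map_add _
  map_smul' g z := by
    induction z with
    | zero => simp
    | tmul f y =>
      rw [TensorProduct.smul_tmul', TensorProduct.lift.tmul, TensorProduct.lift.tmul]
      simp [MvPolynomial.aeval_eq_eval, mul_smul]
    | add z w hz hw => rw [smul_add, map_add, hz, hw, map_add, smul_add]

lemma spec_tmul (e : κ → R) (f : MvPolynomial κ R) (y : M) :
    spec M e (f ⊗ₜ y) = MvPolynomial.eval e f • y := by
  change TensorProduct.lift _ _ = _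
  rw [TensorProduct.lift.tmul]
  simp [MvPolynomial.aeval_eq_eval]

lemma spec_surjective (e : κ → R) : Function.Surjective (spec M e) := fun y =>
  ⟨1 ⊗ₜ y, by rw [spec_tmul, map_one, one_smul]⟩

lemma sub_C_eval_mem (e : κ → R) (f : MvPolynomial κ R) :
    f - MvPolynomial.C (MvPolynomial.eval e f) ∈ RingHom.ker (MvPolynomial.eval e) := by
  rw [RingHom.mem_ker, map_sub, MvPolynomial.eval_C, sub_self]

lemma ker_spec (e : κ → R) : LinearMap.ker (spec M e) =
    RingHom.ker (MvPolynomial.eval e) • ⊤ := by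
  refine le_antisymm (fun z hz => ?_) (Submodule.smul_le.2 fun r hr y _ => ?_)
  · have h : ∀ z : MvPolynomial κ R ⊗[R] M, z - 1 ⊗ₜ spec M e z ∈
        (RingHom.ker (MvPolynomial.eval e) • ⊤ :
          Submodule (MvPolynomial κ R) (MvPolynomial κ R ⊗[R] M)) := by
      intro z
      induction z with
      | zero => simp
      | tmul f y =>
        have : f ⊗ₜ[R] y - 1 ⊗ₜ spec M e (f ⊗ₜ y) =
            (f - MvPolynomial.C (MvPolynomial.eval e f)) • ((1 : MvPolynomial κ R) ⊗ₜ[R] y) := by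
          rw [spec_tmul, TensorProduct.smul_tmul', smul_eq_mul, mul_one, TensorProduct.sub_tmul,
            ← TensorProduct.smul_tmul, MvPolynomial.smul_eq_C_mul, mul_one]
        rw [this]
        exact Submodule.smul_mem_smul (sub_C_eval_mem e f) trivial
      | add z w hz hw =>
        rw [map_add, TensorProduct.tmul_add, add_sub_add_comm]
        exact Submodule.add_mem _ hz hw
    have := h z
    rwa [LinearMap.mem_ker.1 hz, TensorProduct.tmul_zero, sub_zero] at this
  · rw [LinearMap.mem_ker, map_smulₛₗ, RingHom.mem_ker.1 hr, zero_smul]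

variable [IsLocalRing R]

/-- The extension of the maximal ideal to the polynomial ring. -/
def pol (R κ : Type*) [CommRing R] [IsLocalRing R] : Ideal (MvPolynomial κ R) :=
  RingHom.ker (MvPolynomial.map (σ := κ) (residue R))

instance : (pol R κ).IsPrime := RingHom.ker_isPrime _

lemma pol_eq : pol R κ = (maximalIdeal R).map MvPolynomial.C := by
  rw [pol, MvPolynomial.ker_map, ker_residue]

lemma eval_mem_of_mem_pol (e : κ → R) {f : MvPolynomial κ R} (hf : f ∈ pol R κ) :
    MvPolynomial.eval e f ∈ maximalIdeal R := by
  rw [pol_eq] at hf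
  have := Ideal.mem_map_of_mem (MvPolynomial.eval e) hf
  rw [Ideal.map_map, show (MvPolynomial.eval e).comp MvPolynomial.C = RingHom.id R from
    RingHom.ext fun r => MvPolynomial.eval_C r, Ideal.map_id] at this
  exact this

lemma sub_C_eval_mem_mul (e : κ → R) {f : MvPolynomial κ R} (hf : f ∈ pol R κ) :
    f - MvPolynomial.C (MvPolynomial.eval e f) ∈ RingHom.ker (MvPolynomial.eval e) * pol R κ := by
  rw [pol_eq] at hf ⊢
  refine Submodule.span_induction ?_ ?_ ?_ ?_ hf
  · rintro _ ⟨r, hr, rfl⟩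
    rw [MvPolynomial.eval_C, sub_self]
    exact Ideal.zero_mem _
  · rw [map_zero, map_zero, sub_zero]
    exact Ideal.zero_mem _
  · intro a b _ _ ha hb
    rw [map_add, map_add, add_sub_add_comm]
    exact Ideal.add_mem _ ha hb
  · intro g a ha' ha
    have h2 : MvPolynomial.C (MvPolynomial.eval e a) ∈ (maximalIdeal R).map (MvPolynomial.C (σ := κ)) :=
      Ideal.mem_map_of_mem _ (eval_mem_of_mem_pol e (by rw [pol_eq]; exact ha'))
    have h1 := Ideal.mul_mem_mul (sub_C_eval_mem e g) h2
    rw [smul_eq_mul, map_mul, map_mul, show g * a - MvPolynomial.C (MvPolynomial.eval e g) *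
      MvPolynomial.C (MvPolynomial.eval e a) = g * (a - MvPolynomial.C (MvPolynomial.eval e a)) +
      (g - MvPolynomial.C (MvPolynomial.eval e g)) * MvPolynomial.C (MvPolynomial.eval e a) by ring]
    exact Ideal.add_mem _ (Ideal.mul_mem_left _ _ ha) h1

lemma exists_one_sub_mul_mem (e : κ → R) {t : MvPolynomial κ R}
    (ht : MvPolynomial.eval e t ∉ maximalIdeal R) :
    ∃ g, 1 - g * t ∈ RingHom.ker (MvPolynomial.eval e) := by
  obtain ⟨b, hb⟩ := IsUnit.exists_left_inv (not_not.1 fun h => ht ((mem_maximalIdeal _).2 h))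
  refine ⟨MvPolynomial.C b, ?_⟩
  rw [RingHom.mem_ker, map_sub, map_mul, MvPolynomial.eval_C, hb, map_one, sub_self]

lemma mem_smul_sup_span {A E : Type*} [CommRing A] [AddCommGroup E] [Module A E] {𝔞 : Ideal A}
    {X : Submodule A E} {y z : E} (hz : z ∈ 𝔞 • (X ⊔ Submodule.span A {y})) :
    ∃ f ∈ 𝔞, z - f • y ∈ 𝔞 • X := by
  rw [Submodule.smul_sup] at hz
  obtain ⟨z₀, hz₀, w, hw, rfl⟩ := Submodule.mem_sup.1 hz
  obtain ⟨f, hf, rfl⟩ := Submodule.mem_ideal_smul_span_iff_exists_sum 𝔞 (fun _ : Unit => y) w |>.1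
    (by simpa using hw)
  refine ⟨f ⟨⟩, hf _, ?_⟩
  simpa [Finsupp.sum_fintype] using hz₀

end Spread

section SpreadLength
open IsLocalRing TensorProduct

lemma rlen_sup_span_singleton {R M : Type*} [CommRing R] [IsLocalRing R] [AddCommGroup M]
    [Module R M] {X : Submodule R M} {y : M} (hy : y ∉ X)
    (hm : ∀ r ∈ maximalIdeal R, r • y ∈ X) : rlen X (X ⊔ Submodule.span R {y}) = 1 := by
  rw [rlen, Module.length_eq_one_iff, isSimpleModule_iff_isAtom, Submodule.map_sup,
    Submodule.mkQ_map_self, bot_sup_eq, Submodule.map_span, Set.image_singleton]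
  refine ⟨fun h => hy ?_, fun N hN => ?_⟩
  · rw [Submodule.span_singleton_eq_bot] at h
    exact (Submodule.Quotient.mk_eq_zero _).1 h
  · by_contra hne
    obtain ⟨w, hw, hw0⟩ := Submodule.exists_mem_ne_zero_of_ne_bot hne
    obtain ⟨r, rfl⟩ := Submodule.mem_span_singleton.1 (hN.le hw)
    have hr : IsUnit r := by
      by_contra h
      refine hw0 ?_
      rw [← map_smul]
      exact (Submodule.Quotient.mk_eq_zero _).2 (hm r ((mem_maximalIdeal _).2 h))
    refine hN.not_ge ?_
    rw [Submodule.span_singleton_le_iff_mem]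
    exact (Submodule.smul_mem_iff_of_isUnit _ hr).1 hw

variable {R M κ : Type*} [CommRing R] [IsLocalRing R] [AddCommGroup M] [Module R M]

/-- After inverting a polynomial outside `pol R κ`, the specializations of `X` behave uniformly. -/
lemma exists_uniform_spec [IsNoetherianRing R] [Module.Finite R M] [Finite κ]
    (X : Submodule (MvPolynomial κ R) (MvPolynomial κ R ⊗[R] M))
    (hX : ∃ s ∉ pol R κ, ∃ k, ∀ f ∈ pol R κ ^ k, ∀ z, (s * f) • z ∈ X) :
    ∃ l : ℕ, ∃ s ∉ pol R κ, ∀ e : κ → R, MvPolynomial.eval e s ∉ maximalIdeal R →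
      X ⊓ (RingHom.ker (MvPolynomial.eval e) • ⊤) ≤ RingHom.ker (MvPolynomial.eval e) • X ∧
      rlen (X.map (spec M e)) ⊤ = l := by
  induction X using WellFoundedGT.induction with
  | ind X ih =>
  by_cases hT : X = ⊤
  · subst hT
    refine ⟨0, 1, fun h => (inferInstance : (pol R κ).IsPrime).ne_top
      ((Ideal.eq_top_iff_one _).2 h), fun e _ => ⟨inf_le_right, ?_⟩⟩
    rw [Submodule.map_top, LinearMap.range_eq_top.2 (spec_surjective e), Nat.cast_zero]
    exact rlen_eq_zero.2 le_rfl
  have : Nontrivial ((MvPolynomial κ R ⊗[R] M) ⧸ X) := Submodule.Quotient.nontrivial_iff.2 hT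
  obtain ⟨q, hq⟩ := associatedPrimes.nonempty (MvPolynomial κ R) ((MvPolynomial κ R ⊗[R] M) ⧸ X)
  obtain ⟨hp, y', hy'⟩ := isAssociatedPrime_iff.1 hq
  obtain ⟨y, rfl⟩ := Submodule.Quotient.mk_surjective X y'
  have hmem : ∀ f, f ∈ q ↔ f • y ∈ X := fun f => by
    rw [hy', Submodule.mem_colon_singleton, Submodule.mem_bot, ← Submodule.Quotient.mk_smul,
      Submodule.Quotient.mk_eq_zero]
  have hyX : y ∉ X := fun h => hp.ne_top ((Ideal.eq_top_iff_one _).2 ((hmem 1).2 (by rwa [one_smul])))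
  have hlt : X < X ⊔ Submodule.span _ {y} := left_lt_sup.2 fun h => hyX
    (h (Submodule.mem_span_singleton_self y))
  obtain ⟨s, hs, k, hk⟩ := hX
  obtain ⟨l, s₁, hs₁, h₁⟩ := ih _ hlt ⟨s, hs, k, fun f hf z => Submodule.mem_sup_left (hk f hf z)⟩
  have hmap : ∀ e : κ → R, (X ⊔ Submodule.span _ {y}).map (spec M e) =
      X.map (spec M e) ⊔ Submodule.span R {spec M e y} := fun e => by
    rw [Submodule.map_sup, Submodule.map_span, Set.image_singleton]
  by_cases hqp : q ≤ pol R κ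
  · have hsq : s ∉ q := fun h => hs (hqp h)
    have hpq : pol R κ ≤ q := by
      intro f hf
      refine hp.mem_of_pow_mem k ((hp.mem_or_mem ?_).resolve_left hsq)
      exact (hmem _).2 (hk _ (Ideal.pow_mem_pow hf k) y)
    refine ⟨l + 1, s₁, hs₁, fun e he => ⟨fun z hz => ?_, ?_⟩⟩
    · obtain ⟨f, hf, hz₀⟩ := mem_smul_sup_span ((h₁ e he).1
        ⟨Submodule.mem_sup_left hz.1, hz.2⟩)
      have hfq : f ∈ q := by
        rw [hmem]
        have := X.sub_mem hz.1 (Submodule.smul_le_right hz₀)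
        rwa [sub_sub_cancel] at this
      have hf2 := sub_C_eval_mem_mul e (hqp hfq)
      rw [RingHom.mem_ker.1 hf, map_zero, sub_zero] at hf2
      have hfy : f • y ∈ RingHom.ker (MvPolynomial.eval e) • X := by
        refine Submodule.smul_induction_on hf2 (fun a ha b hb => ?_) fun a b ha hb => ?_
        · rw [smul_eq_mul, mul_smul]
          exact Submodule.smul_mem_smul ha ((hmem b).1 (hpq hb))
        · rw [add_smul]
          exact Submodule.add_mem _ ha hb
      have := Submodule.add_mem _ hz₀ hfy
      rwa [sub_add_cancel] at this
    · rw [rlen_add (Submodule.map_mono hlt.le) le_top, (h₁ e he).2, hmap,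
        rlen_sup_span_singleton, Nat.cast_add, Nat.cast_one, add_comm]
      · rintro ⟨x, hx, hxy⟩
        have hd : y - x ∈ LinearMap.ker (spec M e) := by
          rw [LinearMap.mem_ker, map_sub, hxy, sub_self]
        rw [ker_spec] at hd
        obtain ⟨f, hf, hz₀⟩ := mem_smul_sup_span ((h₁ e he).1 ⟨Submodule.sub_mem _
          (Submodule.mem_sup_right (Submodule.mem_span_singleton_self y))
          (Submodule.mem_sup_left hx), hd⟩)
        have h2 := X.add_mem (Submodule.smul_le_right hz₀) hx
        rw [show y - x - f • y + x = (1 - f) • y by module, ← hmem] at h2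
        have h3 := eval_mem_of_mem_pol e (hqp h2)
        rw [map_sub, RingHom.mem_ker.1 hf, map_one, sub_zero] at h3
        exact (Ideal.ne_top_iff_one _).1 (maximalIdeal.isMaximal R).ne_top h3
      · intro r hr
        refine ⟨MvPolynomial.C r • y, (hmem _).1 (hpq ?_), ?_⟩
        · rw [pol_eq]
          exact Ideal.mem_map_of_mem _ hr
        · rw [map_smulₛₗ, MvPolynomial.eval_C]
  · obtain ⟨t, htq, ht⟩ := SetLike.not_le_iff_exists.1 hqp
    refine ⟨l, s₁ * t, fun h => ((inferInstance : (pol R κ).IsPrime).mem_or_mem h).elim hs₁ ht,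
      fun e he => ?_⟩
    rw [map_mul] at he
    have he₁ : MvPolynomial.eval e s₁ ∉ maximalIdeal R := fun h => he (Ideal.mul_mem_right _ _ h)
    have het : MvPolynomial.eval e t ∉ maximalIdeal R := fun h => he (Ideal.mul_mem_left _ _ h)
    obtain ⟨g, hg⟩ := exists_one_sub_mul_mem e het
    have hty := (hmem t).1 htq
    refine ⟨fun z hz => ?_, ?_⟩
    · obtain ⟨f, hf, hz₀⟩ := mem_smul_sup_span ((h₁ e he₁).1
        ⟨Submodule.mem_sup_left hz.1, hz.2⟩)
      have e1 := Submodule.smul_mem_smul hg hz.1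
      have e2 := Submodule.smul_mem _ (g * t) hz₀
      have e3 := Submodule.smul_mem _ g (Submodule.smul_mem_smul hf hty)
      have e4 : z = (1 - g * t) • z + (g * t) • (z - f • y) + g • f • t • y := by module
      rw [e4]
      exact Submodule.add_mem _ (Submodule.add_mem _ e1 e2) e3
    · rw [← (h₁ e he₁).2, hmap]
      congr 1
      refine (sup_eq_left.2 ((Submodule.span_singleton_le_iff_mem _ _).2 (Submodule.mem_map.2
        ⟨g • t • y, X.smul_mem g hty, ?_⟩))).symm
      rw [RingHom.mem_ker] at hg
      rw [← mul_smul, map_smulₛₗ, ← sub_sub_cancel 1 (g * t), map_sub, hg, map_one, sub_zero,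
        one_smul]

end SpreadLength

section Descend
open IsLocalRing

lemma exists_smul_mem_of_fg {A E : Type*} [CommRing A] [AddCommGroup E] [Module A E]
    {S : Submonoid A} {N X : Submodule A E} (hN : N.FG)
    (h : ∀ y ∈ N, ∃ t ∈ S, t • y ∈ X) : ∃ s ∈ S, ∀ y ∈ N, s • y ∈ X := by
  induction N, hN using Submodule.fg_induction with
  | singleton y =>
    obtain ⟨t, ht, hy⟩ := h y (Submodule.mem_span_singleton_self y)
    refine ⟨t, ht, fun z hz => ?_⟩
    obtain ⟨r, rfl⟩ := Submodule.mem_span_singleton.1 hz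
    rw [smul_comm]
    exact X.smul_mem r hy
  | sup N₁ N₂ _ _ h₁ h₂ =>
    obtain ⟨s, hs, hs'⟩ := h₁ fun y hy => h y (Submodule.mem_sup_left hy)
    obtain ⟨t, ht, ht'⟩ := h₂ fun y hy => h y (Submodule.mem_sup_right hy)
    refine ⟨s * t, S.mul_mem hs ht, fun y hy => ?_⟩
    obtain ⟨y₁, hy₁, y₂, hy₂, rfl⟩ := Submodule.mem_sup.1 hy
    rw [smul_add, mul_comm, mul_smul, mul_comm, mul_smul]
    exact X.add_mem (X.smul_mem _ (hs' _ hy₁)) (X.smul_mem _ (ht' _ hy₂))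

variable {A L E E' : Type*} [CommRing A] [CommRing L] [Algebra A L] [AddCommGroup E] [Module A E]
  [AddCommGroup E'] [Module A E'] [Module L E'] [IsScalarTower A L E'] (S : Submonoid A)
  [IsLocalization S L] (f : E →ₗ[A] E') [IsLocalizedModule S f]

include f in
lemma exists_smul_eq_of_mem_map_smul {J : Ideal A} {w : E'}
    (hw : w ∈ (J.map (algebraMap A L) • ⊤ : Submodule L E')) :
    ∃ t ∈ S, ∃ y ∈ (J • ⊤ : Submodule A E), t • w = f y := by
  refine Submodule.smul_induction_on hw (fun a ha w _ => ?_) fun v w hv hw => ?_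
  · obtain ⟨⟨⟨j, hj⟩, s⟩, hs⟩ := (IsLocalization.mem_map_algebraMap_iff S L).1 ha
    obtain ⟨⟨y, t⟩, ht⟩ := IsLocalizedModule.surj S f w
    refine ⟨s * t, S.mul_mem s.2 t.2, j • y, Submodule.smul_mem_smul hj trivial, ?_⟩
    change (t : A) • w = f y at ht
    simp only at hs
    rw [map_smul, ← ht, ← algebraMap_smul L, ← algebraMap_smul L j, ← hs, map_mul,
      ← algebraMap_smul L (t : A), smul_smul, smul_smul]
    congr 1
    ring
  · obtain ⟨s, hs, y, hy, h1⟩ := hv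
    obtain ⟨t, ht, z, hz, h2⟩ := hw
    refine ⟨s * t, S.mul_mem hs ht, t • y + s • z, Submodule.add_mem _
      (Submodule.smul_mem _ _ hy) (Submodule.smul_mem _ _ hz), ?_⟩
    rw [map_add, map_smul, map_smul, ← h1, ← h2, smul_add, smul_smul, smul_smul, mul_comm t]

lemma map_mem_map_smul (J : Ideal A) {y : E} (hy : y ∈ (J • ⊤ : Submodule A E)) :
    f y ∈ (J.map (algebraMap A L) • ⊤ : Submodule L E') := by
  refine Submodule.smul_induction_on hy (fun a ha w _ => ?_) fun v w hv hw => ?_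
  · rw [map_smul, ← algebraMap_smul L a]
    exact Submodule.smul_mem_smul (Ideal.mem_map_of_mem _ ha) trivial
  · rw [map_add]
    exact Submodule.add_mem _ hv hw

include S in
lemma exists_smul_mem_smul {J : Ideal A} {y : E}
    (hy : f y ∈ (J.map (algebraMap A L) • ⊤ : Submodule L E')) :
    ∃ t ∈ S, t • y ∈ (J • ⊤ : Submodule A E) := by
  obtain ⟨t, ht, z, hz, h⟩ := exists_smul_eq_of_mem_map_smul S f hy
  rw [← map_smul] at h
  obtain ⟨c, hc⟩ := IsLocalizedModule.exists_of_eq (S := S) h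
  refine ⟨c * t, S.mul_mem c.2 ht, ?_⟩
  rw [mul_smul]
  change (c : A) • t • y = (c : A) • z at hc
  rw [hc]
  exact Submodule.smul_mem _ _ hz

lemma map_mem_satur (I b : Ideal A) {y : E} (hy : y ∈ satur I (b • ⊤ : Submodule A E)) :
    f y ∈ satur (I.map (algebraMap A L)) (b.map (algebraMap A L) • ⊤ : Submodule L E') := by
  rw [mem_satur] at hy ⊢
  obtain ⟨n, hn⟩ := hy
  refine ⟨n, fun r hr => ?_⟩
  rw [← Ideal.map_pow] at hr
  have : Ideal.map (algebraMap A L) (I ^ n) ≤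
      (Submodule.comap (LinearMap.toSpanSingleton L E' (f y))
        (b.map (algebraMap A L) • ⊤ : Submodule L E')) := by
    refine Ideal.span_le.2 ?_
    rintro _ ⟨r, hr, rfl⟩
    change algebraMap A L r • f y ∈ (b.map (algebraMap A L) • ⊤ : Submodule L E')
    rw [algebraMap_smul, ← map_smul]
    exact map_mem_map_smul f b (hn r hr)
  exact this hr

include S in
lemma exists_smul_mem_satur [IsNoetherianRing A] [Module.Finite A E] (I b : Ideal A) {y : E}
    (hy : f y ∈ satur (I.map (algebraMap A L)) (b.map (algebraMap A L) • ⊤ : Submodule L E')) :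
    ∃ t ∈ S, t • y ∈ satur I (b • ⊤ : Submodule A E) := by
  rw [mem_satur] at hy
  obtain ⟨n, hn⟩ := hy
  obtain ⟨s, hs, h⟩ := exists_smul_mem_of_fg (S := S) (X := (b • ⊤ : Submodule A E))
    (N := Submodule.map (LinearMap.toSpanSingleton A E y) (I ^ n)) (IsNoetherian.noetherian _) (by
      rintro _ ⟨r, hr, rfl⟩
      refine exists_smul_mem_smul (L := L) S f ?_
      rw [LinearMap.toSpanSingleton_apply, map_smul, ← algebraMap_smul L r]
      refine hn _ ?_
      rw [← Ideal.map_pow]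
      exact Ideal.mem_map_of_mem _ hr)
  refine ⟨s, hs, mem_satur.2 ⟨n, fun r hr => ?_⟩⟩
  rw [smul_comm]
  exact h _ ⟨r, hr, rfl⟩

end Descend

section DescendGood
open IsLocalRing
variable {A L E E' : Type*} [CommRing A] [CommRing L] [Algebra A L] [AddCommGroup E] [Module A E]
  [AddCommGroup E'] [Module A E'] [Module L E'] [IsScalarTower A L E']

lemma exists_descent_sup [IsNoetherianRing A] [Module.Finite A E] (S : Submonoid A)
    [IsLocalization S L] (f : E →ₗ[A] E') [IsLocalizedModule S f]
    (I b : Ideal A) (a : A) (J J' : Ideal A)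
    (h : (J.map (algebraMap A L) • ⊤ : Submodule L E') ≤
      am (algebraMap A L a) (J'.map (algebraMap A L) • ⊤) ⊔ (satur (I.map (algebraMap A L))
        (b.map (algebraMap A L) • ⊤ : Submodule L E'))) : ∃ s ∈ S,
      ∀ y ∈ (J • ⊤ : Submodule A E), s • y ∈ am a (J' • ⊤ : Submodule A E) ⊔ satur I (b • ⊤) := by
  refine exists_smul_mem_of_fg (IsNoetherian.noetherian _) fun y hy => ?_
  obtain ⟨v, hv, k, hk, hvk⟩ := Submodule.mem_sup.1 (h (map_mem_map_smul f J hy))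
  obtain ⟨w, hw, rfl⟩ := mem_am.1 hv
  obtain ⟨t, ht, z, hz, htz⟩ := exists_smul_eq_of_mem_map_smul S f hw
  have : f (t • y - a • z) ∈ satur (I.map (algebraMap A L))
      (b.map (algebraMap A L) • ⊤ : Submodule L E') := by
    have e : f (t • y - a • z) = algebraMap A L t • k := by
      rw [map_sub, map_smul, map_smul, ← htz, ← hvk, algebraMap_smul, algebraMap_smul, smul_add,
        smul_comm, add_sub_cancel_left]
    rw [e]
    exact Submodule.smul_mem _ _ hk
  obtain ⟨c, hc, hcm⟩ := exists_smul_mem_satur S f I b this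
  refine ⟨c * t, S.mul_mem hc ht, Submodule.mem_sup.2 ⟨a • c • z,
    mem_am.2 ⟨c • z, Submodule.smul_mem _ c hz, rfl⟩, _, hcm, by module⟩⟩

lemma exists_descent_reg [IsNoetherianRing A] [Module.Finite A E] (S : Submonoid A)
    [IsLocalization S L] (f : E →ₗ[A] E') [IsLocalizedModule S f]
    (I b : Ideal A) (a : A)
    (h : ∀ y, algebraMap A L a • y ∈ satur (I.map (algebraMap A L))
      (b.map (algebraMap A L) • ⊤ : Submodule L E') → y ∈ satur (I.map (algebraMap A L))
      (b.map (algebraMap A L) • ⊤ : Submodule L E')) :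
    ∃ s ∈ S, ∀ y : E, a • y ∈ satur I (b • ⊤ : Submodule A E) → s • y ∈ satur I (b • ⊤) := by
  refine exists_smul_mem_of_fg (N := (satur I (b • ⊤ : Submodule A E)).comap
    (LinearMap.lsmul A E a)) (IsNoetherian.noetherian _) fun y hy => ?_
  refine exists_smul_mem_satur (L := L) S f I b (h _ ?_)
  have := map_mem_satur (L := L) f I b (y := a • y) hy
  rwa [map_smul, ← algebraMap_smul L a] at this

/-- A good situation over a localization descends after inverting one element. -/
lemma exists_descent [IsLocalRing L] [IsNoetherianRing A] [Module.Finite A E] (p : Ideal A)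
    [p.IsPrime] [IsLocalization.AtPrime L p] (f : E →ₗ[A] E') [IsLocalizedModule p.primeCompl f]
    (I b : Ideal A) (a : A)
    (hg : Good (I.map (algebraMap A L)) (satur (I.map (algebraMap A L))
      (b.map (algebraMap A L) • ⊤ : Submodule L E')) (algebraMap A L a)) :
    ∃ s ∉ p, (∀ y : E, a • y ∈ satur I (b • ⊤ : Submodule A E) → s • y ∈ satur I (b • ⊤)) ∧
      (∃ n, ∀ y ∈ (I ^ (n + 1) • ⊤ : Submodule A E),
        s • y ∈ am a (I ^ n • ⊤ : Submodule A E) ⊔ satur I (b • ⊤)) ∧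
      ∃ k, ∀ y ∈ (p ^ k • ⊤ : Submodule A E), s • y ∈ satur I (b • ⊤) ⊔ am a ⊤ := by
  obtain ⟨s₁, hs₁, h₁⟩ := exists_descent_reg (L := L) p.primeCompl f I b a hg.reg
  obtain ⟨n, hn⟩ := hg.red
  obtain ⟨k, hk⟩ := hg.cof
  obtain ⟨s₂, hs₂, h₂⟩ := exists_descent_sup (L := L) p.primeCompl f I b a (I ^ (n + 1)) (I ^ n)
    (by rwa [Ideal.map_pow, Ideal.map_pow])
  obtain ⟨s₃, hs₃, h₃⟩ := exists_descent_sup (L := L) p.primeCompl f I b a (p ^ k) ⊤ (by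
    rw [Ideal.map_pow, IsLocalization.AtPrime.map_eq_maximalIdeal p L, Ideal.map_top,
      Submodule.top_smul, sup_comm]
    exact hk)
  rw [Submodule.top_smul, sup_comm] at h₃
  refine ⟨s₁ * (s₂ * s₃), p.primeCompl.mul_mem hs₁ (p.primeCompl.mul_mem hs₂ hs₃),
    fun y hy => ?_, ⟨n, fun y hy => ?_⟩, ⟨k, fun y hy => ?_⟩⟩
  · rw [mul_comm, mul_smul]
    exact Submodule.smul_mem _ _ (h₁ y hy)
  · rw [show s₁ * (s₂ * s₃) = (s₁ * s₃) * s₂ by ring, mul_smul]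
    exact Submodule.smul_mem _ _ (h₂ y hy)
  · rw [← mul_assoc, mul_smul]
    exact Submodule.smul_mem _ _ (h₃ y hy)

end DescendGood

section SpecGood
open IsLocalRing TensorProduct
variable {R M κ : Type*} [CommRing R] [AddCommGroup M] [Module R M]

lemma map_smul_spec (e : κ → R) (J : Ideal (MvPolynomial κ R))
    (N : Submodule (MvPolynomial κ R) (MvPolynomial κ R ⊗[R] M)) :
    (J • N).map (spec M e) = J.map (MvPolynomial.eval e) • N.map (spec M e) := by
  refine le_antisymm (Submodule.map_le_iff_le_comap.2 (Submodule.smul_le.2 fun r hr z hz => ?_))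
    (Submodule.smul_le.2 ?_)
  · rw [Submodule.mem_comap, map_smulₛₗ]
    exact Submodule.smul_mem_smul (Ideal.mem_map_of_mem _ hr) (Submodule.mem_map_of_mem hz)
  · rintro r hr _ ⟨z, hz, rfl⟩
    obtain ⟨f, hf, rfl⟩ := (Ideal.mem_map_iff_of_surjective _
      (eval_surjective e).is_surjective).1 hr
    rw [← map_smulₛₗ]
    exact Submodule.mem_map_of_mem (Submodule.smul_mem_smul hf hz)

lemma map_spec_top (e : κ → R) : (⊤ : Submodule (MvPolynomial κ R) _).map (spec M e) = ⊤ := by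
  rw [Submodule.map_top, LinearMap.range_eq_top.2 (spec_surjective e)]

lemma map_am_spec (e : κ → R) (a : MvPolynomial κ R)
    (N : Submodule (MvPolynomial κ R) (MvPolynomial κ R ⊗[R] M)) :
    (am a N).map (spec M e) = am (MvPolynomial.eval e a) (N.map (spec M e)) := by
  rw [am_eq, am_eq, map_smul_spec, Ideal.map_span, Set.image_singleton]

lemma map_C_map_eval (e : κ → R) (J : Ideal R) :
    (J.map (MvPolynomial.C (σ := κ))).map (MvPolynomial.eval e) = J := by
  rw [Ideal.map_map, show (MvPolynomial.eval e).comp MvPolynomial.C = RingHom.id R from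
    RingHom.ext fun r => MvPolynomial.eval_C r, Ideal.map_id]

lemma map_spec_satur_le (e : κ → R) (I : Ideal R) (b : Ideal (MvPolynomial κ R)) :
    (satur (I.map MvPolynomial.C) (b • ⊤ : Submodule _ (MvPolynomial κ R ⊗[R] M))).map (spec M e) ≤
      satur I (b.map (MvPolynomial.eval e) • ⊤) := by
  rintro _ ⟨z, hz, rfl⟩
  obtain ⟨n, hn⟩ := mem_satur.1 hz
  refine mem_satur.2 ⟨n, fun r hr => ?_⟩
  have h := hn (MvPolynomial.C r) (by rw [← Ideal.map_pow]; exact Ideal.mem_map_of_mem _ hr)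
  have := Submodule.mem_map_of_mem (f := spec M e) h
  rwa [map_smul_spec, map_spec_top, map_smulₛₗ, MvPolynomial.eval_C] at this

variable [IsLocalRing R]

/-- Uniformity of specializations of a generically good situation. -/
lemma exists_good_spec [IsNoetherianRing R] [Module.Finite R M] [Finite κ] (I : Ideal R)
    (b : Ideal (MvPolynomial κ R)) (a : MvPolynomial κ R) (ha : a ∈ I.map (MvPolynomial.C (σ := κ)))
    {K : Submodule (MvPolynomial κ R) (MvPolynomial κ R ⊗[R] M)}
    (hK : K = satur (I.map (MvPolynomial.C (σ := κ))) (b • ⊤))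
    {s : MvPolynomial κ R} (hs : s ∉ pol R κ)
    (h₁ : ∀ y : MvPolynomial κ R ⊗[R] M, a • y ∈ K → s • y ∈ K)
    (h₂ : ∃ n, ∀ y ∈ (I.map (MvPolynomial.C (σ := κ)) ^ (n + 1) • ⊤ :
        Submodule (MvPolynomial κ R) (MvPolynomial κ R ⊗[R] M)),
      s • y ∈ am a (I.map (MvPolynomial.C (σ := κ)) ^ n • ⊤) ⊔ K)
    (h₃ : ∃ k, ∀ y ∈ (pol R κ ^ k • ⊤ : Submodule (MvPolynomial κ R) (MvPolynomial κ R ⊗[R] M)),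
      s • y ∈ K ⊔ am a ⊤) :
    ∃ l : ℕ, ∃ s ∉ pol R κ, ∀ e : κ → R, MvPolynomial.eval e s ∉ maximalIdeal R →
      Good I (satur I (b.map (MvPolynomial.eval e) • ⊤ : Submodule R M)) (MvPolynomial.eval e a) ∧
      rlen (satur I (b.map (MvPolynomial.eval e) • ⊤ : Submodule R M) ⊔
        am (MvPolynomial.eval e a) ⊤) ⊤ = l := by
  obtain ⟨k, hk⟩ := h₃
  obtain ⟨n, hn⟩ := h₂
  obtain ⟨l, s', hs', h⟩ := exists_uniform_spec (K ⊔ am a ⊤) ⟨s, hs, k, fun f hf z => by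
    rw [mul_smul]
    exact hk _ (Submodule.smul_mem_smul hf trivial)⟩
  refine ⟨l, s * s', fun h => ((inferInstance : (pol R κ).IsPrime).mem_or_mem h).elim hs hs',
    fun e he => ?_⟩
  rw [map_mul] at he
  have hes : IsUnit (MvPolynomial.eval e s) := not_not.1 fun h =>
    he (Ideal.mul_mem_right _ _ ((mem_maximalIdeal _).2 h))
  obtain ⟨hpure, hlen⟩ := h e fun h => he (Ideal.mul_mem_left _ _ h)
  have haI : MvPolynomial.eval e a ∈ I := by
    have := Ideal.mem_map_of_mem (MvPolynomial.eval e) ha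
    rwa [map_C_map_eval] at this
  have hdesc : ∀ (Y : Submodule (MvPolynomial κ R) (MvPolynomial κ R ⊗[R] M)) (z),
      s • z ∈ Y → spec M e z ∈ Y.map (spec M e) := fun Y z hz => by
    rw [← Submodule.smul_mem_iff_of_isUnit _ hes, ← map_smulₛₗ]
    exact Submodule.mem_map_of_mem hz
  have hreg : ∀ y : M, MvPolynomial.eval e a • y ∈ K.map (spec M e) → y ∈ K.map (spec M e) := by
    intro y hy
    obtain ⟨z, rfl⟩ := spec_surjective e y
    obtain ⟨x, hx, hxz⟩ := hy
    have hker : a • z - x ∈ LinearMap.ker (spec M e) := by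
      rw [LinearMap.mem_ker, map_sub, hxz, map_smulₛₗ, sub_self]
    rw [ker_spec] at hker
    have h4 := hpure ⟨Submodule.sub_mem _
      (Submodule.mem_sup_right (mem_am.2 ⟨z, trivial, rfl⟩)) (Submodule.mem_sup_left hx), hker⟩
    rw [Submodule.smul_sup, smul_am] at h4
    obtain ⟨x', hx', v, hv, hxv⟩ := Submodule.mem_sup.1 h4
    obtain ⟨w, hw, rfl⟩ := mem_am.1 hv
    have h5 : a • (z - w) ∈ K := by
      rw [show a • (z - w) = x + x' by rw [smul_sub, ← sub_eq_iff_eq_add'.2 hxv.symm]; abel]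
      exact K.add_mem hx (Submodule.smul_le_right hx')
    have h6 := hdesc K _ (h₁ _ h5)
    rw [← ker_spec] at hw
    rwa [map_sub, LinearMap.mem_ker.1 hw, sub_zero] at h6
  have hKe : K.map (spec M e) = satur I (b.map (MvPolynomial.eval e) • ⊤ : Submodule R M) := by
    refine le_antisymm (hK ▸ map_spec_satur_le e I b) fun y hy => ?_
    obtain ⟨m, hm⟩ := mem_satur.1 hy
    have h7 : MvPolynomial.eval e a ^ m • y ∈ K.map (spec M e) := by
      refine Submodule.map_mono (hK ▸ le_satur (I.map (MvPolynomial.C (σ := κ))) _) ?_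
      rw [map_smul_spec, map_spec_top]
      exact hm _ (Ideal.pow_mem_pow haI m)
    clear hm hy
    induction m with
    | zero => rwa [pow_zero, one_smul] at h7
    | succ m ih =>
      rw [pow_succ', mul_smul] at h7
      exact ih (hreg _ h7)
  rw [← hKe]
  refine ⟨⟨haI, hreg, ⟨n, fun y hy => ?_⟩, ⟨k, fun y hy => ?_⟩⟩, ?_⟩
  · rw [← map_C_map_eval e I, ← Ideal.map_pow, ← map_spec_top e, ← map_smul_spec] at hy
    obtain ⟨z, hz, rfl⟩ := hy
    have := hdesc _ _ (hn z hz)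
    rwa [Submodule.map_sup, map_am_spec, map_smul_spec, Ideal.map_pow, map_C_map_eval,
      map_spec_top] at this
  · rw [← map_C_map_eval e (maximalIdeal R), ← pol_eq, ← Ideal.map_pow, ← map_spec_top e,
      ← map_smul_spec] at hy
    obtain ⟨z, hz, rfl⟩ := hy
    have := hdesc _ _ (hk z hz)
    rwa [Submodule.map_sup, map_am_spec, map_spec_top] at this
  · rw [← hlen, Submodule.map_sup, map_am_spec, map_spec_top]

end SpecGood

section BaseChange
open IsLocalRing

lemma ringKrullDim_le_of_map_maximalIdeal {B C : Type*} [CommRing B] [CommRing C] [IsLocalRing B]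
    [IsLocalRing C] [IsNoetherianRing B] [IsNoetherianRing C] (φ : B →+* C)
    (h : (maximalIdeal B).map φ = maximalIdeal C) : ringKrullDim C ≤ ringKrullDim B := by
  classical
  rw [← maximalIdeal_height_eq_ringKrullDim, ← maximalIdeal_height_eq_ringKrullDim]
  obtain ⟨s, hs, hcard⟩ := (maximalIdeal B).exists_finset_card_eq_height_of_isNoetherianRing
  rw [WithBot.coe_le_coe, ← hcard]
  refine (Ideal.height_le_card_of_mem_minimalPrimes_span_finset (s := s.image φ)
    ⟨⟨inferInstance, ?_⟩, fun Q hQ _ => ?_⟩).trans (by exact_mod_cast Finset.card_image_le)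
  · rw [Finset.coe_image, ← Ideal.map_span, ← h]
    exact Ideal.map_mono hs.1.2
  · rw [Finset.coe_image, ← Ideal.map_span, Ideal.map_le_iff_le_comap] at hQ
    have := hQ.1
    rw [← h, Ideal.map_le_iff_le_comap]
    exact hs.2 ⟨inferInstance, hQ.2⟩ (le_maximalIdeal (Ideal.IsPrime.ne_top inferInstance))

lemma ringKrullDim_quotient_le_of_map_le {R L : Type*} [CommRing R] [CommRing L] [IsLocalRing R]
    [IsLocalRing L] [IsNoetherianRing R] [IsNoetherianRing L] (φ : R →+* L)
    (h : (maximalIdeal R).map φ = maximalIdeal L) {J : Ideal R} {P : Ideal L} (hP : P ≠ ⊤)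
    (hJ : J.map φ ≤ P) : ringKrullDim (L ⧸ P) ≤ ringKrullDim (R ⧸ J) := by
  have hJ' : J ≠ ⊤ := by
    rintro rfl
    rw [Ideal.map_top] at hJ
    exact hP (top_le_iff.1 hJ)
  have := Ideal.Quotient.nontrivial_iff.2 hP
  have := Ideal.Quotient.nontrivial_iff.2 hJ'
  have := IsLocalRing.of_surjective' (Ideal.Quotient.mk P) Ideal.Quotient.mk_surjective
  have := IsLocalRing.of_surjective' (Ideal.Quotient.mk J) Ideal.Quotient.mk_surjective
  refine ringKrullDim_le_of_map_maximalIdeal (Ideal.quotientMap P φ (Ideal.map_le_iff_le_comap.1 hJ)) ?_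
  rw [← map_maximalIdeal_of_surjective _ (Ideal.Quotient.mk_surjective (I := J)),
    ← map_maximalIdeal_of_surjective _ (Ideal.Quotient.mk_surjective (I := P)), ← h, Ideal.map_map,
    Ideal.map_map, Ideal.quotientMap_comp_mk]

/-- The cofinite filter on residue classes. -/
def resFilter (R : Type*) [CommRing R] [IsLocalRing R] : Filter R :=
  comap (residue R) cofinite

variable {R L : Type*} [CommRing R] [IsLocalRing R] [CommRing L] [IsLocalRing L]

lemma isGeneric_map (hres : Infinite (ResidueField R)) (φ : R →+* L) [IsLocalHom φ] (z : L) :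
    IsGeneric (map (fun r => z + φ r) (resFilter R)) := by
  have : (resFilter R).NeBot :=
    cofinite_neBot.comap_of_surj residue_surjective
  refine ⟨inferInstance, fun r₀ => ?_⟩
  rw [eventually_map, resFilter, eventually_comap]
  by_cases h : ∃ r₁, z + φ r₁ - r₀ ∈ maximalIdeal L
  · obtain ⟨r₁, h₁⟩ := h
    filter_upwards [(Set.finite_singleton (residue R r₁)).compl_mem_cofinite]
    rintro _ hr r rfl h₂
    have h3 := Ideal.sub_mem _ h₂ h₁
    rw [show z + φ r - r₀ - (z + φ r₁ - r₀) = φ (r - r₁) by rw [map_sub]; ring, mem_maximalIdeal,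
      map_mem_nonunits_iff, ← mem_maximalIdeal, ← residue_eq_zero_iff, map_sub, sub_eq_zero] at h3
    exact hr h3
  · exact Eventually.of_forall fun _ r _ hr => h ⟨r, hr⟩

end BaseChange

section Uniform
open IsLocalRing TensorProduct

lemma eventually_seqFilter_forall {E : Type*} : ∀ {n : ℕ} {u : Fin n → Filter E}
    {p : Fin n → E → Prop}, (∀ i, ∀ᶠ e in u i, p i e) → ∀ᶠ c in seqFilter n u, ∀ i, p i (c i)
  | 0, _, _, _ => eventually_seqFilter_zero.2 fun i => i.elim0
  | n + 1, u, p, h => by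
    rw [eventually_seqFilter_succ]
    filter_upwards [h 0] with e he
    filter_upwards [eventually_seqFilter_forall fun i : Fin n => h i.succ] with c hc i
    exact Fin.cases he hc i

lemma eventually_seqFilter_forall₂ {E : Type*} {n m : ℕ} {v : Fin n → Fin m → Filter E}
    {p : Fin n → Fin m → E → Prop} (h : ∀ i j, ∀ᶠ e in v i j, p i j e) :
    ∀ᶠ c in seqFilter n fun i => seqFilter m (v i), ∀ i j, p i j (c i j) :=
  eventually_seqFilter_forall (p := fun i (e : Fin m → E) => ∀ j, p i j (e j)) fun i =>
    eventually_seqFilter_forall (h i)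

variable {R : Type*} [CommRing R] [IsLocalRing R]

lemma pol_map_le {κ : Type*} (g : MvPolynomial κ R →ₐ[R] MvPolynomial κ R) {s : MvPolynomial κ R}
    (hs : s ∈ pol R κ) : g s ∈ pol R κ := by
  rw [pol_eq] at hs ⊢
  have := Ideal.mem_map_of_mem (g : MvPolynomial κ R →+* MvPolynomial κ R) hs
  rw [Ideal.map_map, ← MvPolynomial.algebraMap_eq, AlgHom.comp_algebraMap] at this
  exact this

lemma exists_shift {κ : Type*} (u : κ → R) {s : MvPolynomial κ R} (hs : s ∉ pol R κ) :
    ∃ F ∉ pol R κ, ∀ c, MvPolynomial.eval c F = MvPolynomial.eval (c - u) s := by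
  let g := fun v : κ → R => MvPolynomial.aeval (R := R) fun p => MvPolynomial.X p + MvPolynomial.C (v p)
  have hg : ∀ v c f, MvPolynomial.eval c (g v f) = MvPolynomial.eval (c + v) f := by
    intro v c f
    have : (MvPolynomial.aeval c).comp (g v) = MvPolynomial.aeval (R := R) (c + v) := by
      ext p
      simp [g]
    have := DFunLike.congr_fun this f
    simpa [MvPolynomial.aeval_eq_eval] using this
  refine ⟨g (-u) s, fun h => hs ?_, fun c => by rw [hg, sub_eq_add_neg]⟩
  have h2 := pol_map_le (g u) h
  have : (g u).comp (g (-u)) = AlgHom.id R _ := by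
    ext p
    simp [g]
  have h3 := DFunLike.congr_fun this s
  change g u (g (-u) s) = s at h3
  rwa [h3] at h2

end Uniform

section Generic
open IsLocalRing TensorProduct
/-- The generic linear combination of the `x l`, translated by `u`. -/
def gen {R ι : Type*} [CommRing R] {m : ℕ} (x : Fin m → R) (u : ι × Fin m → R) (j : ι) :
    MvPolynomial (ι × Fin m) R :=
  ∑ l, (MvPolynomial.X (j, l) + MvPolynomial.C (u (j, l))) * MvPolynomial.C (x l)

lemma eval_gen {R ι : Type*} [CommRing R] {m : ℕ} (x : Fin m → R) (u c : ι × Fin m → R) (j : ι) :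
    MvPolynomial.eval (c - u) (gen x u j) = lin x fun l => c (j, l) := by
  simp [gen, lin_apply]

lemma gen_mem {R ι : Type*} [CommRing R] {m : ℕ} {x : Fin m → R} {I : Ideal R}
    (hx : Ideal.span (Set.range x) = I) (u : ι × Fin m → R) (j : ι) : gen x u j ∈ I.map MvPolynomial.C :=
  Ideal.sum_mem _ fun l _ => Ideal.mul_mem_left _ _
    (Ideal.mem_map_of_mem _ (hx ▸ Ideal.subset_span ⟨l, rfl⟩))

variable {R κ M L E : Type*} [CommRing R] [IsLocalRing R] [AddCommGroup M] [Module R M]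
  [CommRing L] [IsLocalRing L] [Algebra (MvPolynomial κ R) L] [IsLocalization.AtPrime L (pol R κ)]
  [AddCommGroup E] [Module (MvPolynomial κ R) E] [Module L E]
  [IsScalarTower (MvPolynomial κ R) L E] (f : MvPolynomial κ R ⊗[R] M →ₗ[MvPolynomial κ R] E)
  [IsLocalizedModule (pol R κ).primeCompl f]

variable (κ L) in
/-- The map from `R` to the local ring `R(Z)`. -/
def toGen : R →+* L :=
  (algebraMap (MvPolynomial κ R) L).comp MvPolynomial.C

omit [IsLocalRing R] [IsLocalRing L] [IsLocalization.AtPrime L (pol R κ)] in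
lemma map_toGen (I : Ideal R) : I.map (toGen κ L) =
    (I.map MvPolynomial.C).map (algebraMap (MvPolynomial κ R) L) := by
  rw [Ideal.map_map, toGen]

variable (R κ L) in
lemma maximalIdeal_map_toGen : (maximalIdeal R).map (toGen κ L) = maximalIdeal L := by
  rw [map_toGen, ← pol_eq, IsLocalization.AtPrime.map_eq_maximalIdeal]

lemma isLocalHom_toGen : IsLocalHom (toGen κ L : R →+* L) := by
  refine ⟨fun r hr => ?_⟩
  by_contra h
  have h1 : toGen κ L r ∈ maximalIdeal L := by
    rw [← maximalIdeal_map_toGen R κ L]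
    exact Ideal.mem_map_of_mem _ ((mem_maximalIdeal _).2 h)
  exact (mem_maximalIdeal _).1 h1 hr

include f in
lemma dimLE_generic [IsNoetherianRing R] [Finite κ] {d : ℕ}
    (h : mDim R M ≤ (d : WithBot ℕ∞)) : DimLE L E d := by
  have := IsLocalization.isNoetherianRing (pol R κ).primeCompl L inferInstance
  intro P hP
  have h1 := coheight_le_ringKrullDim_quotient (J := P.asIdeal) (P := P) le_rfl
  have h2 := h1.trans ((ringKrullDim_quotient_le_of_map_le (toGen κ L)
    (maximalIdeal_map_toGen R κ L) (J := Module.annihilator R M) P.isPrime.ne_top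
    (le_trans ?_ hP)).trans h)
  · exact_mod_cast h2
  rw [Ideal.map_le_iff_le_comap]
  intro r hr
  rw [Ideal.mem_comap, Module.mem_annihilator]
  intro w
  obtain ⟨⟨z, t⟩, ht⟩ := IsLocalizedModule.surj (pol R κ).primeCompl f w
  change (t : MvPolynomial κ R) • w = f z at ht
  have hz : (MvPolynomial.C r : MvPolynomial κ R) • z = 0 := by
    clear ht
    induction z with
    | zero => simp
    | tmul g y =>
      rw [TensorProduct.smul_tmul', smul_eq_mul, ← MvPolynomial.smul_eq_C_mul,
        TensorProduct.smul_tmul, Module.mem_annihilator.1 hr, TensorProduct.tmul_zero]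
    | add z w hz hw => rw [smul_add, hz, hw, add_zero]
  have hu : IsUnit (algebraMap _ L (t : MvPolynomial κ R)) := IsLocalization.map_units L t
  rw [← hu.smul_eq_zero, algebraMap_smul, toGen, RingHom.comp_apply, algebraMap_smul, smul_comm, ht,
    ← map_smul, hz, map_zero]

end Generic

section GenericGood
open IsLocalRing TensorProduct

lemma exists_gen_good {R M L E : Type*} {D m : ℕ} [CommRing R] [IsLocalRing R] [AddCommGroup M]
    [Module R M] [CommRing L] [IsLocalRing L] [AddCommGroup E] [Module L E]
    [Algebra (MvPolynomial (Fin (D + 1) × Fin m) R) L]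
    [IsLocalization.AtPrime L (pol R (Fin (D + 1) × Fin m))]
    [Module (MvPolynomial (Fin (D + 1) × Fin m) R) E]
    [IsScalarTower (MvPolynomial (Fin (D + 1) × Fin m) R) L E]
    (f : MvPolynomial (Fin (D + 1) × Fin m) R ⊗[R] M →ₗ[MvPolynomial (Fin (D + 1) × Fin m) R] E)
    [IsLocalizedModule (pol R (Fin (D + 1) × Fin m)).primeCompl f]
    [IsNoetherianRing R] (hres : Infinite (ResidueField R)) {I : Ideal R}
    (hI : I ≤ maximalIdeal R) {x : Fin m → R} (hx : Ideal.span (Set.range x) = I)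
    [Module.Finite R M] (h : mDim R M ≤ ((D + 1 : ℕ) : WithBot ℕ∞)) :
    ∃ u : Fin (D + 1) × Fin m → R,
      Good ((I.map MvPolynomial.C).map (algebraMap (MvPolynomial (Fin (D + 1) × Fin m) R) L))
        (satur ((I.map MvPolynomial.C).map (algebraMap (MvPolynomial (Fin (D + 1) × Fin m) R) L))
          ((Ideal.span (Set.range fun j : Fin D => gen x u j.castSucc)).map (algebraMap _ L) • ⊤ :
            Submodule L E)) (algebraMap _ L (gen x u (Fin.last D))) := by
  have := IsLocalization.isNoetherianRing (pol R (Fin (D + 1) × Fin m)).primeCompl L inferInstance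
  have : Module.Finite L E :=
    Module.Finite.of_isLocalizedModule (pol R (Fin (D + 1) × Fin m)).primeCompl f
  have := isLocalHom_toGen (R := R) (κ := Fin (D + 1) × Fin m) (L := L)
  let φ : R →+* L := toGen (Fin (D + 1) × Fin m) L
  let Z : Fin (D + 1) × Fin m → L := fun p =>
    algebraMap _ L (MvPolynomial.X p : MvPolynomial (Fin (D + 1) × Fin m) R)
  let v : Fin (D + 1) → Fin m → Filter L := fun j l =>
    map (fun r => Z (j, l) + φ r) (resFilter R)
  have hrow : ∀ j, IsGenericRow (seqFilter m (v j)) := fun j =>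
    isGenericRow_seqFilter _ fun l => isGeneric_map hres _ _
  have hne := seqFilter_neBot _ fun j => (hrow j).neBot
  have hform : ∀ᶠ c in seqFilter (D + 1) fun j => seqFilter m (v j),
      ∀ j l, ∃ r, c j l = Z (j, l) + φ r :=
    eventually_seqFilter_forall₂ (p := fun j l e => ∃ r, e = Z (j, l) + φ r) fun j l =>
      eventually_map.2 (Eventually.of_forall fun r => ⟨r, rfl⟩)
  have hI' : I.map φ ≤ maximalIdeal L :=
    maximalIdeal_map_toGen R (Fin (D + 1) × Fin m) L ▸ Ideal.map_mono hI
  have hx' : Ideal.span (Set.range (φ ∘ x)) = I.map φ := by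
    rw [← hx, Ideal.map_span, Set.range_comp]
  obtain ⟨c, ⟨K, rfl, hK, _⟩, hc⟩ := ((eventually_formula hI' hx' D E _ hrow
    (dimLE_generic f h)).and hform).exists
  choose u hu using hc
  have hlin : ∀ j, algebraMap _ L (gen x (fun p => u p.1 p.2) j) = lin (φ ∘ x) (c j) := by
    intro j
    rw [gen, map_sum, lin_apply]
    refine Finset.sum_congr rfl fun l _ => ?_
    rw [map_mul, map_add, hu, smul_eq_mul]
    rfl
  refine ⟨fun p => u p.1 p.2, ?_⟩
  rw [hlin, Ideal.map_span, ← Set.range_comp, ← map_toGen]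
  simpa only [Function.comp_def, hlin] using hK

end GenericGood

section Final
open IsLocalRing TensorProduct

/-- General specializations are good, with a constant length. -/
lemma exists_uniform_of_isLocalizedModule {R M : Type*} {D m : ℕ} (L : Type*) {E : Type*}
    [CommRing R] [IsLocalRing R] [AddCommGroup M] [Module R M] [CommRing L] [IsLocalRing L] [AddCommGroup E] [Module L E]
    [Algebra (MvPolynomial (Fin (D + 1) × Fin m) R) L]
    [IsLocalization.AtPrime L (pol R (Fin (D + 1) × Fin m))]
    [Module (MvPolynomial (Fin (D + 1) × Fin m) R) E]
    [IsScalarTower (MvPolynomial (Fin (D + 1) × Fin m) R) L E]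
    (f : MvPolynomial (Fin (D + 1) × Fin m) R ⊗[R] M →ₗ[MvPolynomial (Fin (D + 1) × Fin m) R] E)
    [IsLocalizedModule (pol R (Fin (D + 1) × Fin m)).primeCompl f]
    [IsNoetherianRing R] [Module.Finite R M] (hres : Infinite (ResidueField R))
    {I : Ideal R} (hI : I ≤ maximalIdeal R) {x : Fin m → R} (hx : Ideal.span (Set.range x) = I)
    (h : mDim R M ≤ ((D + 1 : ℕ) : WithBot ℕ∞)) :
    ∃ l : ℕ, ∃ F ∉ pol R (Fin (D + 1) × Fin m), ∀ c, MvPolynomial.eval c F ∉ maximalIdeal R →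
      ∃ K, K = satur I (Ideal.span (Set.range fun j : Fin D => lin x fun l => c (j.castSucc, l)) • ⊤ :
        Submodule R M) ∧ Good I K (lin x fun l => c (Fin.last D, l)) ∧
        rlen (K ⊔ am (lin x fun l => c (Fin.last D, l)) ⊤) ⊤ = l := by
  obtain ⟨u, hu⟩ := exists_gen_good (L := L) f hres hI hx h
  obtain ⟨s, hs, h₁, h₂, h₃⟩ := exists_descent (pol R (Fin (D + 1) × Fin m)) f
    (I.map MvPolynomial.C) _ _ hu
  obtain ⟨l, s', hs', hl⟩ := exists_good_spec I _ _ (gen_mem hx u _) rfl hs h₁ h₂ h₃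
  obtain ⟨F, hF, hFs⟩ := exists_shift u hs'
  refine ⟨l, F, hF, fun c hc => ?_⟩
  rw [hFs] at hc
  have := hl _ hc
  rw [eval_gen, Ideal.map_span, ← Set.range_comp] at this
  simp only [Function.comp_def, eval_gen] at this
  exact ⟨_, rfl, this⟩

lemma exists_uniform {R M : Type*} {D m : ℕ} [CommRing R] [IsLocalRing R] [IsNoetherianRing R]
    [AddCommGroup M] [Module R M] [Module.Finite R M] (hres : Infinite (ResidueField R))
    {I : Ideal R} (hI : I ≤ maximalIdeal R) {x : Fin m → R} (hx : Ideal.span (Set.range x) = I)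
    (h : mDim R M ≤ ((D + 1 : ℕ) : WithBot ℕ∞)) :
    ∃ l : ℕ, ∃ F ∉ pol R (Fin (D + 1) × Fin m), ∀ c, MvPolynomial.eval c F ∉ maximalIdeal R →
      ∃ K, K = satur I (Ideal.span (Set.range fun j : Fin D => lin x fun l => c (j.castSucc, l)) • ⊤ :
        Submodule R M) ∧ Good I K (lin x fun l => c (Fin.last D, l)) ∧
        rlen (K ⊔ am (lin x fun l => c (Fin.last D, l)) ⊤) ⊤ = l := by
  let A := MvPolynomial (Fin (D + 1) × Fin m) R
  let L := Localization.AtPrime (pol R (Fin (D + 1) × Fin m))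
  let f : A ⊗[R] M →ₗ[A] L ⊗[A] (A ⊗[R] M) := TensorProduct.mk A L (A ⊗[R] M) 1
  have : IsLocalizedModule (pol R (Fin (D + 1) × Fin m)).primeCompl f :=
    (isLocalizedModule_iff_isBaseChange _ L _).2 (TensorProduct.isBaseChange A _ L)
  exact exists_uniform_of_isLocalizedModule L (E := L ⊗[A] (A ⊗[R] M)) f hres hI hx h

lemma mem_pol_iff {R κ : Type*} [CommRing R] [IsLocalRing R] (F : MvPolynomial κ R) (c : κ → R) :
    MvPolynomial.eval c F ∈ maximalIdeal R ↔
      MvPolynomial.eval (fun p => residue R (c p)) (MvPolynomial.map (residue R) F) = 0 := by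
  rw [← residue_eq_zero_iff, MvPolynomial.eval_map, MvPolynomial.eval,
    MvPolynomial.coe_eval₂Hom, MvPolynomial.eval₂_comp_left, RingHom.comp_id]
  rfl

/-- The `j`-multiplicity is the length of a general specialization. -/
lemma exists_jMult_eq {R M : Type*} {D m : ℕ} [CommRing R] [IsLocalRing R] [IsNoetherianRing R]
    [AddCommGroup M] [Module R M] [Module.Finite R M] (hres : Infinite (ResidueField R))
    {I : Ideal R} (hI : I ≤ maximalIdeal R) {x : Fin m → R} (hx : Ideal.span (Set.range x) = I)
    (h : mDim R M ≤ ((D + 1 : ℕ) : WithBot ℕ∞)) :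
    ∃ F ∉ pol R (Fin (D + 1) × Fin m), ∀ c, MvPolynomial.eval c F ∉ maximalIdeal R →
      ∃ K, K = satur I (Ideal.span (Set.range fun j : Fin D => lin x fun l => c (j.castSucc, l)) • ⊤ :
        Submodule R M) ∧ Good I K (lin x fun l => c (Fin.last D, l)) ∧
        jMult (maximalIdeal R) I M (D + 1) =
          (rlen (K ⊔ am (lin x fun l => c (Fin.last D, l)) ⊤) ⊤).toNat := by
  obtain ⟨l, F, hF, hFc⟩ := exists_uniform hres hI hx h
  refine ⟨F, hF, fun c hc => ?_⟩
  obtain ⟨K, hK, hG, hl⟩ := hFc c hc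
  refine ⟨K, hK, hG, ?_⟩
  rw [hl]
  have hg : IsGeneric (resFilter R) := by
    have := isGeneric_map hres (RingHom.id R) 0
    simpa using this
  have hrow : ∀ _ : Fin (D + 1), IsGenericRow (seqFilter m fun _ => resFilter R) := fun _ =>
    isGenericRow_seqFilter _ fun _ => hg
  have hne := seqFilter_neBot _ fun j => (hrow j).neBot
  obtain ⟨c', ⟨K', hK', -, ht⟩, hc'⟩ := ((eventually_formula hI hx D M _ hrow
    (dimLE_of_mDim_le h)).and (eventually_eval_ne_zero (fun _ _ => resFilter R) (fun _ _ => hg)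
      (MvPolynomial.map (residue R) F) hF)).exists
  obtain ⟨K'', hK'', -, hl'⟩ := hFc (fun p => c' p.1 p.2) fun hh => hc' ((mem_pol_iff _ _).1 hh)
  rw [hK', ← hK'', hl'] at ht
  rw [jMult]
  refine Tendsto.limUnder_eq ?_
  simpa only [mLength_H0_gradedPiece, Nat.add_sub_cancel] using ht

end Final

end JMul

/-- Theorem 3.6 (length formula): for general elements `a₁, …, a_{d−1}, a_d` of `I`,
`j_d(I, M) = e(I; M/((a₁, …, a_{d−1})M :_M I^∞))
           = length_R (M/(((a₁, …, a_{d−1})M :_M I^∞) + a_d M))`. -/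
theorem stmt_10 {R : Type*} [CommRing R] [IsNoetherianRing R] [IsLocalRing R]
    (hdim : 0 < ringKrullDim R) (hres : Infinite (IsLocalRing.ResidueField R))
    (I : Ideal R) (hI : I ≠ ⊤)
    (M : Type*) [AddCommGroup M] [Module R M] [Module.Finite R M]
    (d : ℕ) (hd : 0 < d) (hMd : mDim R M ≤ (d : WithBot ℕ∞)) :
    GeneralElts (IsLocalRing.maximalIdeal R) I d fun a =>
      jMult (IsLocalRing.maximalIdeal R) I M d =
        hsMult I (M ⧸ satur I
          (Ideal.span (Set.range fun j : Fin (d - 1) => a (Fin.castLE (Nat.sub_le d 1) j)) • ⊤ :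
            Submodule R M)) 1 ∧
      jMult (IsLocalRing.maximalIdeal R) I M d =
        ((mLength R (M ⧸ (satur I
            (Ideal.span (Set.range fun j : Fin (d - 1) =>
              a (Fin.castLE (Nat.sub_le d 1) j)) • ⊤ : Submodule R M) ⊔
          Ideal.span {a ⟨d - 1, Nat.sub_lt hd Nat.one_pos⟩} • ⊤))).toNat : ℝ) := by
  intro m x hx
  obtain ⟨D, rfl⟩ : ∃ D, d = D + 1 := ⟨d - 1, by omega⟩
  obtain ⟨F, hF, hFc⟩ := JMul.exists_jMult_eq hres (IsLocalRing.le_maximalIdeal hI) hx hMd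
  refine ⟨F, hF, fun c hc => ?_⟩
  obtain ⟨K, hK, hG, hj⟩ := hFc c fun h => hc ((JMul.mem_pol_iff F c).1 h)
  refine Eq.subst (motive := fun K' => jMult (IsLocalRing.maximalIdeal R) I M (D + 1) =
    hsMult I (M ⧸ K') 1 ∧ jMult (IsLocalRing.maximalIdeal R) I M (D + 1) =
      ((mLength R (M ⧸ (K' ⊔ Ideal.span {JMul.lin x fun l => c (Fin.last D, l)} • ⊤))).toNat :
        ℝ)) hK ?_
  rw [hG.hsMult_eq, JMul.mLength_eq, ← JMul.rlen_top, ← JMul.am_eq]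
  exact ⟨hj, hj⟩

end
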